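/- For every ε > 0, as X → ∞ one has M₂(X,q) ∼ C·∏_{p∣q}(1+2p^{-1})^{-1}·X^{1/2}q^{1/2}, uniformly for integers q in the range X^{31/41+ε} ≤ q ≤ X^{1−ε}. -/

import Mathlib

open scoped BigOperators

/-- The singular constant `C(q) = (6/π²)·∏_{p∣q}(1−p^{-2})^{-1}`. -/
noncomputable def Cq (q : ℕ) : ℝ :=
  (6 / Real.pi ^ 2) * ∏ p ∈ q.primeFactors, (1 - ((p : ℝ))⁻¹ ^ 2)⁻¹

/-- The error term `E(X,q,a)`. -/
noncomputable def Eterm (X : ℝ) (q a : ℕ) : ℝ :=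
  (∑ n ∈ (Finset.Icc 1 ⌊X⌋₊).filter (fun n => n % q = a % q),
    ((ArithmeticFunction.moebius n : ℤ) : ℝ) ^ 2) - Cq q * X / q

/-- The variance `M₂(X,q) = Σ*_{a mod q} |E(X,q,a)|²`. -/
noncomputable def M2 (X : ℝ) (q : ℕ) : ℝ :=
  ∑ a ∈ (Finset.range q).filter (fun a => Nat.Coprime a q), (Eterm X q a) ^ 2

/-- The constant `C = (ζ(3/2)/π)·∏_p (p³−3p+2)/p³`. -/
noncomputable def Cmain : ℝ :=
  ((riemannZeta (3 / 2)).re / Real.pi) *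
    ∏' p : Nat.Primes, ((((p : ℕ) : ℝ) ^ 3 - 3 * ((p : ℕ) : ℝ) + 2) / ((p : ℕ) : ℝ) ^ 3)

namespace SqV
open Finset

/-- multiples counted in a class -/
lemma count_class (M : ℕ) (hM : 0 < M) (c : ℤ) (α β : ℝ) (h : α ≤ β) :
    |((((Finset.Ioc ⌊α⌋ ⌊β⌋).filter (fun n => n ≡ c [ZMOD (M:ℤ)])).card : ℕ) : ℝ) - (β - α) / M| ≤ 1 := by
  have hM' : (0:ℤ) < (M:ℤ) := by exact_mod_cast hM
  have hMR : (0:ℝ) < (M:ℝ) := by exact_mod_cast hM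
  have e := Int.Ioc_filter_modEq_card ⌊α⌋ ⌊β⌋ hM' c
  have key : ∀ γ : ℝ, ⌊(((⌊γ⌋:ℤ):ℚ) - (c:ℚ)) / ((M:ℤ):ℚ)⌋ = ⌊(γ - c) / M⌋ := by
    intro γ
    rw [Int.floor_eq_iff]
    constructor
    · have h1 : (⌊(γ - c) / M⌋ : ℝ) ≤ (γ - c)/M := Int.floor_le _
      rw [le_div_iff₀ hMR] at h1
      have h2 : ⌊(γ - c) / M⌋ * (M:ℤ) + c ≤ ⌊γ⌋ := by
        rw [Int.le_floor]; push_cast; linarith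
      rw [le_div_iff₀ (by exact_mod_cast hM)]
      have h3 : ((⌊(γ - c) / M⌋ * (M:ℤ) + c : ℤ):ℚ) ≤ (⌊γ⌋:ℚ) := by exact_mod_cast h2
      push_cast at h3 ⊢; linarith
    · have h1 : (γ - c)/M < (⌊(γ - c) / M⌋ : ℝ) + 1 := Int.lt_floor_add_one _
      rw [div_lt_iff₀ hMR] at h1
      have h2 : ⌊γ⌋ < (⌊(γ - c) / M⌋ + 1) * (M:ℤ) + c := by
        rw [Int.floor_lt]; push_cast; linarith
      rw [div_lt_iff₀ (by exact_mod_cast hM)]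
      have h3 : (⌊γ⌋:ℚ) < (((⌊(γ - c) / M⌋ + 1) * (M:ℤ) + c : ℤ):ℚ)  := by exact_mod_cast h2
      push_cast at h3 ⊢; linarith
  rw [key, key] at e
  have hmono : ⌊(α - c) / M⌋ ≤ ⌊(β - c) / M⌋ := by
    apply Int.floor_le_floor; gcongr
  rw [max_eq_left (by linarith)] at e
  have e' : ((((Finset.Ioc ⌊α⌋ ⌊β⌋).filter (fun n => n ≡ c [ZMOD (M:ℤ)])).card : ℕ) : ℝ) = (⌊(β - c) / M⌋:ℝ) - ⌊(α - c) / M⌋ := by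
    exact_mod_cast e
  rw [e']
  have a1 : (⌊(α - c) / M⌋ : ℝ) ≤ (α - c)/M := Int.floor_le _
  have a2 : (α - c)/M < (⌊(α - c) / M⌋ : ℝ) + 1 := Int.lt_floor_add_one _
  have a3 : (⌊(β - c) / M⌋ : ℝ) ≤ (β - c)/M := Int.floor_le _
  have a4 : (β - c)/M < (⌊(β - c) / M⌋ : ℝ) + 1 := Int.lt_floor_add_one _
  have a5 : (β - α) / M = (β - c)/M - (α - c)/M := by ring
  rw [a5, abs_le]; constructor <;> linarith

lemma sum_moebius_div (q : ℕ) (hq : 0 < q) :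
    ∑ r ∈ q.divisors, (ArithmeticFunction.moebius r : ℝ) / r = (q.totient : ℝ) / q := by
  have h := (ArithmeticFunction.sum_eq_iff_sum_mul_moebius_eq (R := ℝ) (f := fun n => (n.totient : ℝ))
    (g := fun n => (n:ℝ))).1 (by
      intro n hn
      exact_mod_cast Nat.sum_totient n) q hq
  rw [← h, Finset.sum_div, Nat.sum_divisorsAntidiagonal (fun a b => (ArithmeticFunction.moebius a : ℝ) * (b:ℝ) / q)]
  apply Finset.sum_congr rfl
  intro r hr
  have hr' := Nat.dvd_of_mem_divisors hr
  have hr0 : (r:ℝ) ≠ 0 := by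
    have := Nat.pos_of_mem_divisors hr; positivity
  have hq0 : (q:ℝ) ≠ 0 := by positivity
  rw [Nat.cast_div hr' hr0]
  field_simp

lemma moebius_abs_le (n : ℕ) : |(ArithmeticFunction.moebius n : ℝ)| ≤ 1 := by
  have := ArithmeticFunction.abs_moebius_le_one (n := n)
  exact_mod_cast this

lemma sum_moebius_ind (m : ℕ) (hm : 0 < m) :
    ∑ r ∈ m.divisors, (ArithmeticFunction.moebius r : ℝ) = if m = 1 then 1 else 0 := by
  rw [← ArithmeticFunction.one_apply, ← ArithmeticFunction.coe_moebius_mul_coe_zeta (R := ℝ),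
    ArithmeticFunction.coe_mul_zeta_apply]
  simp

lemma coprime_ind (n : ℤ) (q : ℕ) (hq : 0 < q) :
    (if Int.gcd n q = 1 then (1:ℝ) else 0) =
      ∑ r ∈ q.divisors, if (r:ℤ) ∣ n then (ArithmeticFunction.moebius r : ℝ) else 0 := by
  have hg : 0 < Int.gcd n q := Int.gcd_pos_of_ne_zero_right _ (by exact_mod_cast hq.ne')
  rw [← sum_moebius_ind _ hg, ← Finset.sum_filter]
  apply Finset.sum_congr _ (fun _ _ => rfl)
  ext r
  simp only [Nat.mem_divisors, Finset.mem_filter]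
  constructor
  · rintro ⟨h1, h2⟩
    refine ⟨⟨?_, hq.ne'⟩, ?_⟩
    · have := Int.gcd_dvd_right n (q:ℤ)
      exact Int.natCast_dvd_natCast.1 ((Int.natCast_dvd_natCast.2 h1).trans this)
    · exact (Int.natCast_dvd_natCast.2 h1).trans (Int.gcd_dvd_left n (q:ℤ))
  · rintro ⟨⟨h1, h2⟩, h3⟩
    exact ⟨by
      have := Int.dvd_coe_gcd h3 (Int.natCast_dvd_natCast.2 h1)
      exact_mod_cast this, hg.ne'⟩

lemma count_class_coprime (L q : ℕ) (hL : 0 < L) (hq : 0 < q) (hc : Nat.Coprime L q) (c : ℤ) (α β : ℝ)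
    (h : α ≤ β) :
    |((((Finset.Ioc ⌊α⌋ ⌊β⌋).filter (fun n => n ≡ c [ZMOD (L:ℤ)] ∧ Int.gcd n q = 1)).card : ℕ) : ℝ)
      - (q.totient : ℝ) / q * ((β - α) / L)| ≤ (q.divisors.card : ℝ) := by
  have e1 : ((((Finset.Ioc ⌊α⌋ ⌊β⌋).filter (fun n => n ≡ c [ZMOD (L:ℤ)] ∧ Int.gcd n q = 1)).card : ℕ) : ℝ)
      = ∑ r ∈ q.divisors, (ArithmeticFunction.moebius r : ℝ) *
        ((((Finset.Ioc ⌊α⌋ ⌊β⌋).filter (fun n => n ≡ c [ZMOD (L:ℤ)] ∧ (r:ℤ) ∣ n)).card : ℕ) : ℝ) := by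
    rw [Finset.card_filter]
    push_cast
    have : ∀ n : ℤ, (if n ≡ c [ZMOD (L:ℤ)] ∧ Int.gcd n q = 1 then (1:ℝ) else 0) =
       ∑ r ∈ q.divisors, (ArithmeticFunction.moebius r : ℝ) * (if n ≡ c [ZMOD (L:ℤ)] ∧ (r:ℤ) ∣ n then 1 else 0) := by
      intro n
      by_cases hn : n ≡ c [ZMOD (L:ℤ)]
      · simp only [hn, true_and]
        rw [coprime_ind n q hq]
        apply Finset.sum_congr rfl; intro r _; split_ifs <;> simp
      · simp [hn]
    rw [Finset.sum_congr rfl (fun n _ => this n), Finset.sum_comm]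
    apply Finset.sum_congr rfl; intro r _
    rw [← Finset.mul_sum, Finset.card_filter]; push_cast; rfl
  rw [e1, ← sum_moebius_div q hq, Finset.sum_mul, ← Finset.sum_sub_distrib]
  refine (Finset.abs_sum_le_sum_abs _ _).trans ?_
  rw [Finset.card_eq_sum_ones]; push_cast
  apply Finset.sum_le_sum
  intro r hr
  have hr0 : 0 < r := Nat.pos_of_mem_divisors hr
  have hrc : Nat.Coprime L r := Nat.Coprime.coprime_dvd_right (Nat.dvd_of_mem_divisors hr) hc
  obtain ⟨x, hx1, hx2⟩ : ∃ x : ℤ, x ≡ c [ZMOD (L:ℤ)] ∧ x ≡ 0 [ZMOD (r:ℤ)] := by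
    have hcop : IsCoprime (L:ℤ) (r:ℤ) := Nat.isCoprime_iff_coprime.2 hrc
    obtain ⟨u, v, huv⟩ := hcop
    refine ⟨c * (v * r), ?_, ?_⟩
    · rw [Int.modEq_iff_dvd]; exact ⟨c * u, by linear_combination (-c) * huv⟩
    · rw [Int.modEq_iff_dvd]; exact ⟨-c*v, by ring⟩
  have hset : (Finset.Ioc ⌊α⌋ ⌊β⌋).filter (fun n => n ≡ c [ZMOD (L:ℤ)] ∧ (r:ℤ) ∣ n) =
     (Finset.Ioc ⌊α⌋ ⌊β⌋).filter (fun n => n ≡ x [ZMOD ((L * r : ℕ):ℤ)]) := by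
    apply Finset.filter_congr
    intro n _
    push_cast
    rw [← Int.modEq_and_modEq_iff_modEq_mul (by simpa using hrc)]
    constructor
    · rintro ⟨h1, h2⟩; exact ⟨h1.trans hx1.symm, (Int.modEq_zero_iff_dvd.2 h2).trans hx2.symm⟩
    · rintro ⟨h1, h2⟩; exact ⟨h1.trans hx1, Int.modEq_zero_iff_dvd.1 (h2.trans hx2)⟩
  rw [hset]
  have hb := count_class (L*r) (by positivity) x α β h
  have e2 : (ArithmeticFunction.moebius r : ℝ) / r * ((β - α) / L) =
    (ArithmeticFunction.moebius r : ℝ) * ((β - α) / ((L*r:ℕ):ℝ)) := by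
    push_cast; field_simp
  rw [e2, ← mul_sub, abs_mul]
  calc _ ≤ 1 * 1 := mul_le_mul (moebius_abs_le r) hb (abs_nonneg _) zero_le_one
    _ = 1 := by ring

/-- sum over square divisors -/
lemma moebius_sq_sum (n N : ℕ) (hn : 0 < n) (hN : n ≤ N) :
    ((ArithmeticFunction.moebius n : ℤ) : ℝ)^2 =
      ∑ d ∈ (Finset.Icc 1 N).filter (fun d => d^2 ∣ n), (ArithmeticFunction.moebius d : ℝ) := by
  obtain ⟨a, b, hab, ha⟩ := Nat.sq_mul_squarefree n
  have hb0 : 0 < b := by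
    rcases Nat.eq_zero_or_pos b with h | h
    · subst h; simp at hab; omega
    · exact h
  have hset : (Finset.Icc 1 N).filter (fun d => d^2 ∣ n) = b.divisors := by
    ext d
    simp only [Finset.mem_filter, Finset.mem_Icc, Nat.mem_divisors]
    constructor
    · rintro ⟨⟨h1, h2⟩, h3⟩
      refine ⟨?_, hb0.ne'⟩
      have hd0 : d ≠ 0 := by omega
      rw [← Nat.factorization_le_iff_dvd hd0 hb0.ne']
      have ha0 : a ≠ 0 := ha.ne_zero
      rw [← hab, ← Nat.factorization_le_iff_dvd (by positivity) (by positivity),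
        Nat.factorization_mul (by positivity) ha0, Nat.factorization_pow, Nat.factorization_pow] at h3
      intro p
      have h4 := h3 p
      have h5 := ha.natFactorization_le_one p
      simp at h4
      omega
    · rintro ⟨h1, h2⟩
      have hd : d ^ 2 ∣ n := by rw [← hab]; exact (pow_dvd_pow_of_dvd h1 2).mul_right a
      have hd0 := Nat.pos_of_dvd_of_pos h1 hb0
      refine ⟨⟨hd0, ?_⟩, hd⟩
      exact (Nat.le_self_pow two_ne_zero d).trans ((Nat.le_of_dvd hn hd).trans hN)
  rw [hset, sum_moebius_ind b hb0]
  split_ifs with h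
  · subst h
    have : Squarefree n := by rw [← hab]; simpa using ha
    have := ArithmeticFunction.moebius_sq_eq_one_of_squarefree this
    exact_mod_cast this
  · have : ¬ Squarefree n := by
      intro hs
      apply h
      have := hs b (by rw [← hab]; exact ⟨a, by ring⟩)
      exact Nat.isUnit_iff.1 this
    rw [ArithmeticFunction.moebius_eq_zero_of_not_squarefree this]; simp

lemma divisor_bound (η : ℝ) (hη : 0 < η) :
    ∃ C : ℝ, 0 < C ∧ ∀ n : ℕ, 0 < n → (n.divisors.card : ℝ) ≤ C * (n:ℝ)^η := by
  obtain ⟨B, hB⟩ := exists_nat_ge ((2:ℝ)^(1/η))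
  set c : ℝ := max 1 (1 / (η * Real.log 2)) with hc
  have hlog : 0 < Real.log 2 := Real.log_pos (by norm_num)
  have hc1 : 1 ≤ c := le_max_left _ _
  refine ⟨c^B, by positivity, ?_⟩
  intro n hn
  rw [Nat.card_divisors hn.ne']
  have e1 : (n:ℝ)^η = ∏ p ∈ n.primeFactors, ((p:ℝ)^(n.factorization p))^η := by
    rw [Real.finsetProd_rpow _ _ (fun i _ => by positivity)]
    congr 1
    conv_lhs => rw [← Nat.prod_factorization_pow_eq_self hn.ne']
    rw [Nat.prod_factorization_eq_prod_primeFactors]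
    push_cast; rfl
  have e2 : ∏ p ∈ n.primeFactors, (if p < B then c else 1) ≤ c^B := by
    rw [Finset.prod_ite, Finset.prod_const, Finset.prod_const_one, mul_one]
    apply pow_le_pow_right₀ hc1
    calc _ ≤ (Finset.range B).card := Finset.card_le_card (by intro p; simp)
      _ = B := Finset.card_range B
  calc _ = ∏ p ∈ n.primeFactors, ((n.factorization p : ℝ) + 1) := by push_cast; rfl
    _ ≤ ∏ p ∈ n.primeFactors, ((if p < B then c else 1) * ((p:ℝ)^(n.factorization p))^η) := by
        apply Finset.prod_le_prod
        · intro p _; positivity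
        · intro p hp
          have hp2 : (2:ℝ) ≤ p := by exact_mod_cast (Nat.prime_of_mem_primeFactors hp).two_le
          set a := n.factorization p
          split_ifs with h
          · have h1 : (2:ℝ)^((a:ℝ)*η) ≤ ((p:ℝ)^a)^η := by
              rw [← Real.rpow_natCast, ← Real.rpow_mul (by positivity)]
              exact Real.rpow_le_rpow (by norm_num) hp2 (by positivity)
            have h2 : (a:ℝ) * η * Real.log 2 + 1 ≤ (2:ℝ)^((a:ℝ)*η) := by
              rw [Real.rpow_def_of_pos (by norm_num), mul_comm (Real.log 2)]
              exact Real.add_one_le_exp _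
            have h3 : 1 ≤ c * (η * Real.log 2) := by
              have : 1 / (η * Real.log 2) ≤ c := le_max_right _ _
              rwa [div_le_iff₀ (by positivity)] at this
            have ha : (0:ℝ) ≤ a := by positivity
            calc (a:ℝ) + 1 ≤ c * ((a:ℝ) * η * Real.log 2 + 1) := by nlinarith
              _ ≤ _ := by gcongr; linarith
          · have hpB : (2:ℝ)^(1/η) ≤ p := hB.trans (by exact_mod_cast not_lt.1 h)
            have h1 : (2:ℝ) ≤ (p:ℝ)^η := by
              calc (2:ℝ) = ((2:ℝ)^(1/η))^η := by
                    rw [← Real.rpow_mul (by norm_num), one_div_mul_cancel hη.ne', Real.rpow_one]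
                _ ≤ _ := Real.rpow_le_rpow (by positivity) hpB hη.le
            have h2 : ((p:ℝ)^a)^η = ((p:ℝ)^η)^a := by
              rw [← Real.rpow_natCast, ← Real.rpow_mul (by positivity), mul_comm, Real.rpow_mul (by positivity), Real.rpow_natCast]
            rw [one_mul, h2]
            calc (a:ℝ) + 1 ≤ (2:ℝ)^a := by exact_mod_cast Nat.lt_two_pow_self
              _ ≤ _ := by gcongr
    _ = (∏ p ∈ n.primeFactors, (if p < B then c else 1)) * (n:ℝ)^η := by
        rw [Finset.prod_mul_distrib, e1]
    _ ≤ _ := by gcongr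

lemma divisor_mono_card (n d : ℕ) (hn : 0 < n) (h : d ∣ n) : d.divisors.card ≤ n.divisors.card :=
  Finset.card_le_card (Nat.divisors_subset_of_dvd hn.ne' h)

/-- tails of sum of inverse squares -/
lemma inv_sq_tail (D N : ℕ) (hD : 0 < D) : ∑ d ∈ Finset.Ioc D N, (1:ℝ) / (d:ℝ)^2 ≤ (1:ℝ) / (D:ℝ) := by
  have := sum_Ioc_inv_sq_le_sub (α := ℝ) hD.ne' (n := max D N) (le_max_left _ _)
  rcases le_or_gt D N with h | h
  · rw [max_eq_right h] at this
    simp only [one_div]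
    have h2 : (0:ℝ) ≤ (N:ℝ)⁻¹ := by positivity
    linarith
  · rw [Finset.Ioc_eq_empty (by omega)]; simp

end SqV

namespace SqV
open Finset

lemma sum_over_a (q N : ℕ) (hq : 0 < q) (f g : ℕ → ℝ) :
    ∑ a ∈ (Finset.range q).filter (fun a => Nat.Coprime a q),
      (∑ n ∈ (Finset.Icc 1 N).filter (fun n => n % q = a % q), f n) *
      (∑ n ∈ (Finset.Icc 1 N).filter (fun n => n % q = a % q), g n) =
    ∑ n₁ ∈ Finset.Icc 1 N, ∑ n₂ ∈ Finset.Icc 1 N,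
      if n₁ % q = n₂ % q ∧ Nat.Coprime n₁ q then f n₁ * g n₂ else 0 := by
  have h1 : ∀ a, (∑ n ∈ (Finset.Icc 1 N).filter (fun n => n % q = a % q), f n) *
      (∑ n ∈ (Finset.Icc 1 N).filter (fun n => n % q = a % q), g n) =
      ∑ n₁ ∈ Finset.Icc 1 N, ∑ n₂ ∈ Finset.Icc 1 N,
        if n₁ % q = a % q ∧ n₂ % q = a % q then f n₁ * g n₂ else 0 := by
    intro a
    rw [Finset.sum_filter, Finset.sum_filter, Finset.sum_mul_sum]
    apply Finset.sum_congr rfl; intro n₁ _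
    apply Finset.sum_congr rfl; intro n₂ _
    by_cases h1 : n₁ % q = a % q <;> by_cases h2 : n₂ % q = a % q <;> simp [h1, h2]
  rw [Finset.sum_congr rfl (fun a _ => h1 a), Finset.sum_comm]
  apply Finset.sum_congr rfl; intro n₁ _
  rw [Finset.sum_comm]
  apply Finset.sum_congr rfl; intro n₂ _
  rw [Finset.sum_filter]
  have hcop : Nat.Coprime (n₁ % q) q ↔ Nat.Coprime n₁ q := by
    rw [Nat.coprime_iff_gcd_eq_one, Nat.coprime_iff_gcd_eq_one, Nat.gcd_comm n₁ q, ← Nat.gcd_rec]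
  rw [Finset.sum_eq_single (n₁ % q)]
  · simp only [Nat.mod_mod, hcop]
    by_cases h1 : Nat.Coprime n₁ q <;> by_cases h2 : n₁ % q = n₂ % q
    · simp [h1, h2]
    · have : ¬ (n₂ % q = n₁ % q) := fun h => h2 h.symm
      simp [h1, h2, this]
    · simp [h1]
    · simp [h1]
  · intro a ha hne
    rw [Finset.mem_range] at ha
    rw [Nat.mod_eq_of_lt ha]
    have : ¬ (n₁ % q = a) := fun h => hne h.symm
    simp [this]
  · intro h
    exact absurd (Finset.mem_range.2 (Nat.mod_lt _ hq)) h

lemma sum_over_a1 (q N : ℕ) (hq : 0 < q) (f : ℕ → ℝ) :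
    ∑ a ∈ (Finset.range q).filter (fun a => Nat.Coprime a q),
      (∑ n ∈ (Finset.Icc 1 N).filter (fun n => n % q = a % q), f n) =
    ∑ n ∈ Finset.Icc 1 N, if Nat.Coprime n q then f n else 0 := by
  simp_rw [Finset.sum_filter (s := Finset.Icc 1 N)]
  rw [Finset.sum_comm]
  apply Finset.sum_congr rfl; intro n₁ _
  rw [Finset.sum_filter]
  have hcop : Nat.Coprime (n₁ % q) q ↔ Nat.Coprime n₁ q := by
    rw [Nat.coprime_iff_gcd_eq_one, Nat.coprime_iff_gcd_eq_one, Nat.gcd_comm n₁ q, ← Nat.gcd_rec]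
  rw [Finset.sum_eq_single (n₁ % q)]
  · simp only [Nat.mod_mod, hcop]; simp
  · intro a ha hne
    rw [Finset.mem_range] at ha
    rw [Nat.mod_eq_of_lt ha]
    have : ¬ (n₁ % q = a) := fun h => hne h.symm
    simp [this]
  · intro h
    exact absurd (Finset.mem_range.2 (Nat.mod_lt _ hq)) h

noncomputable def hh (t : ℝ) : ℝ := Int.fract t * (1 - Int.fract t)

lemma sum_tri_aux (t : ℝ) (J : ℕ) :
    ∑ j ∈ Finset.Icc (-(J:ℤ)) (J:ℤ), (t - |(j:ℝ)|) = (2 * J + 1) * t - J * (J + 1) := by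
  induction J with
  | zero => simp
  | succ J ih =>
    have : Finset.Icc (-((J+1:ℕ):ℤ)) ((J+1:ℕ):ℤ) = insert (-((J+1:ℕ):ℤ)) (insert ((J+1:ℕ):ℤ) (Finset.Icc (-(J:ℤ)) (J:ℤ))) := by
      ext x; simp only [Finset.mem_insert, Finset.mem_Icc]; push_cast; omega
    rw [this, Finset.sum_insert (by simp only [Finset.mem_insert, Finset.mem_Icc]; push_cast; omega),
      Finset.sum_insert (by simp only [Finset.mem_Icc]; push_cast; omega), ih]
    have h1 : |((-((J+1:ℕ):ℤ) : ℤ):ℝ)| = J + 1 := by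
      push_cast; rw [abs_of_nonpos (by linarith [(Nat.cast_nonneg J : (0:ℝ) ≤ J)])]; ring
    have h2 : |((((J+1:ℕ):ℤ) : ℤ):ℝ)| = J + 1 := by
      push_cast; rw [abs_of_nonneg (by linarith [(Nat.cast_nonneg J : (0:ℝ) ≤ J)])]
    rw [h1, h2]; push_cast; ring

lemma sum_tri (t : ℝ) (ht : 0 ≤ t) :
    ∑ j ∈ Finset.Icc (-⌊t⌋) ⌊t⌋, (t - |(j:ℝ)|) = t^2 + hh t := by
  obtain ⟨J, hJ⟩ := Int.eq_ofNat_of_zero_le (Int.floor_nonneg.2 ht)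
  have h := Int.floor_add_fract t
  rw [hJ, sum_tri_aux, hh]
  rw [hJ] at h
  have : Int.fract t = t - J := by push_cast at h; linarith
  rw [this]; ring

lemma sum_tri_dvd (s : ℕ) (hs : 0 < s) (K : ℝ) (hK : 0 ≤ K) :
    ∑ k ∈ (Finset.Icc (-⌊K⌋) ⌊K⌋).filter (fun k => (s:ℤ) ∣ k), (K - |(k:ℝ)|) =
      s * ((K/s)^2 + hh (K/s)) := by
  have hsR : (0:ℝ) < s := by exact_mod_cast hs
  rw [← sum_tri (K/s) (by positivity), Finset.mul_sum]
  symm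
  apply Finset.sum_bij (fun (j:ℤ) _ => (s:ℤ) * j)
  · intro j hj
    rw [Finset.mem_Icc] at hj
    rw [Finset.mem_filter, Finset.mem_Icc]
    have h1 : (j:ℝ) ≤ K/s := Int.le_floor.1 hj.2
    have h2 : ((-j:ℤ):ℝ) ≤ K/s := Int.le_floor.1 (by linarith [hj.1])
    rw [le_div_iff₀ hsR] at h1 h2
    refine ⟨⟨?_, ?_⟩, dvd_mul_right _ _⟩
    · have : -((s:ℤ) * j) ≤ ⌊K⌋ := by rw [Int.le_floor]; push_cast at h2 ⊢; linarith
      linarith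
    · rw [Int.le_floor]; push_cast; linarith
  · intro a _ b _ h
    exact mul_left_cancel₀ (by exact_mod_cast hs.ne') h
  · intro k hk
    rw [Finset.mem_filter, Finset.mem_Icc] at hk
    obtain ⟨⟨h1, h2⟩, j, rfl⟩ := hk
    refine ⟨j, ?_, rfl⟩
    have h3 : (((s:ℤ)*j : ℤ):ℝ) ≤ K := Int.le_floor.1 h2
    have h4 : ((-((s:ℤ)*j) : ℤ):ℝ) ≤ K := Int.le_floor.1 (by linarith)
    push_cast at h3 h4
    rw [Finset.mem_Icc]
    constructor
    · have : -j ≤ ⌊K/s⌋ := by rw [Int.le_floor, le_div_iff₀ hsR]; push_cast; linarith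
      linarith
    · rw [Int.le_floor, le_div_iff₀ hsR]; linarith
  · intro j _
    push_cast
    rw [abs_mul, abs_of_pos hsR]; field_simp

/-- number of pairs -/
noncomputable def PP (N q d₁ d₂ : ℕ) : ℕ := ((Finset.Icc 1 N ×ˢ Finset.Icc 1 N).filter (fun n : ℕ × ℕ =>
  d₁^2 ∣ n.1 ∧ d₂^2 ∣ n.2 ∧ n.1 % q = n.2 % q ∧ Nat.Coprime n.1 q)).card

noncomputable def TT (X : ℝ) (q d₁ d₂ : ℕ) (k : ℤ) : Finset ℤ :=
  (Finset.Ioc ⌊max 0 (-(k:ℝ)*q)⌋ ⌊X - max 0 ((k:ℝ)*q)⌋).filter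
    (fun n => ((d₁^2:ℕ):ℤ) ∣ n ∧ ((d₂^2:ℕ):ℤ) ∣ n + k * q ∧ Int.gcd n q = 1)

lemma mem_TT_bounds (X : ℝ) (q : ℕ) (k n : ℤ) :
    n ∈ Finset.Ioc ⌊max 0 (-(k:ℝ)*q)⌋ ⌊X - max 0 ((k:ℝ)*q)⌋ ↔
      0 < n ∧ 0 < n + k * q ∧ (n:ℝ) ≤ X ∧ ((n + k * q : ℤ):ℝ) ≤ X := by
  rw [Finset.mem_Ioc, Int.floor_lt, Int.le_floor, max_lt_iff, le_sub_iff_add_le, add_comm, ← le_sub_iff_add_le, max_le_iff]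
  constructor
  · rintro ⟨⟨h1, h2⟩, h3, h4⟩
    refine ⟨by exact_mod_cast h1, ?_, by linarith, by push_cast; linarith⟩
    have : (0:ℝ) < ((n + k * q : ℤ) : ℝ) := by push_cast; linarith
    exact_mod_cast this
  · rintro ⟨h1, h2, h3, h4⟩
    have h1' : (0:ℝ) < n := by exact_mod_cast h1
    have h2' : (0:ℝ) < ((n + k * q : ℤ) : ℝ) := by exact_mod_cast h2
    push_cast at h2' h4
    refine ⟨⟨h1', by linarith⟩, by linarith, by linarith⟩

lemma PP_eq (X : ℝ) (hX : 0 ≤ X) (q d₁ d₂ : ℕ) (hq : 0 < q) :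
    PP ⌊X⌋₊ q d₁ d₂ = ∑ k ∈ Finset.Icc (-⌊X/q⌋) ⌊X/q⌋, (TT X q d₁ d₂ k).card := by
  have hqR : (0:ℝ) < q := by exact_mod_cast hq
  have hqZ : (q:ℤ) ≠ 0 := by exact_mod_cast hq.ne'
  unfold PP
  rw [Finset.card_eq_sum_card_fiberwise (f := fun n : ℕ × ℕ => ((n.2:ℤ) - n.1) / q) (t := Finset.Icc (-⌊X/q⌋) ⌊X/q⌋)]
  · apply Finset.sum_congr rfl
    intro k _
    apply Finset.card_bij (fun (n : ℕ × ℕ) _ => (n.1 : ℤ))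
    · rintro ⟨n₁, n₂⟩ hn
      simp only [Finset.mem_filter, Finset.mem_product, Finset.mem_Icc] at hn
      obtain ⟨⟨⟨⟨h1, h2⟩, h3, h4⟩, h5, h6, h7, h8⟩, h9⟩ := hn
      have h10 : (q:ℤ) ∣ (n₂:ℤ) - n₁ := (Nat.modEq_iff_dvd).1 h7
      have h11 : (n₂:ℤ) = n₁ + k * q := by
        rw [← h9, Int.ediv_mul_cancel h10]; ring
      unfold TT
      rw [Finset.mem_filter, mem_TT_bounds, ← h11]
      refine ⟨⟨by exact_mod_cast h1, by exact_mod_cast h3, ?_, ?_⟩, by exact_mod_cast h5, by exact_mod_cast h6, by exact_mod_cast h8⟩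
      · exact_mod_cast (Nat.le_floor_iff hX).1 h2
      · exact_mod_cast (Nat.le_floor_iff hX).1 h4
    · rintro ⟨n₁, n₂⟩ hn ⟨m₁, m₂⟩ hm h
      simp only [Finset.mem_filter, Finset.mem_product, Finset.mem_Icc] at hn hm
      have h10 : (q:ℤ) ∣ (n₂:ℤ) - n₁ := (Nat.modEq_iff_dvd).1 hn.1.2.2.2.1
      have h11 : (q:ℤ) ∣ (m₂:ℤ) - m₁ := (Nat.modEq_iff_dvd).1 hm.1.2.2.2.1
      have e1 := Int.ediv_mul_cancel h10
      have e2 := Int.ediv_mul_cancel h11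
      rw [hn.2] at e1
      rw [hm.2] at e2
      simp only [Prod.mk.injEq]
      have h' : (n₁:ℤ) = m₁ := h
      omega
    · intro n hn
      unfold TT at hn
      rw [Finset.mem_filter, mem_TT_bounds] at hn
      obtain ⟨⟨h1, h2, h3, h4⟩, h5, h6, h7⟩ := hn
      obtain ⟨n₁, rfl⟩ := Int.eq_ofNat_of_zero_le h1.le
      obtain ⟨n₂, h8⟩ := Int.eq_ofNat_of_zero_le h2.le
      refine ⟨(n₁, n₂), ?_, rfl⟩
      rw [h8] at h2 h4 h6
      simp only [Finset.mem_filter, Finset.mem_product, Finset.mem_Icc]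
      have h10 : (n₂:ℤ) - n₁ = k * q := by rw [← h8]; ring
      refine ⟨⟨⟨⟨by exact_mod_cast h1, ?_⟩, by exact_mod_cast h2, ?_⟩, by exact_mod_cast h5, by exact_mod_cast h6, ?_, by exact_mod_cast h7⟩, ?_⟩
      · exact (Nat.le_floor_iff hX).2 (by exact_mod_cast h3)
      · exact (Nat.le_floor_iff hX).2 (by exact_mod_cast h4)
      · exact (Nat.modEq_iff_dvd).2 ⟨k, by rw [h10]; ring⟩
      · rw [h10, Int.mul_ediv_cancel _ hqZ]
  · rintro ⟨n₁, n₂⟩ hn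
    simp only [Finset.coe_filter, Finset.mem_product, Finset.mem_Icc, Set.mem_ofPred_eq] at hn
    obtain ⟨⟨⟨h1, h2⟩, h3, h4⟩, h5, h6, h7, h8⟩ := hn
    have h10 : (q:ℤ) ∣ (n₂:ℤ) - n₁ := (Nat.modEq_iff_dvd).1 h7
    obtain ⟨k, hk⟩ := h10
    simp only [Finset.coe_Icc, Set.mem_Icc]
    rw [hk, Int.mul_ediv_cancel_left _ hqZ]
    have hk' : (n₂:ℝ) - n₁ = q * k := by exact_mod_cast hk
    have h2' := (Nat.le_floor_iff hX).1 h2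
    have h4' := (Nat.le_floor_iff hX).1 h4
    have h1' : (0:ℝ) ≤ n₁ := by positivity
    have h3' : (0:ℝ) ≤ n₂ := by positivity
    constructor
    · have : -k ≤ ⌊X/q⌋ := by rw [Int.le_floor, le_div_iff₀ hqR]; push_cast; linarith
      linarith
    · rw [Int.le_floor, le_div_iff₀ hqR]; linarith

lemma TT_card (X : ℝ) (q d₁ d₂ : ℕ) (hq : 0 < q) (hd₁ : 0 < d₁) (hd₂ : 0 < d₂)
    (hc₁ : Nat.Coprime d₁ q) (hc₂ : Nat.Coprime d₂ q) (k : ℤ) (hk : |(k:ℝ)| ≤ X / q) :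
    |((TT X q d₁ d₂ k).card : ℝ) - (if ((Nat.gcd d₁ d₂ ^ 2 : ℕ):ℤ) ∣ k then
      (q.totient : ℝ) / q * ((X - |(k:ℝ)| * q) / ((d₁ * d₂ : ℝ)^2 / (Nat.gcd d₁ d₂ : ℝ)^2)) else 0)|
      ≤ (q.divisors.card : ℝ) := by
  have hqR : (0:ℝ) < q := by exact_mod_cast hq
  set δ := Nat.gcd d₁ d₂ with hδ
  have hδ0 : 0 < δ := Nat.gcd_pos_of_pos_left _ hd₁
  have hδq : Nat.Coprime δ q := Nat.Coprime.coprime_dvd_left (Nat.gcd_dvd_left _ _) hc₁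
  have hgcd : Nat.gcd (d₁^2) (d₂^2) = δ^2 := by rw [hδ, Nat.pow_gcd_pow]
  by_cases hdv : ((δ ^ 2 : ℕ):ℤ) ∣ k
  · rw [if_pos hdv]
    have hcop : (Nat.lcm (d₁^2) (d₂^2)).Coprime q := by
      apply Nat.Coprime.coprime_dvd_left (Nat.lcm_dvd_mul _ _)
      exact Nat.Coprime.mul_left (hc₁.pow_left 2) (hc₂.pow_left 2)
    have hL : 0 < Nat.lcm (d₁^2) (d₂^2) := Nat.lcm_pos (by positivity) (by positivity)
    have hLR : ((Nat.lcm (d₁^2) (d₂^2) : ℕ):ℝ) = (d₁ * d₂ : ℝ)^2 / (δ : ℝ)^2 := by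
      have := Nat.gcd_mul_lcm (d₁^2) (d₂^2)
      rw [hgcd] at this
      have h2 : (δ:ℝ)^2 * ((Nat.lcm (d₁^2) (d₂^2) : ℕ):ℝ) = (d₁:ℝ)^2 * (d₂:ℝ)^2 := by exact_mod_cast this
      rw [eq_div_iff (by positivity), mul_comm, h2]; ring
    obtain ⟨x, hx1, hx2⟩ : ∃ x : ℤ, ((d₁^2:ℕ):ℤ) ∣ x ∧ ((d₂^2:ℕ):ℤ) ∣ x + k * q := by
      have hb := Int.gcd_eq_gcd_ab ((d₁^2:ℕ):ℤ) ((d₂^2:ℕ):ℤ)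
      rw [Int.gcd_natCast_natCast, hgcd] at hb
      obtain ⟨j, hj⟩ := hdv
      rw [hb] at hj
      refine ⟨- (((d₁^2:ℕ):ℤ) * Int.gcdA _ _ * j * q), ⟨-(Int.gcdA ((d₁^2:ℕ):ℤ) ((d₂^2:ℕ):ℤ) * j * q), by ring⟩, ⟨Int.gcdB ((d₁^2:ℕ):ℤ) ((d₂^2:ℕ):ℤ) * j * q, ?_⟩⟩
      rw [hj]; ring
    have hset : TT X q d₁ d₂ k = (Finset.Ioc ⌊max 0 (-(k:ℝ)*q)⌋ ⌊X - max 0 ((k:ℝ)*q)⌋).filter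
        (fun n => n ≡ x [ZMOD ((Nat.lcm (d₁^2) (d₂^2) : ℕ):ℤ)] ∧ Int.gcd n q = 1) := by
      unfold TT
      apply Finset.filter_congr
      intro n _
      rw [← and_assoc]
      apply and_congr_left'
      rw [Int.modEq_iff_dvd, ← Int.lcm_natCast_natCast, ]
      constructor
      · rintro ⟨h1, h2⟩
        apply Int.coe_lcm_dvd
        · exact dvd_sub hx1 h1
        · have := dvd_sub hx2 h2; simpa using this
      · intro h
        have h1 := (Int.dvd_lcm_left ((d₁^2:ℕ):ℤ) ((d₂^2:ℕ):ℤ)).trans h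
        have h2 := (Int.dvd_lcm_right ((d₁^2:ℕ):ℤ) ((d₂^2:ℕ):ℤ)).trans h
        constructor
        · have := dvd_sub hx1 h1; simpa using this
        · have := dvd_sub hx2 h2; ring_nf at this ⊢; exact this
    rw [hset]
    have hlen : (X - max 0 ((k:ℝ)*q)) - max 0 (-(k:ℝ)*q) = X - |(k:ℝ)| * q := by
      rcases le_total 0 (k:ℝ) with h | h
      · rw [abs_of_nonneg h, max_eq_right (by positivity), max_eq_left (by nlinarith)]; ring
      · rw [abs_of_nonpos h, max_eq_left (by nlinarith), max_eq_right (by nlinarith)]; ring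
    have hle : max 0 (-(k:ℝ)*q) ≤ X - max 0 ((k:ℝ)*q) := by
      rw [le_div_iff₀ hqR] at hk; linarith
    have := count_class_coprime _ q hL hq hcop x _ _ hle
    rwa [hlen, hLR] at this
  · rw [if_neg hdv]
    have : TT X q d₁ d₂ k = ∅ := by
      rw [Finset.eq_empty_iff_forall_notMem]
      intro n hn
      unfold TT at hn
      rw [Finset.mem_filter] at hn
      apply hdv
      have h1 : ((δ ^ 2 : ℕ):ℤ) ∣ n := (Int.natCast_dvd_natCast.2 (pow_dvd_pow_of_dvd (Nat.gcd_dvd_left _ _) 2)).trans hn.2.1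
      have h2 : ((δ ^ 2 : ℕ):ℤ) ∣ n + k * q := (Int.natCast_dvd_natCast.2 (pow_dvd_pow_of_dvd (Nat.gcd_dvd_right _ _) 2)).trans hn.2.2.1
      have h3 : ((δ ^ 2 : ℕ):ℤ) ∣ k * q := by have := dvd_sub h2 h1; simpa using this
      have h4 : IsCoprime ((δ ^ 2 : ℕ):ℤ) (q:ℤ) := Nat.isCoprime_iff_coprime.2 (hδq.pow_left 2)
      exact h4.dvd_of_dvd_mul_right h3
    rw [this]; simp

lemma PP_asymp (X : ℝ) (q d₁ d₂ : ℕ) (hq : 0 < q) (hqX : (q:ℝ) ≤ X) (hd₁ : 0 < d₁) (hd₂ : 0 < d₂)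
    (hc₁ : Nat.Coprime d₁ q) (hc₂ : Nat.Coprime d₂ q) :
    |(PP ⌊X⌋₊ q d₁ d₂ : ℝ) - (q.totient : ℝ) * ((X/q)^2 / (d₁ * d₂ : ℝ)^2 +
      (Nat.gcd d₁ d₂ : ℝ)^4 * hh (X/q / (Nat.gcd d₁ d₂ : ℝ)^2) / (d₁ * d₂ : ℝ)^2)| ≤
      3 * (X/q) * (q.divisors.card : ℝ) := by
  have hqR : (0:ℝ) < q := by exact_mod_cast hq
  have hX : 0 ≤ X := hqR.le.trans hqX
  have hK1 : 1 ≤ X/q := by rwa [le_div_iff₀ hqR, one_mul]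
  set δ := Nat.gcd d₁ d₂ with hδ
  have hδ0 : 0 < δ := Nat.gcd_pos_of_pos_left _ hd₁
  have hδR : (0:ℝ) < δ := by exact_mod_cast hδ0
  have hd₁R : (0:ℝ) < d₁ := by exact_mod_cast hd₁
  have hd₂R : (0:ℝ) < d₂ := by exact_mod_cast hd₂
  have main : (q.totient : ℝ) * ((X/q)^2 / (d₁ * d₂ : ℝ)^2 +
      (δ : ℝ)^4 * hh (X/q / (δ : ℝ)^2) / (d₁ * d₂ : ℝ)^2) =
      ∑ k ∈ Finset.Icc (-⌊X/q⌋) ⌊X/q⌋, (if ((δ ^ 2 : ℕ):ℤ) ∣ k then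
      (q.totient : ℝ) / q * ((X - |(k:ℝ)| * q) / ((d₁ * d₂ : ℝ)^2 / (δ : ℝ)^2)) else 0) := by
    rw [← Finset.sum_filter]
    have e : ∀ k : ℤ, (q.totient : ℝ) / q * ((X - |(k:ℝ)| * q) / ((d₁ * d₂ : ℝ)^2 / (δ : ℝ)^2)) =
      ((q.totient : ℝ) * (δ : ℝ)^2 / (d₁ * d₂ : ℝ)^2) * (X / q - |(k:ℝ)|) := by
      intro k; field_simp
    rw [Finset.sum_congr rfl (fun k _ => e k), ← Finset.mul_sum, sum_tri_dvd (δ^2) (by positivity) _ (by positivity)]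
    push_cast
    field_simp
  rw [main, PP_eq X hX q d₁ d₂ hq]
  push_cast
  rw [← Finset.sum_sub_distrib]
  refine (Finset.abs_sum_le_sum_abs _ _).trans ?_
  refine (Finset.sum_le_sum (g := fun _ => (q.divisors.card : ℝ)) ?_).trans ?_
  · intro k hk
    rw [Finset.mem_Icc] at hk
    have h1 : (k:ℝ) ≤ X/q := Int.le_floor.1 hk.2
    have h2 : ((-k:ℤ):ℝ) ≤ X/q := Int.le_floor.1 (by linarith [hk.1])
    push_cast at h2
    have := TT_card X q d₁ d₂ hq hd₁ hd₂ hc₁ hc₂ k (abs_le.2 ⟨by linarith, h1⟩)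
    push_cast at this ⊢
    exact this
  · rw [Finset.sum_const, nsmul_eq_mul, Int.card_Icc]
    gcongr
    have h0 : 0 ≤ ⌊X/q⌋ := Int.floor_nonneg.2 (by positivity)
    have h1 : (⌊X/q⌋:ℝ) ≤ X/q := Int.floor_le _
    have : (((⌊X/q⌋ + 1 - -⌊X/q⌋).toNat : ℕ):ℝ) = ((⌊X/q⌋ + 1 - -⌊X/q⌋ : ℤ):ℝ) := by
      rw [← Int.cast_natCast, Int.toNat_of_nonneg (by linarith)]
    rw [this]; push_cast; linarith

end SqV

namespace SqV
open Finset

noncomputable def Ad (N q d a : ℕ) : ℝ :=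
  ∑ n ∈ (Finset.Icc 1 N).filter (fun n => n % q = a % q), (if d^2 ∣ n then (1:ℝ) else 0)

def DD (q D : ℕ) : Finset ℕ := (Finset.Icc 1 D).filter (fun d => Nat.Coprime d q)

noncomputable def FF (X : ℝ) (q D a : ℕ) : ℝ :=
  ∑ d ∈ DD q D, (ArithmeticFunction.moebius d : ℝ) * (Ad ⌊X⌋₊ q d a - X / q / (d:ℝ)^2)

noncomputable def TD (K : ℝ) (q D : ℕ) : ℝ :=
  ∑ d₁ ∈ DD q D, ∑ d₂ ∈ DD q D, (ArithmeticFunction.moebius d₁ : ℝ) * (ArithmeticFunction.moebius d₂ : ℝ) *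
    ((Nat.gcd d₁ d₂ : ℝ)^4 * hh (K / (Nat.gcd d₁ d₂ : ℝ)^2) / (d₁ * d₂ : ℝ)^2)

def CA (q : ℕ) : Finset ℕ := (Finset.range q).filter (fun a => Nat.Coprime a q)

lemma CA_card (q : ℕ) : (CA q).card = q.totient := by
  unfold CA
  rw [Nat.totient_eq_card_coprime]
  congr 1
  apply Finset.filter_congr
  intro a _; exact Nat.coprime_comm

lemma sum_Ad_Ad (N q d₁ d₂ : ℕ) (hq : 0 < q) :
    ∑ a ∈ CA q, Ad N q d₁ a * Ad N q d₂ a = PP N q d₁ d₂ := by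
  unfold CA Ad PP
  rw [sum_over_a q N hq, Finset.card_filter, Finset.sum_product]
  push_cast
  apply Finset.sum_congr rfl; intro n₁ _
  apply Finset.sum_congr rfl; intro n₂ _
  by_cases h1 : d₁^2 ∣ n₁ <;> by_cases h2 : d₂^2 ∣ n₂ <;> simp [h1, h2]

lemma sum_Ad (X : ℝ) (hX : 0 ≤ X) (q d : ℕ) (hq : 0 < q) (hd : 0 < d) (hc : Nat.Coprime d q) :
    |∑ a ∈ CA q, Ad ⌊X⌋₊ q d a - (q.totient : ℝ) * (X / q / (d:ℝ)^2)| ≤ (q.divisors.card : ℝ) := by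
  unfold CA Ad
  rw [sum_over_a1 q _ hq]
  have h := count_class_coprime (d^2) q (by positivity) hq (hc.pow_left 2) 0 0 X hX
  have e : ∑ n ∈ Finset.Icc 1 ⌊X⌋₊, (if Nat.Coprime n q then (if d^2 ∣ n then (1:ℝ) else 0) else 0) =
     ((((Finset.Ioc ⌊(0:ℝ)⌋ ⌊X⌋).filter (fun n => n ≡ 0 [ZMOD ((d^2:ℕ):ℤ)] ∧ Int.gcd n q = 1)).card : ℕ) : ℝ) := by
    have : ∀ n : ℕ, (if Nat.Coprime n q then (if d^2 ∣ n then (1:ℝ) else 0) else 0) = if (d^2 ∣ n ∧ Nat.Coprime n q) then 1 else 0 := by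
      intro n; by_cases h1 : Nat.Coprime n q <;> by_cases h2 : d^2 ∣ n <;> simp [h1, h2]
    rw [Finset.sum_congr rfl (fun n _ => this n), Finset.sum_boole]
    norm_cast
    apply Finset.card_bij (fun (n:ℕ) _ => (n:ℤ))
    · intro n hn
      rw [Finset.mem_filter, Finset.mem_Icc] at hn
      rw [Finset.mem_filter, Finset.mem_Ioc]
      refine ⟨⟨?_, ?_⟩, ?_, ?_⟩
      · simp; omega
      · rw [Int.le_floor]; exact_mod_cast (Nat.le_floor_iff hX).1 hn.1.2
      · exact Int.modEq_zero_iff_dvd.2 (by exact_mod_cast hn.2.1)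
      · exact_mod_cast hn.2.2
    · intro a _ b _ h; exact_mod_cast h
    · intro n hn
      rw [Finset.mem_filter, Finset.mem_Ioc] at hn
      have hn0 : 0 < n := by simpa using hn.1.1
      obtain ⟨m, rfl⟩ := Int.eq_ofNat_of_zero_le hn0.le
      refine ⟨m, ?_, rfl⟩
      rw [Finset.mem_filter, Finset.mem_Icc]
      refine ⟨⟨by exact_mod_cast hn0, ?_⟩, ?_, ?_⟩
      · have := Int.le_floor.1 hn.1.2
        exact (Nat.le_floor_iff hX).2 (by exact_mod_cast this)
      · have := Int.modEq_zero_iff_dvd.1 hn.2.1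
        exact_mod_cast this
      · exact_mod_cast hn.2.2
  rw [e]
  have e2 : (q.totient : ℝ) * (X / q / (d:ℝ)^2) = (q.totient : ℝ) / q * ((X - 0) / ((d^2:ℕ):ℝ)) := by
    push_cast; ring
  rw [e2]; exact h

lemma FF_norm (X : ℝ) (q D : ℕ) (hq : 0 < q) (hqX : (q:ℝ) ≤ X) :
    |∑ a ∈ CA q, (FF X q D a)^2 - (q.totient : ℝ) * TD (X/q) q D| ≤
      (D:ℝ)^2 * (5 * (X/q) * (q.divisors.card : ℝ)) := by
  have hqR : (0:ℝ) < q := by exact_mod_cast hq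
  have hX : 0 ≤ X := hqR.le.trans hqX
  set K := X/q with hK
  have hK0 : 0 ≤ K := by positivity
  have e1 : ∑ a ∈ CA q, (FF X q D a)^2 = ∑ d₁ ∈ DD q D, ∑ d₂ ∈ DD q D,
     (ArithmeticFunction.moebius d₁ : ℝ) * (ArithmeticFunction.moebius d₂ : ℝ) *
      ((PP ⌊X⌋₊ q d₁ d₂ : ℝ) - K / (d₂:ℝ)^2 * ∑ a ∈ CA q, Ad ⌊X⌋₊ q d₁ a
        - K / (d₁:ℝ)^2 * ∑ a ∈ CA q, Ad ⌊X⌋₊ q d₂ a + q.totient * (K / (d₁:ℝ)^2 * (K / (d₂:ℝ)^2))) := by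
    unfold FF
    simp_rw [sq (∑ d ∈ DD q D, _), Finset.sum_mul_sum]
    rw [Finset.sum_comm]
    apply Finset.sum_congr rfl; intro d₁ _
    rw [Finset.sum_comm]
    apply Finset.sum_congr rfl; intro d₂ _
    rw [← sum_Ad_Ad _ _ _ _ hq, Finset.mul_sum, Finset.mul_sum, ← CA_card, Finset.card_eq_sum_ones]
    push_cast
    rw [Finset.sum_mul, ← Finset.sum_sub_distrib, ← Finset.sum_sub_distrib, ← Finset.sum_add_distrib, Finset.mul_sum]
    apply Finset.sum_congr rfl; intro a _
    ring
  rw [e1, TD, Finset.mul_sum, ← Finset.sum_sub_distrib]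
  have hcard : ((DD q D).card : ℝ) ≤ D := by
    have : (DD q D).card ≤ (Finset.Icc 1 D).card := Finset.card_filter_le _ _
    rw [Nat.card_Icc] at this
    exact_mod_cast (by omega : (DD q D).card ≤ D)
  have hB : 0 ≤ 5 * K * (q.divisors.card : ℝ) := by positivity
  have key : ∀ d₁ ∈ DD q D, ∀ d₂ ∈ DD q D,
     |(ArithmeticFunction.moebius d₁ : ℝ) * (ArithmeticFunction.moebius d₂ : ℝ) *
      ((PP ⌊X⌋₊ q d₁ d₂ : ℝ) - K / (d₂:ℝ)^2 * ∑ a ∈ CA q, Ad ⌊X⌋₊ q d₁ a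
        - K / (d₁:ℝ)^2 * ∑ a ∈ CA q, Ad ⌊X⌋₊ q d₂ a + q.totient * (K / (d₁:ℝ)^2 * (K / (d₂:ℝ)^2)))
      - (q.totient : ℝ) * ((ArithmeticFunction.moebius d₁ : ℝ) * (ArithmeticFunction.moebius d₂ : ℝ) *
    ((Nat.gcd d₁ d₂ : ℝ)^4 * hh (K / (Nat.gcd d₁ d₂ : ℝ)^2) / (d₁ * d₂ : ℝ)^2))| ≤ 5 * K * (q.divisors.card : ℝ) := by
    intro d₁ h₁ d₂ h₂
    unfold DD at h₁ h₂
    rw [Finset.mem_filter, Finset.mem_Icc] at h₁ h₂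
    have hd₁ : 0 < d₁ := h₁.1.1
    have hd₂ : 0 < d₂ := h₂.1.1
    have hd₁R : (1:ℝ) ≤ d₁ := by exact_mod_cast hd₁
    have hd₂R : (1:ℝ) ≤ d₂ := by exact_mod_cast hd₂
    have a1 := PP_asymp X q d₁ d₂ hq hqX hd₁ hd₂ h₁.2 h₂.2
    have a2 := sum_Ad X hX q d₁ hq hd₁ h₁.2
    have a3 := sum_Ad X hX q d₂ hq hd₂ h₂.2
    rw [← hK] at a1 a2 a3
    set P : ℝ := (PP ⌊X⌋₊ q d₁ d₂ : ℝ)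
    set S₁ := ∑ a ∈ CA q, Ad ⌊X⌋₊ q d₁ a
    set S₂ := ∑ a ∈ CA q, Ad ⌊X⌋₊ q d₂ a
    set t : ℝ := (q.divisors.card : ℝ)
    set H := (Nat.gcd d₁ d₂ : ℝ)^4 * hh (K / (Nat.gcd d₁ d₂ : ℝ)^2) / (d₁ * d₂ : ℝ)^2
    have a4 : |(K / (d₂:ℝ)^2) * (S₁ - q.totient * (K / (d₁:ℝ)^2))| ≤ K * t := by
      rw [abs_mul, abs_of_nonneg (by positivity : 0 ≤ K / (d₂:ℝ)^2)]
      apply mul_le_mul _ a2 (abs_nonneg _) hK0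
      apply div_le_self hK0; nlinarith
    have a5 : |(K / (d₁:ℝ)^2) * (S₂ - q.totient * (K / (d₂:ℝ)^2))| ≤ K * t := by
      rw [abs_mul, abs_of_nonneg (by positivity : 0 ≤ K / (d₁:ℝ)^2)]
      apply mul_le_mul _ a3 (abs_nonneg _) hK0
      apply div_le_self hK0; nlinarith
    have e2 : (ArithmeticFunction.moebius d₁ : ℝ) * (ArithmeticFunction.moebius d₂ : ℝ) *
      (P - K / (d₂:ℝ)^2 * S₁ - K / (d₁:ℝ)^2 * S₂ + q.totient * (K / (d₁:ℝ)^2 * (K / (d₂:ℝ)^2)))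
      - (q.totient : ℝ) * ((ArithmeticFunction.moebius d₁ : ℝ) * (ArithmeticFunction.moebius d₂ : ℝ) * H) =
      ((ArithmeticFunction.moebius d₁ : ℝ) * (ArithmeticFunction.moebius d₂ : ℝ)) *
       ((P - q.totient * (K^2 / (d₁ * d₂ : ℝ)^2 + H)) - (K / (d₂:ℝ)^2) * (S₁ - q.totient * (K / (d₁:ℝ)^2))
         - (K / (d₁:ℝ)^2) * (S₂ - q.totient * (K / (d₂:ℝ)^2))) := by
      field_simp; ring
    rw [e2, abs_mul, abs_mul]
    have m1 := moebius_abs_le d₁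
    have m2 := moebius_abs_le d₂
    have m3 : |(ArithmeticFunction.moebius d₁ : ℝ)| * |(ArithmeticFunction.moebius d₂ : ℝ)| ≤ 1 :=
      mul_le_one₀ m1 (abs_nonneg _) m2
    have a6 : |(P - q.totient * (K^2 / (d₁ * d₂ : ℝ)^2 + H)) - (K / (d₂:ℝ)^2) * (S₁ - q.totient * (K / (d₁:ℝ)^2))
         - (K / (d₁:ℝ)^2) * (S₂ - q.totient * (K / (d₂:ℝ)^2))| ≤ 5 * K * t := by
      refine (abs_sub _ _).trans ?_
      refine (add_le_add_left (abs_sub _ _) _).trans ?_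
      linarith
    calc _ ≤ 1 * (5 * K * t) := mul_le_mul m3 a6 (abs_nonneg _) zero_le_one
      _ = _ := one_mul _
  calc _ ≤ ∑ d₁ ∈ DD q D, ∑ d₂ ∈ DD q D, (5 * K * (q.divisors.card : ℝ)) := by
        refine (Finset.abs_sum_le_sum_abs _ _).trans ?_
        apply Finset.sum_le_sum; intro d₁ h₁
        rw [Finset.mul_sum, ← Finset.sum_sub_distrib]
        refine (Finset.abs_sum_le_sum_abs _ _).trans ?_
        apply Finset.sum_le_sum; intro d₂ h₂
        exact key d₁ h₁ d₂ h₂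
    _ = ((DD q D).card : ℝ)^2 * (5 * K * (q.divisors.card : ℝ)) := by
        rw [Finset.sum_const, Finset.sum_const, nsmul_eq_mul, nsmul_eq_mul]; ring
    _ ≤ _ := by gcongr

end SqV

namespace SqV
open Finset

lemma frac_eq (q s a b c d : ℕ) (hs : s * s ≤ q) (ha : 1 ≤ a ∧ a ≤ s) (hb : 1 ≤ b ∧ b ≤ s)
    (hc : 1 ≤ c ∧ c ≤ s) (hd : 1 ≤ d ∧ d ≤ s) (hab : Nat.Coprime a b) (hcd : Nat.Coprime c d)
    (h : (q:ℤ) ∣ (a:ℤ) * d - c * b) : a = c ∧ b = d := by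
  have h1 : 1 ≤ a * d := Nat.mul_pos ha.1 hd.1
  have h2 : a * d ≤ q := (Nat.mul_le_mul ha.2 hd.2).trans hs
  have h3 : 1 ≤ c * b := Nat.mul_pos hc.1 hb.1
  have h4 : c * b ≤ q := (Nat.mul_le_mul hc.2 hb.2).trans hs
  have h5 : (a:ℤ) * d - c * b = 0 := by
    apply Int.eq_zero_of_abs_lt_dvd h
    rw [abs_lt]; zify at *; constructor <;> linarith
  have h6 : a * d = c * b := by zify; linarith
  have h7 : a ∣ c := hab.dvd_of_dvd_mul_right (Dvd.intro _ h6)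
  have h8 : c ∣ a := hcd.dvd_of_dvd_mul_right (Dvd.intro _ h6.symm)
  have h9 := Nat.dvd_antisymm h7 h8
  subst h9
  exact ⟨rfl, (Nat.eq_of_mul_eq_mul_left ha.1 h6).symm⟩

/-- the set of coprime pairs -/
def SS (q s m₁ m₂ : ℕ) : Finset (ℕ × ℕ) :=
  ((Icc 1 s) ×ˢ (Icc 1 s)).filter (fun e => Nat.Coprime e.1 e.2 ∧ Nat.Coprime e.1 q ∧ Nat.Coprime e.2 q ∧
    Nat.Coprime m₁ q ∧ Nat.Coprime m₂ q ∧ (q:ℤ) ∣ (m₁:ℤ) * e.1^2 - m₂ * e.2^2)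

lemma SS_card (q s m₁ m₂ : ℕ) (hq : 0 < q) (hs : s * s ≤ q) :
    (SS q s m₁ m₂).card ≤ 2 * q.divisors.card := by
  rcases (SS q s m₁ m₂).eq_empty_or_nonempty with h0 | ⟨⟨f₁, f₂⟩, hf⟩
  · rw [h0]; simp
  have mem : ∀ e : ℕ × ℕ, e ∈ SS q s m₁ m₂ → (1 ≤ e.1 ∧ e.1 ≤ s) ∧ (1 ≤ e.2 ∧ e.2 ≤ s) ∧ Nat.Coprime e.1 e.2 ∧ IsCoprime (e.1:ℤ) q ∧ IsCoprime (e.2:ℤ) q ∧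
    IsCoprime (m₁:ℤ) q ∧ IsCoprime (m₂:ℤ) q ∧ (q:ℤ) ∣ (m₁:ℤ) * e.1^2 - m₂ * e.2^2 := by
    intro e he
    simp only [SS, mem_filter, mem_product, mem_Icc] at he
    exact ⟨he.1.1, he.1.2, he.2.1, Nat.isCoprime_iff_coprime.2 he.2.2.1, Nat.isCoprime_iff_coprime.2 he.2.2.2.1,
      Nat.isCoprime_iff_coprime.2 he.2.2.2.2.1, Nat.isCoprime_iff_coprime.2 he.2.2.2.2.2.1, he.2.2.2.2.2.2⟩
  obtain ⟨-, -, -, cf1, cf2, cm1, cm2, df⟩ := mem _ hf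
  set φ : ℕ × ℕ → ℕ := fun e => Int.gcd ((e.1:ℤ) * f₂ - e.2 * f₁) q with hφ
  have key : ∀ e ∈ SS q s m₁ m₂, ∀ e' ∈ SS q s m₁ m₂, φ e = φ e' → (q:ℤ) ∣ 2 * ((e.1:ℤ) * e'.2 - e'.1 * e.2) := by
    intro e he e' he' hee
    have hprod : ∀ e ∈ SS q s m₁ m₂, (q:ℤ) ∣ ((e.1:ℤ) * f₂ - e.2 * f₁) * ((e.1:ℤ) * f₂ + e.2 * f₁) := by
      intro e he
      obtain ⟨-, -, -, ce1, ce2, _, _, de⟩ := mem _ he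
      have : (q:ℤ) ∣ m₁ * (((e.1:ℤ) * f₂ - e.2 * f₁) * ((e.1:ℤ) * f₂ + e.2 * f₁)) := by
        have e1 : (m₁:ℤ) * (((e.1:ℤ) * f₂ - e.2 * f₁) * ((e.1:ℤ) * f₂ + e.2 * f₁)) =
          (m₁ * (e.1:ℤ)^2 - m₂ * e.2^2) * f₂^2 - (m₁ * (f₁:ℤ)^2 - m₂ * f₂^2) * e.2^2 := by ring
        rw [e1]
        exact dvd_sub (de.mul_right _) (df.mul_right _)
      exact cm1.symm.dvd_of_dvd_mul_left this
    have hfac : ∀ e ∈ SS q s m₁ m₂, ((φ e : ℕ):ℤ) ∣ ((e.1:ℤ) * f₂ - e.2 * f₁) ∧ ∃ k : ℤ, (q:ℤ) = φ e * k ∧ k ∣ ((e.1:ℤ) * f₂ + e.2 * f₁) := by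
      intro e he
      have g1 : ((φ e : ℕ):ℤ) ∣ ((e.1:ℤ) * f₂ - e.2 * f₁) := Int.gcd_dvd_left _ _
      have g2 : ((φ e : ℕ):ℤ) ∣ (q:ℤ) := Int.gcd_dvd_right _ _
      refine ⟨g1, ?_⟩
      obtain ⟨k, hk⟩ := g2
      obtain ⟨l, hl⟩ := g1
      refine ⟨k, hk, ?_⟩
      have hpos : 0 < φ e := Int.gcd_pos_of_ne_zero_right _ (by exact_mod_cast hq.ne')
      have hcop : IsCoprime l k := by
        have := Int.gcd_mul_left (φ e) l k
        rw [← hl, ← hk] at this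
        change φ e = _ at this
        rw [Int.natAbs_natCast] at this
        rw [Int.isCoprime_iff_gcd_eq_one]
        exact (Nat.eq_of_mul_eq_mul_left hpos (by linarith)).symm
      have hp := hprod e he
      rw [hl] at hp
      nth_rewrite 1 [hk] at hp
      rw [mul_assoc] at hp
      have hp2 := Int.dvd_of_mul_dvd_mul_left (by exact_mod_cast hpos.ne') hp
      exact hcop.symm.dvd_of_dvd_mul_left hp2
    obtain ⟨a1, k, hk, a2⟩ := hfac e he
    obtain ⟨b1, k', hk', b2⟩ := hfac e' he'
    rw [← hee] at b1 hk'
    have hpos : 0 < φ e := Int.gcd_pos_of_ne_zero_right _ (by exact_mod_cast hq.ne')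
    have : k' = k := by
      have : ((φ e:ℕ):ℤ) * k' = φ e * k := by rw [← hk, ← hk']
      exact mul_left_cancel₀ (by exact_mod_cast hpos.ne') this
    subst this
    obtain ⟨-, -, -, ce1, ce2, -, -, de⟩ := mem _ he
    set g : ℤ := ((φ e : ℕ) : ℤ) with hg
    have hgq : g ∣ q := ⟨k', hk⟩
    have hkq : k' ∣ q := ⟨g, by rw [hk]; ring⟩
    have w1 : g ∣ ((e.1:ℤ) * e'.2 - e'.1 * e.2) := by
      have : g ∣ f₂ * ((e.1:ℤ) * e'.2 - e'.1 * e.2) := by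
        have e1 : (f₂:ℤ) * ((e.1:ℤ) * e'.2 - e'.1 * e.2) = ((e.1:ℤ) * f₂ - e.2 * f₁) * e'.2 - ((e'.1:ℤ) * f₂ - e'.2 * f₁) * e.2 := by ring
        rw [e1]; exact dvd_sub (a1.mul_right _) (b1.mul_right _)
      exact (cf2.symm.of_isCoprime_of_dvd_left hgq).dvd_of_dvd_mul_left this
    have w2 : k' ∣ ((e.1:ℤ) * e'.2 - e'.1 * e.2) := by
      have : k' ∣ f₂ * ((e.1:ℤ) * e'.2 - e'.1 * e.2) := by
        have e1 : (f₂:ℤ) * ((e.1:ℤ) * e'.2 - e'.1 * e.2) = ((e.1:ℤ) * f₂ + e.2 * f₁) * e'.2 - ((e'.1:ℤ) * f₂ + e'.2 * f₁) * e.2 := by ring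
        rw [e1]; exact dvd_sub (a2.mul_right _) (b2.mul_right _)
      exact (cf2.symm.of_isCoprime_of_dvd_left hkq).dvd_of_dvd_mul_left this
    -- gcd g k' divides 2
    have w3 : ((Int.gcd g k' : ℕ):ℤ) ∣ 2 := by
      have d1 : ((Int.gcd g k' : ℕ):ℤ) ∣ 2 * ((e.1:ℤ) * f₂) := by
        have := dvd_add ((Int.gcd_dvd_left g k').trans a1) ((Int.gcd_dvd_right g k').trans a2)
        have e1 : (e.1:ℤ) * f₂ - e.2 * f₁ + (e.1 * f₂ + e.2 * f₁) = 2 * ((e.1:ℤ) * f₂) := by ring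
        rwa [e1] at this
      have d2 : IsCoprime ((e.1:ℤ) * f₂) (Int.gcd g k' : ℕ) :=
        (ce1.mul_left cf2).of_isCoprime_of_dvd_right ((Int.gcd_dvd_left g k').trans hgq)
      exact d2.symm.dvd_of_dvd_mul_right d1
    have w4 : (q:ℤ) ∣ (Int.gcd g k' : ℕ) * ((e.1:ℤ) * e'.2 - e'.1 * e.2) := by
      obtain ⟨x, y, hxy⟩ : ∃ x y : ℤ, ((Int.gcd g k' : ℕ):ℤ) = g * x + k' * y := ⟨_, _, Int.gcd_eq_gcd_ab g k'⟩
      rw [hxy, add_mul, hk]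
      refine dvd_add ?_ ?_
      · rw [mul_assoc]; exact mul_dvd_mul_left _ (w2.mul_left _)
      · rw [mul_comm g k', mul_assoc]; exact mul_dvd_mul_left _ (w1.mul_left _)
    exact w4.trans (mul_dvd_mul_right w3 _)
  have hmaps : ∀ e ∈ SS q s m₁ m₂, φ e ∈ q.divisors := by
    intro e _
    rw [Nat.mem_divisors]
    exact ⟨Int.natCast_dvd_natCast.1 (Int.gcd_dvd_right _ _), hq.ne'⟩
  apply Finset.card_le_mul_card_image_of_maps_to hmaps
  intro g _
  by_contra hcon
  push Not at hcon
  obtain ⟨a, ha, b, hb, c, hc, hab, hac, hbc⟩ := Finset.two_lt_card.1 hcon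
  rw [mem_filter] at ha hb hc
  have ma := mem _ ha.1
  have mb := mem _ hb.1
  have mc := mem _ hc.1
  have neq : ∀ x ∈ SS q s m₁ m₂, ∀ y ∈ SS q s m₁ m₂, x ≠ y → ¬ (q:ℤ) ∣ ((x.1:ℤ) * y.2 - y.1 * x.2) := by
    intro x hx y hy hxy h
    have mx := mem _ hx
    have my := mem _ hy
    have := frac_eq q s x.1 x.2 y.1 y.2 hs mx.1 mx.2.1 my.1 my.2.1 mx.2.2.1 my.2.2.1 h
    exact hxy (Prod.ext this.1 this.2)
  obtain ⟨i, hi⟩ := key b hb.1 a ha.1 (hb.2.trans ha.2.symm)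
  obtain ⟨j, hj⟩ := key c hc.1 a ha.1 (hc.2.trans ha.2.symm)
  have n1 := neq b hb.1 a ha.1 hab.symm
  have n2 := neq c hc.1 a ha.1 hac.symm
  have odd : ∀ (w i : ℤ), 2 * w = q * i → ¬ (q:ℤ) ∣ w → Odd i := by
    intro w i h hn
    by_contra h2
    rw [Int.not_odd_iff_even] at h2
    obtain ⟨t, ht⟩ := h2
    apply hn; exact ⟨t, by rw [ht] at h; linarith⟩
  have oi := odd _ _ hi n1
  have oj := odd _ _ hj n2
  have evq : Even (q:ℤ) := by
    have : Even ((q:ℤ) * i) := by rw [← hi]; exact even_two_mul _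
    rcases Int.even_mul.1 this with h | h
    · exact h
    · exact absurd oi (Int.not_odd_iff_even.2 h)
  have oddc : ∀ z : ℤ, IsCoprime z q → Odd z := by
    intro z hz
    by_contra h2
    rw [Int.not_odd_iff_even] at h2
    have := hz.isUnit_of_dvd' h2.two_dvd evq.two_dvd
    norm_num [Int.isUnit_iff] at this
  have oc := oddc _ mc.2.2.2.2.1
  have ob := oddc _ mb.2.2.2.2.1
  have ev : Even (i * c.2 - j * b.2) := (oi.mul oc).sub_odd (oj.mul ob)
  obtain ⟨t, ht⟩ := ev
  have : (q:ℤ) ∣ a.2 * ((b.1:ℤ) * c.2 - c.1 * b.2) := by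
    refine ⟨t, ?_⟩
    have : 2 * (a.2 * ((b.1:ℤ) * c.2 - c.1 * b.2)) = q * (i * c.2 - j * b.2) := by linear_combination c.2 * hi - b.2 * hj
    rw [ht] at this; linarith
  exact neq b hb.1 c hc.1 hbc (ma.2.2.2.2.1.symm.dvd_of_dvd_mul_left this)

end SqV

namespace SqV
open Finset

def QS (N q D s : ℕ) : Finset ((ℕ × ℕ) × (ℕ × ℕ)) :=
  ((Icc 1 N ×ˢ Icc 1 N) ×ˢ (Ioc D s ×ˢ Ioc D s)).filter (fun t => t.1.1 ≠ t.1.2 ∧ t.1.1 % q = t.1.2 % q ∧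
    Nat.Coprime t.1.1 q ∧ t.2.1^2 ∣ t.1.1 ∧ t.2.2^2 ∣ t.1.2)

lemma QS_card (N q D s : ℕ) (hq : 0 < q) (hD : 0 < D) (hs : s * s ≤ q) :
    (QS N q D s).card ≤ Nat.sqrt (N / q) * ((N / D^2) * (N / D^2)) * (2 * q.divisors.card) := by
  set T : Finset (Σ _ : ℕ × (ℕ × ℕ), ℕ × ℕ) :=
    (Icc 1 (Nat.sqrt (N / q)) ×ˢ (Icc 1 (N / D^2) ×ˢ Icc 1 (N/D^2))).sigma (fun t => SS q s t.2.1 t.2.2) with hT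
  have hTc : T.card ≤ Nat.sqrt (N / q) * ((N / D^2) * (N / D^2)) * (2 * q.divisors.card) := by
    rw [hT, Finset.card_sigma]
    refine (Finset.sum_le_card_nsmul _ _ _ (fun t _ => SS_card q s t.2.1 t.2.2 hq hs)).trans ?_
    simp [Finset.card_product]
  refine le_trans ?_ hTc
  apply Finset.card_le_card_of_injOn (fun t => ⟨(Nat.gcd t.2.1 t.2.2, (t.1.1 / t.2.1^2, t.1.2 / t.2.2^2)),
    (t.2.1 / Nat.gcd t.2.1 t.2.2, t.2.2 / Nat.gcd t.2.1 t.2.2)⟩)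
  · rintro ⟨⟨n₁, n₂⟩, ⟨d₁, d₂⟩⟩ ht
    simp only [QS, coe_filter, mem_product, mem_Icc, mem_Ioc, Set.mem_ofPred_eq] at ht
    obtain ⟨⟨⟨⟨p1, p2⟩, p3, p4⟩, ⟨p5, p6⟩, p7, p8⟩, hne, hmod, hcop, hd1, hd2⟩ := ht
    obtain ⟨m₁, rfl⟩ := hd1
    obtain ⟨m₂, rfl⟩ := hd2
    have d1p : 0 < d₁ := by omega
    have d2p : 0 < d₂ := by omega
    have gp : 0 < Nat.gcd d₁ d₂ := Nat.gcd_pos_of_pos_left _ d1p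
    obtain ⟨e₁, he1⟩ := Nat.gcd_dvd_left d₁ d₂
    obtain ⟨e₂, he2⟩ := Nat.gcd_dvd_right d₁ d₂
    have hecop : Nat.Coprime e₁ e₂ := by
      have := Nat.coprime_div_gcd_div_gcd gp
      rwa [Nat.div_eq_of_eq_mul_right gp he1, Nat.div_eq_of_eq_mul_right gp he2] at this
    have hcop2 : Nat.Coprime (d₂^2 * m₂) q := by
      rw [Nat.coprime_iff_gcd_eq_one, Nat.gcd_comm, Nat.gcd_rec, ← hmod, ← Nat.gcd_rec, Nat.gcd_comm]; exact hcop
    have m1p : 0 < m₁ := Nat.pos_of_ne_zero (by rintro rfl; simp at p1)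
    have m2p : 0 < m₂ := Nat.pos_of_ne_zero (by rintro rfl; simp at p3)
    simp only [hT, coe_sigma, Set.mem_sigma_iff, mem_coe, mem_product, mem_Icc]
    rw [Nat.mul_div_cancel_left _ (by positivity), Nat.mul_div_cancel_left _ (by positivity),
      Nat.div_eq_of_eq_mul_right gp he1, Nat.div_eq_of_eq_mul_right gp he2]
    set g := Nat.gcd d₁ d₂ with hg
    have cm1 : Nat.Coprime m₁ q := Nat.Coprime.coprime_mul_left hcop
    have cm2 : Nat.Coprime m₂ q := Nat.Coprime.coprime_mul_left hcop2
    have cd1 : Nat.Coprime d₁ q := (Nat.coprime_pow_left_iff (by norm_num) _ _).1 (Nat.Coprime.coprime_mul_right hcop)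
    have cd2 : Nat.Coprime d₂ q := (Nat.coprime_pow_left_iff (by norm_num) _ _).1 (Nat.Coprime.coprime_mul_right hcop2)
    have cg : Nat.Coprime g q := cd1.coprime_dvd_left (Nat.gcd_dvd_left _ _)
    have ce1 : Nat.Coprime e₁ q := cd1.coprime_dvd_left ⟨g, by rw [mul_comm]; exact he1⟩
    have ce2 : Nat.Coprime e₂ q := cd2.coprime_dvd_left ⟨g, by rw [mul_comm]; exact he2⟩
    have e1p : 1 ≤ e₁ := Nat.pos_of_ne_zero (by rintro rfl; omega)
    have e2p : 1 ≤ e₂ := Nat.pos_of_ne_zero (by rintro rfl; omega)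
    have e1s : e₁ ≤ s := le_trans (by rw [he1]; exact Nat.le_mul_of_pos_left _ gp) p6
    have e2s : e₂ ≤ s := le_trans (by rw [he2]; exact Nat.le_mul_of_pos_left _ gp) p8
    have hdv : (q:ℤ) ∣ ((d₁^2 * m₁ : ℕ):ℤ) - ((d₂^2 * m₂ : ℕ) : ℤ) :=
      (Nat.modEq_iff_dvd.1 (show (d₂^2 * m₂) ≡ (d₁^2*m₁) [MOD q] from hmod.symm))
    have hfac : ((d₁^2 * m₁ : ℕ):ℤ) - ((d₂^2 * m₂ : ℕ) : ℤ) = (g:ℤ)^2 * ((m₁:ℤ) * e₁^2 - m₂ * e₂^2) := by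
      rw [he1, he2]; push_cast; ring
    have cgq : IsCoprime ((g:ℤ)^2) q := (Nat.isCoprime_iff_coprime.2 cg).pow_left
    have hdv2 : (q:ℤ) ∣ ((m₁:ℤ) * e₁^2 - m₂ * e₂^2) := by
      rw [hfac] at hdv; exact cgq.symm.dvd_of_dvd_mul_left hdv
    refine ⟨⟨⟨gp, ?_⟩, ⟨m1p, ?_⟩, m2p, ?_⟩, ?_⟩
    · -- bound on g
      have hz : ((d₁^2 * m₁ : ℕ):ℤ) - ((d₂^2 * m₂ : ℕ) : ℤ) ≠ 0 := by
        intro h; apply hne; have : ((d₁^2 * m₁ : ℕ):ℤ) = ((d₂^2 * m₂ : ℕ) : ℤ) := by linarith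
        exact_mod_cast this
      have hgq : (g:ℤ)^2 * q ∣ ((d₁^2 * m₁ : ℕ):ℤ) - ((d₂^2 * m₂ : ℕ) : ℤ) := by
        rw [hfac]; exact mul_dvd_mul_left _ hdv2
      have hle := Int.le_of_dvd (abs_pos.2 hz) ((dvd_abs _ _).2 hgq)
      have hle2 : |((d₁^2 * m₁ : ℕ):ℤ) - ((d₂^2 * m₂ : ℕ) : ℤ)| ≤ N := by
        have h1 : (0:ℤ) ≤ ((d₁^2 * m₁ : ℕ):ℤ) := by positivity
        have h2 : (0:ℤ) ≤ ((d₂^2 * m₂ : ℕ):ℤ) := by positivity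
        have h3 : ((d₁^2 * m₁ : ℕ):ℤ) ≤ N := by exact_mod_cast p2
        have h4 : ((d₂^2 * m₂ : ℕ):ℤ) ≤ N := by exact_mod_cast p4
        rw [abs_le]; constructor <;> linarith
      have : g^2 * q ≤ N := by exact_mod_cast hle.trans hle2
      rw [Nat.le_sqrt', Nat.le_div_iff_mul_le hq]; exact this
    · rw [Nat.le_div_iff_mul_le (by positivity)]
      calc m₁ * D^2 ≤ m₁ * d₁^2 := by gcongr
        _ ≤ N := by rw [mul_comm]; exact p2
    · rw [Nat.le_div_iff_mul_le (by positivity)]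
      calc m₂ * D^2 ≤ m₂ * d₂^2 := by gcongr
        _ ≤ N := by rw [mul_comm]; exact p4
    · simp only [SS, mem_filter, mem_product, mem_Icc]
      exact ⟨⟨⟨e1p, e1s⟩, e2p, e2s⟩, hecop, ce1, ce2, cm1, cm2, hdv2⟩
  · rintro ⟨⟨n₁, n₂⟩, ⟨d₁, d₂⟩⟩ ht ⟨⟨n₁', n₂'⟩, ⟨d₁', d₂'⟩⟩ ht' h
    simp only [QS, coe_filter, mem_product, mem_Icc, mem_Ioc, Set.mem_ofPred_eq] at ht ht'
    simp only [Sigma.mk.injEq, Prod.mk.injEq, heq_eq_eq] at h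
    obtain ⟨⟨h1, h2, h3⟩, h4, h5⟩ := h
    have a1 := Nat.div_mul_cancel (Nat.gcd_dvd_left d₁ d₂)
    have a2 := Nat.div_mul_cancel (Nat.gcd_dvd_right d₁ d₂)
    have b1 := Nat.div_mul_cancel (Nat.gcd_dvd_left d₁' d₂')
    have b2 := Nat.div_mul_cancel (Nat.gcd_dvd_right d₁' d₂')
    have c1 : d₁ = d₁' := by rw [← a1, ← b1, h4, h1]
    have c2 : d₂ = d₂' := by rw [← a2, ← b2, h5, h1]
    subst c1; subst c2
    have x1 := Nat.div_mul_cancel ht.2.2.2.2.1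
    have x2 := Nat.div_mul_cancel ht.2.2.2.2.2
    have y1 := Nat.div_mul_cancel ht'.2.2.2.2.1
    have y2 := Nat.div_mul_cancel ht'.2.2.2.2.2
    have c3 : n₁ = n₁' := by rw [← x1, ← y1, h2]
    have c4 : n₂ = n₂' := by rw [← x2, ← y2, h3]
    rw [c3, c4]

end SqV

namespace SqV
open Finset

noncomputable def bb (D s n : ℕ) : ℝ := ∑ d ∈ Ioc D s, (if d^2 ∣ n then (1:ℝ) else 0)

lemma bb_nonneg (D s n : ℕ) : 0 ≤ bb D s n := Finset.sum_nonneg (fun _ _ => by split_ifs <;> norm_num)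

lemma bb_le_tau (D s n : ℕ) (hn : 0 < n) : bb D s n ≤ (n.divisors.card : ℝ) := by
  unfold bb
  rw [Finset.sum_boole]
  norm_cast
  apply Finset.card_le_card
  intro d hd
  rw [mem_filter] at hd
  rw [Nat.mem_divisors]
  exact ⟨(Dvd.intro_left (d^1) (by ring)).trans hd.2, hn.ne'⟩

lemma sum_bb (D s N : ℕ) (hD : 0 < D) : ∑ n ∈ Icc 1 N, bb D s n ≤ (N:ℝ) / D := by
  unfold bb
  rw [Finset.sum_comm]
  calc ∑ d ∈ Ioc D s, ∑ n ∈ Icc 1 N, (if d^2 ∣ n then (1:ℝ) else 0)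
      ≤ ∑ d ∈ Ioc D s, (N:ℝ) * (1 / (d:ℝ)^2) := by
        apply Finset.sum_le_sum
        intro d hd
        rw [mem_Ioc] at hd
        rw [Finset.sum_boole]
        have : ((Icc 1 N).filter (fun n => d^2 ∣ n)).card = N / d^2 := by
          have := Nat.Ioc_filter_dvd_card_eq_div N (d^2)
          rw [← this]; congr 1
        rw [this, mul_one_div]
        have := @Nat.cast_div_le ℝ _ _ _ N (d^2)
        push_cast at this
        exact_mod_cast this
    _ ≤ (N:ℝ) / D := by
        rw [← Finset.mul_sum]
        have := inv_sq_tail D s hD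
        calc (N:ℝ) * _ ≤ N * (1 / D) := by gcongr
          _ = _ := by ring

lemma class_card (N q a : ℕ) :
    ((Icc 1 N).filter (fun n => n % q = a % q)).card ≤ N / q + 1 := by
  rw [← Finset.card_range (N / q + 1)]
  apply Finset.card_le_card_of_injOn (fun n => n / q)
  · intro n hn
    simp only [coe_filter, mem_Icc, Set.mem_ofPred_eq] at hn
    simp only [coe_range, Set.mem_Iio]
    exact Nat.lt_succ_of_le (Nat.div_le_div_right hn.1.2)
  · intro n hn m hm h
    simp only [coe_filter, mem_Icc, Set.mem_ofPred_eq] at hn hm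
    dsimp only at h
    rw [← Nat.div_add_mod n q, ← Nat.div_add_mod m q, h, hn.2, hm.2]

lemma Bpp (N q s t : ℕ) (Y : ℝ) (hY : 1 ≤ Y) (hq : 0 < q) (hs : 0 < s)
    (hτ : ∀ n : ℕ, 0 < n → n ≤ N → (n.divisors.card : ℝ) ≤ Y) :
    ∑ a ∈ CA q, (∑ n ∈ (Icc 1 N).filter (fun n => n % q = a % q), bb s t n)^2 ≤
      ((N:ℝ) / q + 1) * Y * ((N:ℝ) / s) := by
  calc ∑ a ∈ CA q, (∑ n ∈ (Icc 1 N).filter (fun n => n % q = a % q), bb s t n)^2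
      ≤ ∑ a ∈ CA q, ((N:ℝ) / q + 1) * Y * (∑ n ∈ (Icc 1 N).filter (fun n => n % q = a % q), bb s t n) := by
        apply Finset.sum_le_sum; intro a _
        have h1 : ∑ n ∈ (Icc 1 N).filter (fun n => n % q = a % q), bb s t n ≤ ((N:ℝ) / q + 1) * Y := by
          have h2 : ∀ n ∈ (Icc 1 N).filter (fun n => n % q = a % q), bb s t n ≤ Y := by
            intro n hn
            rw [mem_filter, mem_Icc] at hn
            exact (bb_le_tau s t n hn.1.1).trans (hτ n hn.1.1 hn.1.2)
          refine (Finset.sum_le_card_nsmul _ _ _ h2).trans ?_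
          rw [nsmul_eq_mul]
          have h3 : (((Icc 1 N).filter (fun n => n % q = a % q)).card : ℝ) ≤ (N:ℝ)/q + 1 := by
            have := class_card N q a
            calc (((Icc 1 N).filter (fun n => n % q = a % q)).card : ℝ) ≤ ((N / q + 1 : ℕ):ℝ) := by exact_mod_cast this
              _ ≤ _ := by push_cast; gcongr; exact Nat.cast_div_le
          gcongr
        rw [sq]
        apply mul_le_mul_of_nonneg_right h1 (Finset.sum_nonneg (fun n _ => bb_nonneg _ _ _))
    _ ≤ _ := by
        rw [← Finset.mul_sum]
        unfold CA
        rw [sum_over_a1 q N hq]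
        have : ∑ n ∈ Icc 1 N, (if Nat.Coprime n q then bb s t n else 0) ≤ (N:ℝ) / s := by
          refine le_trans (Finset.sum_le_sum ?_) (sum_bb s t N hs)
          intro n _; split_ifs
          · exact le_rfl
          · exact bb_nonneg _ _ _
        gcongr

lemma Bp (N q D s : ℕ) (Y : ℝ) (hq : 0 < q) (hD : 0 < D)
    (hτ : ∀ n : ℕ, 0 < n → n ≤ N → (n.divisors.card : ℝ) ≤ Y) :
    ∑ a ∈ CA q, (∑ n ∈ (Icc 1 N).filter (fun n => n % q = a % q), bb D s n)^2 ≤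
      Y * ((N:ℝ) / D) + ((QS N q D s).card : ℝ) := by
  have e0 : ∀ a, (∑ n ∈ (Icc 1 N).filter (fun n => n % q = a % q), bb D s n)^2 =
    (∑ n ∈ (Icc 1 N).filter (fun n => n % q = a % q), bb D s n) * (∑ n ∈ (Icc 1 N).filter (fun n => n % q = a % q), bb D s n) := fun a => sq _
  simp_rw [e0]
  unfold CA
  rw [sum_over_a q N hq]
  have hQ : ((QS N q D s).card : ℝ) = ∑ n₁ ∈ Icc 1 N, ∑ n₂ ∈ Icc 1 N,
      ∑ d₁ ∈ Ioc D s, ∑ d₂ ∈ Ioc D s, (if n₁ ≠ n₂ ∧ n₁ % q = n₂ % q ∧ Nat.Coprime n₁ q ∧ d₁^2 ∣ n₁ ∧ d₂^2 ∣ n₂ then (1:ℝ) else 0) := by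
    unfold QS
    rw [Finset.card_filter, Finset.sum_product, Finset.sum_product]
    push_cast
    apply Finset.sum_congr rfl; intro n₁ _
    apply Finset.sum_congr rfl; intro n₂ _
    rw [Finset.sum_product]
  have hdiag : ∑ n ∈ Icc 1 N, Y * bb D s n ≤ Y * ((N:ℝ) / D) := by
    rw [← Finset.mul_sum]
    rcases Nat.eq_zero_or_pos N with h | h
    · subst h; simp
    have : 0 ≤ Y := le_trans (by positivity) (hτ 1 one_pos h)
    exact mul_le_mul_of_nonneg_left (sum_bb D s N hD) this
  refine le_trans ?_ (add_le_add_left hdiag _)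
  rw [hQ, ← Finset.sum_add_distrib]
  apply Finset.sum_le_sum; intro n₁ h₁
  rw [mem_Icc] at h₁
  have e1 : Y * bb D s n₁ = ∑ n₂ ∈ Icc 1 N, if n₂ = n₁ then Y * bb D s n₁ else 0 := by
    rw [Finset.sum_ite_eq' ]; simp [h₁.1, h₁.2]
  rw [e1, ← Finset.sum_add_distrib]
  apply Finset.sum_le_sum; intro n₂ h₂
  have hpos : 0 ≤ ∑ d₁ ∈ Ioc D s, ∑ d₂ ∈ Ioc D s, (if n₁ ≠ n₂ ∧ n₁ % q = n₂ % q ∧ Nat.Coprime n₁ q ∧ d₁^2 ∣ n₁ ∧ d₂^2 ∣ n₂ then (1:ℝ) else 0) :=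
    Finset.sum_nonneg (fun _ _ => Finset.sum_nonneg (fun _ _ => by split_ifs <;> norm_num))
  have hY : bb D s n₁ ≤ Y := (bb_le_tau D s n₁ h₁.1).trans (hτ n₁ h₁.1 h₁.2)
  have hb := bb_nonneg D s n₁
  by_cases heq : n₂ = n₁
  · subst heq
    rw [if_pos rfl]
    refine le_trans ?_ (le_add_of_nonneg_right hpos)
    split_ifs
    · exact mul_le_mul_of_nonneg_right hY hb
    · exact mul_nonneg (hb.trans hY) hb
  · rw [if_neg heq, zero_add]
    by_cases hc : n₁ % q = n₂ % q ∧ Nat.Coprime n₁ q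
    · rw [if_pos hc]
      unfold bb
      rw [Finset.sum_mul_sum]
      apply Finset.sum_le_sum; intro d₁ _
      apply Finset.sum_le_sum; intro d₂ _
      by_cases h1 : d₁^2 ∣ n₁ <;> by_cases h2 : d₂^2 ∣ n₂ <;> simp [h1, h2, hc.1, Ne.symm heq]
      rw [if_pos hc.2]
    · rw [if_neg hc]; exact hpos

end SqV

namespace SqV
open Finset

noncomputable def ff (h : ℕ → ℝ) (q e : ℕ) : ℝ :=
  if Nat.Coprime e q then (ArithmeticFunction.moebius e : ℝ) * ∏ p ∈ e.primeFactors, h p else 0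

def HB (h : ℕ → ℝ) : Prop := ∀ p : ℕ, p.Prime → 0 ≤ h p ∧ h p ≤ 1 / (p:ℝ)^2

lemma prod_h_le (h : ℕ → ℝ) (hh : HB h) (e : ℕ) (he : Squarefree e) : ∏ p ∈ e.primeFactors, h p ≤ 1 / (e:ℝ)^2 := by
  calc ∏ p ∈ e.primeFactors, h p ≤ ∏ p ∈ e.primeFactors, 1 / (p:ℝ)^2 := by
        apply Finset.prod_le_prod
        · intro p hp; exact (hh p (Nat.prime_of_mem_primeFactors hp)).1
        · intro p hp; exact (hh p (Nat.prime_of_mem_primeFactors hp)).2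
    _ = 1 / (e:ℝ)^2 := by
        rw [Finset.prod_div_distrib, Finset.prod_pow]
        have := Nat.prod_primeFactors_of_squarefree he
        have h2 := congrArg (Nat.cast : ℕ → ℝ) this
        rw [Nat.cast_prod] at h2
        rw [h2]; simp

lemma prod_h_nonneg (h : ℕ → ℝ) (hh : HB h) (e : ℕ) : 0 ≤ ∏ p ∈ e.primeFactors, h p :=
  Finset.prod_nonneg (fun p hp => (hh p (Nat.prime_of_mem_primeFactors hp)).1)

lemma ff_abs_le (h : ℕ → ℝ) (hh : HB h) (q e : ℕ) : |ff h q e| ≤ 1 / (e:ℝ)^2 := by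
  unfold ff
  by_cases he : Squarefree e
  · split_ifs
    · rw [abs_mul, abs_of_nonneg (prod_h_nonneg h hh e)]
      calc _ ≤ 1 * (1 / (e:ℝ)^2) := by
            gcongr
            · exact prod_h_nonneg h hh e
            · exact moebius_abs_le e
            · exact prod_h_le h hh e he
        _ = _ := one_mul _
    · simp
  · rw [ArithmeticFunction.moebius_eq_zero_of_not_squarefree he]; simp

lemma ff_summable (h : ℕ → ℝ) (hh : HB h) (q : ℕ) : Summable (fun e => ‖ff h q e‖) := by
  refine Summable.of_nonneg_of_le (fun _ => norm_nonneg _) (fun e => ?_) (Real.summable_one_div_nat_pow.2 (le_refl 2))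
  exact ff_abs_le h hh q e

lemma ff_local (h : ℕ → ℝ) (q : ℕ) (p : Nat.Primes) : ∑' e, ff h q ((p:ℕ) ^ e) = if (p:ℕ) ∣ q then 1 else 1 - h p := by
  rw [tsum_eq_sum (s := Finset.range 2)]
  · rw [Finset.sum_range_succ, Finset.sum_range_one, pow_zero, pow_one]
    have : ff h q 1 = 1 := by simp [ff]
    rw [this]
    unfold ff
    rw [ArithmeticFunction.moebius_apply_prime p.2, Nat.Prime.primeFactors p.2]
    by_cases hd : (p:ℕ) ∣ q
    · rw [if_pos hd, if_neg (by rw [Nat.Prime.coprime_iff_not_dvd p.2]; simpa using hd)]; simp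
    · rw [if_neg hd, if_pos (by rw [Nat.Prime.coprime_iff_not_dvd p.2]; exact hd)]; simp; ring
  · intro k hk
    have hk2 : 2 ≤ k := by rw [Finset.mem_range] at hk; omega
    unfold ff
    rw [ArithmeticFunction.moebius_eq_zero_of_not_squarefree]
    · simp
    · intro hs
      have := (Nat.squarefree_pow_iff p.2.ne_one (by omega)).1 hs
      omega

lemma ff_hasProd (h : ℕ → ℝ) (hh : HB h) (q : ℕ) :
    HasProd (fun p : Nat.Primes => if (p:ℕ) ∣ q then 1 else 1 - h p) (∑' e, ff h q e) := by
  have h1 := EulerProduct.eulerProduct_hasProd (f := ff h q) (by simp [ff]) (by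
    intro m n hmn
    unfold ff
    by_cases hm : Nat.Coprime m q
    · by_cases hn : Nat.Coprime n q
      · rw [if_pos (Nat.Coprime.mul_left hm hn), if_pos hm, if_pos hn,
          ArithmeticFunction.isMultiplicative_moebius.map_mul_of_coprime hmn, Nat.Coprime.primeFactors_mul hmn,
          Finset.prod_union hmn.disjoint_primeFactors]
        push_cast; ring
      · rw [if_neg hn, if_neg (fun hc => hn (Nat.Coprime.coprime_mul_left hc))]; simp
    · rw [if_neg hm, if_neg (fun hc => hm (Nat.Coprime.coprime_mul_right hc))]; simp) (ff_summable h hh q) (by simp [ff])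
  have e0 : (fun p : Nat.Primes => if (p:ℕ) ∣ q then 1 else 1 - h p) = (fun p : Nat.Primes => ∑' e, ff h q ((p:ℕ) ^ e)) := by
    funext p
    symm
    exact ff_local h q p
  rw [e0]; exact h1

noncomputable def PPr (h : ℕ → ℝ) : ℝ := ∏' p : Nat.Primes, (1 - h p)

lemma PPr_hasProd (h : ℕ → ℝ) (hh : HB h) : HasProd (fun p : Nat.Primes => 1 - h p) (PPr h) := by
  have h1 := ff_hasProd h hh 1
  have e : (fun p : Nat.Primes => if (p:ℕ) ∣ 1 then 1 else 1 - h p) = (fun p : Nat.Primes => 1 - h p) := by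
    funext p; rw [if_neg]; exact fun hc => p.2.ne_one (Nat.dvd_one.1 hc)
  rw [e] at h1
  exact h1.multipliable.hasProd

lemma HB_lt (h : ℕ → ℝ) (hh : HB h) (p : ℕ) (hp : p.Prime) : h p < 1 := by
  refine lt_of_le_of_lt (hh p hp).2 ?_
  have : (2:ℝ) ≤ p := by exact_mod_cast hp.two_le
  rw [div_lt_one (by positivity)]; nlinarith

lemma ff_hasSum (h : ℕ → ℝ) (hh : HB h) (q : ℕ) (hq : q ≠ 0) :
    HasSum (ff h q) (PPr h * ∏ p ∈ q.primeFactors, (1 - h p)⁻¹) := by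
  have hs : Summable (ff h q) := (ff_summable h hh q).of_norm
  have h1 := ff_hasProd h hh q
  have h2 := PPr_hasProd h hh
  have h3 : HasProd (fun p : Nat.Primes => if (p:ℕ) ∣ q then (1 - h p)⁻¹ else 1) (∏ p ∈ q.primeFactors, (1 - h p)⁻¹) := by
    let S : Finset Nat.Primes := Finset.subtype Nat.Prime q.primeFactors
    have hS : S = Finset.subtype Nat.Prime q.primeFactors := rfl
    have h4 := hasProd_prod_of_ne_finset_one (L := .unconditional _) (f := fun p : Nat.Primes => if (p:ℕ) ∣ q then (1 - h p)⁻¹ else 1)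
      (s := S) (by
        intro p hp
        rw [hS] at hp
        have hp := fun hc => hp (Finset.mem_subtype.2 hc)
        rw [Nat.mem_primeFactors] at hp
        rw [if_neg]; exact fun hc => hp ⟨p.2, hc, hq⟩)
    convert h4 using 1
    have h5 := Finset.prod_subtype_of_mem (s := q.primeFactors) (f := fun p : ℕ => if p ∣ q then (1 - h p)⁻¹ else 1)
      (p := fun p => p.Prime) (fun p hp => Nat.prime_of_mem_primeFactors hp)
    refine Eq.trans ?_ h5.symm
    apply Finset.prod_congr rfl
    intro p hp
    rw [if_pos (Nat.dvd_of_mem_primeFactors hp)]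
  have h6 := h2.mul h3
  have : (fun p : Nat.Primes => (1 - h p) * (if (p:ℕ) ∣ q then (1 - h p)⁻¹ else 1)) = fun p : Nat.Primes => if (p:ℕ) ∣ q then 1 else 1 - h p := by
    funext p
    split_ifs
    · exact mul_inv_cancel₀ (by have := HB_lt h hh p p.2; linarith)
    · rw [mul_one]
  rw [this] at h6
  rw [← h1.unique h6]
  exact hs.hasSum

noncomputable def h1 (p : ℕ) : ℝ := 1 / (p:ℝ)^2

lemma HB_h1 : HB h1 := fun p _ => ⟨by unfold h1; positivity, le_rfl⟩

lemma PPr_h1 : PPr h1 = 6 / Real.pi^2 := by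
  have a := PPr_hasProd h1 HB_h1
  have b := EulerProduct.eulerProduct_hasProd (f := fun n : ℕ => 1 / (n:ℝ)^2) (by simp) (by
    intro m n _; push_cast; rw [mul_pow, div_mul_div_comm, one_mul]) (by
      simp) (by simp)
  rw [hasSum_zeta_two.tsum_eq] at b
  have c := a.mul b
  have : (fun p : Nat.Primes => (1 - h1 p) * ∑' e : ℕ, 1 / (((p:ℕ)^e : ℕ):ℝ)^2) = fun _ => 1 := by
    funext p
    have hlt := HB_lt h1 HB_h1 p p.2
    have hge := (HB_h1 p p.2).1
    have e1 : (fun e : ℕ => 1 / (((p:ℕ)^e : ℕ):ℝ)^2) = fun e => (h1 p)^e := by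
      funext e; unfold h1; push_cast; rw [div_pow, one_pow, ← pow_mul, ← pow_mul, mul_comm]
    rw [e1, tsum_geometric_of_lt_one hge hlt]
    exact mul_inv_cancel₀ (by linarith)
  rw [this] at c
  have := c.unique hasProd_one
  field_simp at this ⊢; linarith

lemma Cq_eq (q : ℕ) : Cq q = PPr h1 * ∏ p ∈ q.primeFactors, (1 - h1 p)⁻¹ := by
  rw [PPr_h1]; unfold Cq h1
  congr 1; apply Finset.prod_congr rfl; intro p _; rw [inv_pow, one_div]

lemma ff_h1 (q d : ℕ) (hc : Nat.Coprime d q) : ff h1 q d = (ArithmeticFunction.moebius d : ℝ) * (1 / (d:ℝ)^2) := by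
  unfold ff
  rw [if_pos hc]
  by_cases he : Squarefree d
  · congr 1; unfold h1
    rw [Finset.prod_div_distrib, Finset.prod_pow]
    have := Nat.prod_primeFactors_of_squarefree he
    have h2 := congrArg (Nat.cast : ℕ → ℝ) this
    rw [Nat.cast_prod] at h2
    rw [h2]; simp
  · rw [ArithmeticFunction.moebius_eq_zero_of_not_squarefree he]; simp

lemma ff_tail (h : ℕ → ℝ) (hh : HB h) (q D : ℕ) (hq : q ≠ 0) (hD : 0 < D) :
    |∑ e ∈ Icc 1 D, ff h q e - PPr h * ∏ p ∈ q.primeFactors, (1 - h p)⁻¹| ≤ 1 / (D:ℝ) := by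
  have hs := (ff_hasSum h hh q hq).tendsto_sum_nat
  have h2 : Filter.Tendsto (fun N => |∑ e ∈ Icc 1 D, ff h q e - ∑ e ∈ range N, ff h q e|) Filter.atTop
    (nhds |∑ e ∈ Icc 1 D, ff h q e - PPr h * ∏ p ∈ q.primeFactors, (1 - h p)⁻¹|) :=
    (tendsto_const_nhds.sub hs).abs
  apply le_of_tendsto h2
  filter_upwards [Filter.eventually_gt_atTop D] with N hN
  have e1 : ∑ e ∈ range N, ff h q e = ∑ e ∈ Icc 1 D, ff h q e + ∑ e ∈ Ioc D (N-1), ff h q e := by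
    have : ff h q 0 = 0 := by simp [ff]
    have e2 : ∑ e ∈ range N, ff h q e = ∑ e ∈ Icc 1 (N-1), ff h q e := by
      obtain ⟨M, rfl⟩ : ∃ M, N = M + 1 := ⟨N - 1, by omega⟩
      rw [Finset.sum_range_succ', this, add_zero, Finset.range_eq_Ico, Finset.sum_Ico_add' (ff h q) 0 M 1]
      congr 1
    rw [e2, ← Finset.sum_union]
    · congr 1; ext x; simp only [mem_Icc, mem_union, mem_Ioc]; omega
    · rw [Finset.disjoint_left]; intro x; simp only [mem_Icc, mem_Ioc]; omega
  rw [e1]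
  rw [sub_add_cancel_left, abs_neg]
  refine (Finset.abs_sum_le_sum_abs _ _).trans ((Finset.sum_le_sum (fun e _ => ff_abs_le h hh q e)).trans (inv_sq_tail D _ hD))

lemma ff_sum_DD (h : ℕ → ℝ) (q D : ℕ) : ∑ e ∈ Icc 1 D, ff h q e =
   ∑ e ∈ DD q D, (ArithmeticFunction.moebius e : ℝ) * ∏ p ∈ e.primeFactors, h p := by
  unfold DD ff; rw [Finset.sum_filter]

end SqV

namespace SqV
open Finset

lemma class_coprime (q n a : ℕ) (ha : Nat.Coprime a q) (h : n % q = a % q) : Nat.Coprime n q := by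
  rw [Nat.coprime_iff_gcd_eq_one, Nat.gcd_comm, Nat.gcd_rec, h, ← Nat.gcd_rec, Nat.gcd_comm]; exact ha

lemma Ad_zero (N q d a : ℕ) (ha : Nat.Coprime a q) (hd : ¬ Nat.Coprime d q) : Ad N q d a = 0 := by
  unfold Ad
  apply Finset.sum_eq_zero
  intro n hn
  rw [mem_filter] at hn
  rw [if_neg]
  intro hdv
  have := class_coprime q n a ha hn.2
  exact hd ((Nat.coprime_pow_left_iff (by norm_num : 0 < 2) _ _).1 (this.coprime_dvd_left hdv))

lemma G_point (X : ℝ) (q D s a : ℕ) (hX : 0 ≤ X) (hq : 0 < q) (hD : 0 < D) (hDs : D ≤ s) (hs : s ≤ ⌊X⌋₊)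
    (ha : Nat.Coprime a q) :
    |Eterm X q a - FF X q D a| ≤ X / q / D +
      (∑ n ∈ (Icc 1 ⌊X⌋₊).filter (fun n => n % q = a % q), bb D s n) +
      (∑ n ∈ (Icc 1 ⌊X⌋₊).filter (fun n => n % q = a % q), bb s ⌊X⌋₊ n) := by
  set N := ⌊X⌋₊ with hN
  set C := (Icc 1 N).filter (fun n => n % q = a % q) with hC
  have e1 : ∀ n ∈ C, ((ArithmeticFunction.moebius n : ℤ) : ℝ)^2 =
      ∑ d ∈ Icc 1 D, (ArithmeticFunction.moebius d : ℝ) * (if d^2 ∣ n then 1 else 0) +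
      ∑ d ∈ Ioc D N, (ArithmeticFunction.moebius d : ℝ) * (if d^2 ∣ n then 1 else 0) := by
    intro n hn
    rw [hC, mem_filter, mem_Icc] at hn
    rw [moebius_sq_sum n N hn.1.1 hn.1.2, Finset.sum_filter, ← Finset.sum_union]
    · apply Finset.sum_congr
      · ext x; simp only [mem_Icc, mem_union, mem_Ioc]; omega
      · intro d _; split_ifs <;> simp
    · rw [Finset.disjoint_left]; intro x; simp only [mem_Icc, mem_Ioc]; omega
  have e2 : ∑ n ∈ C, ((ArithmeticFunction.moebius n : ℤ) : ℝ)^2 =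
      ∑ d ∈ DD q D, (ArithmeticFunction.moebius d : ℝ) * Ad N q d a +
      ∑ n ∈ C, ∑ d ∈ Ioc D N, (ArithmeticFunction.moebius d : ℝ) * (if d^2 ∣ n then 1 else 0) := by
    rw [Finset.sum_congr rfl e1, Finset.sum_add_distrib]
    congr 1
    rw [Finset.sum_comm]
    unfold DD
    rw [Finset.sum_filter]
    apply Finset.sum_congr rfl
    intro d _
    rw [← Finset.mul_sum]
    change _ * Ad N q d a = _
    split_ifs with h
    · rfl
    · rw [Ad_zero N q d a ha h, mul_zero]
  have e3 : ∑ d ∈ DD q D, (ArithmeticFunction.moebius d : ℝ) * (X / q / (d:ℝ)^2) = X / q * ∑ e ∈ Icc 1 D, ff h1 q e := by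
    unfold DD
    rw [Finset.sum_filter, Finset.mul_sum]
    apply Finset.sum_congr rfl
    intro d _
    split_ifs with h
    · rw [ff_h1 q d h]; ring
    · unfold ff; rw [if_neg h, mul_zero]
  have e4 : Eterm X q a - FF X q D a =
      ∑ n ∈ C, ∑ d ∈ Ioc D N, (ArithmeticFunction.moebius d : ℝ) * (if d^2 ∣ n then 1 else 0) +
      X / q * (∑ e ∈ Icc 1 D, ff h1 q e - Cq q) := by
    unfold Eterm FF
    rw [← hN, ← hC, e2]
    simp_rw [mul_sub]
    rw [Finset.sum_sub_distrib, e3]; ring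
  rw [e4]
  have b1 : |X / q * (∑ e ∈ Icc 1 D, ff h1 q e - Cq q)| ≤ X / q / D := by
    rw [abs_mul, abs_of_nonneg (by positivity), Cq_eq]
    have := ff_tail h1 HB_h1 q D hq.ne' hD
    calc _ ≤ X / q * (1 / D) := by gcongr
      _ = _ := by ring
  have b2 : |∑ n ∈ C, ∑ d ∈ Ioc D N, (ArithmeticFunction.moebius d : ℝ) * (if d^2 ∣ n then 1 else 0)| ≤
     ∑ n ∈ C, bb D s n + ∑ n ∈ C, bb s N n := by
    rw [← Finset.sum_add_distrib]
    refine (Finset.abs_sum_le_sum_abs _ _).trans (Finset.sum_le_sum ?_)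
    intro n _
    unfold bb
    rw [← Finset.sum_union (by rw [Finset.disjoint_left]; intro x; simp only [mem_Ioc]; omega)]
    have : Ioc D s ∪ Ioc s N = Ioc D N := by ext x; simp only [mem_union, mem_Ioc]; omega
    rw [this]
    refine (Finset.abs_sum_le_sum_abs _ _).trans (Finset.sum_le_sum ?_)
    intro d _
    rw [abs_mul]
    have := moebius_abs_le d
    split_ifs <;> simp [this]
  refine (abs_add_le _ _).trans ?_
  linarith

lemma G_norm (X Y : ℝ) (q D s : ℕ) (hX : 0 ≤ X) (hY : 1 ≤ Y) (hq : 0 < q) (hD : 0 < D) (hDs : D ≤ s) (hs : s ≤ ⌊X⌋₊)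
    (hsq : s * s ≤ q) (hτ : ∀ n : ℕ, 0 < n → n ≤ ⌊X⌋₊ → (n.divisors.card : ℝ) ≤ Y) :
    ∑ a ∈ CA q, (Eterm X q a - FF X q D a)^2 ≤
      3 * (q * (X / q / D)^2 + (Y * (X / D) + 2 * Real.sqrt (X / q) * (X / (D:ℝ)^2)^2 * (q.divisors.card : ℝ))
        + (X / q + 1) * Y * (X / s)) := by
  have hNX : ((⌊X⌋₊:ℕ):ℝ) ≤ X := Nat.floor_le hX
  have hspos : 0 < s := by omega
  have h1 : ∀ a ∈ CA q, (Eterm X q a - FF X q D a)^2 ≤ 3 * ((X / q / D)^2 +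
      (∑ n ∈ (Icc 1 ⌊X⌋₊).filter (fun n => n % q = a % q), bb D s n)^2 +
      (∑ n ∈ (Icc 1 ⌊X⌋₊).filter (fun n => n % q = a % q), bb s ⌊X⌋₊ n)^2) := by
    intro a ha
    have ha2 : Nat.Coprime a q := (mem_filter.1 ha).2
    have h := G_point X q D s a hX hq hD hDs hs ha2
    rw [← sq_abs]
    set x := |Eterm X q a - FF X q D a|
    set u := X / q / (D:ℝ)
    set v := ∑ n ∈ (Icc 1 ⌊X⌋₊).filter (fun n => n % q = a % q), bb D s n
    set w := ∑ n ∈ (Icc 1 ⌊X⌋₊).filter (fun n => n % q = a % q), bb s ⌊X⌋₊ n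
    have hx : 0 ≤ x := abs_nonneg _
    calc x^2 ≤ (u + v + w)^2 := by gcongr
      _ ≤ _ := by nlinarith [sq_nonneg (u - v), sq_nonneg (v - w), sq_nonneg (u - w)]
  refine (Finset.sum_le_sum h1).trans ?_
  rw [← Finset.mul_sum, Finset.sum_add_distrib, Finset.sum_add_distrib, Finset.sum_const, CA_card, nsmul_eq_mul]
  have hb1 : (q.totient : ℝ) * (X / q / D)^2 ≤ q * (X / q / D)^2 := by
    gcongr; exact Nat.totient_le q
  have hb2 := Bp ⌊X⌋₊ q D s Y hq hD hτ
  have hb3 := Bpp ⌊X⌋₊ q s ⌊X⌋₊ Y hY hq hspos hτ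
  have hQ := QS_card ⌊X⌋₊ q D s hq hD hsq
  have hQ2 : ((QS ⌊X⌋₊ q D s).card : ℝ) ≤ 2 * Real.sqrt (X / q) * (X / (D:ℝ)^2)^2 * (q.divisors.card : ℝ) := by
    calc ((QS ⌊X⌋₊ q D s).card : ℝ) ≤ ((Nat.sqrt (⌊X⌋₊ / q) * ((⌊X⌋₊ / D^2) * (⌊X⌋₊ / D^2)) * (2 * q.divisors.card) : ℕ) : ℝ) := by exact_mod_cast hQ
      _ = (Nat.sqrt (⌊X⌋₊ / q) : ℝ) * (((⌊X⌋₊ / D^2 : ℕ) : ℝ) * ((⌊X⌋₊ / D^2 : ℕ) : ℝ)) * (2 * q.divisors.card) := by push_cast; ring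
      _ ≤ Real.sqrt (X / q) * ((X / (D:ℝ)^2) * (X / (D:ℝ)^2)) * (2 * q.divisors.card) := by
        have c1 : (Nat.sqrt (⌊X⌋₊ / q) : ℝ) ≤ Real.sqrt (X / q) := by
          refine Real.nat_sqrt_le_real_sqrt.trans (Real.sqrt_le_sqrt ?_)
          exact (Nat.cast_div_le).trans (by gcongr)
        have c2 : ((⌊X⌋₊ / D^2 : ℕ) : ℝ) ≤ X / (D:ℝ)^2 := by
          refine (Nat.cast_div_le).trans ?_
          push_cast; gcongr
        gcongr
      _ = _ := by ring
  have hb4 : Y * ((⌊X⌋₊:ℝ) / D) ≤ Y * (X / D) := by gcongr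
  have hb5 : ((⌊X⌋₊:ℝ) / q + 1) * Y * ((⌊X⌋₊:ℝ) / s) ≤ (X / q + 1) * Y * (X / s) := by gcongr
  linarith

end SqV

namespace SqV
open Finset MeasureTheory

lemma hh_nonneg (t : ℝ) : 0 ≤ hh t :=
  mul_nonneg (Int.fract_nonneg t) (by have := Int.fract_lt_one t; linarith)

lemma hh_le_one (t : ℝ) : hh t ≤ 1 := by
  unfold hh; nlinarith [Int.fract_nonneg t, Int.fract_lt_one t]

lemma hh_le_self (t : ℝ) (ht : 0 ≤ t) : hh t ≤ t := by
  have h1 : Int.fract t ≤ t := by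
    have h0 : (0:ℝ) ≤ ⌊t⌋ := by exact_mod_cast Int.floor_nonneg.2 ht
    linarith [Int.floor_add_fract t]
  unfold hh; nlinarith [Int.fract_nonneg t, Int.fract_lt_one t]

lemma hh_lip_aux (a b : ℝ) (hab : b ≤ a) : |hh a - hh b| ≤ a - b := by
  have fa := Int.fract_nonneg a
  have fa1 := Int.fract_lt_one a
  have fb := Int.fract_nonneg b
  have fb1 := Int.fract_lt_one b
  have ea := Int.floor_add_fract a
  have eb := Int.floor_add_fract b
  have hfl : ⌊b⌋ ≤ ⌊a⌋ := Int.floor_mono hab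
  rcases eq_or_lt_of_le hfl with h | h
  · have : a - b = Int.fract a - Int.fract b := by rw [h] at eb; linarith
    rw [this]; unfold hh
    rw [abs_le]
    constructor <;> nlinarith
  · have h2 : (⌊b⌋:ℝ) + 1 ≤ ⌊a⌋ := by exact_mod_cast h
    unfold hh; rw [abs_le]
    constructor <;> nlinarith

lemma hh_lip (a b : ℝ) : |hh a - hh b| ≤ |a - b| := by
  rcases le_total b a with h | h
  · rw [abs_of_nonneg (sub_nonneg.2 h)]; exact hh_lip_aux a b h
  · rw [abs_sub_comm, abs_sub_comm a b, abs_of_nonneg (sub_nonneg.2 h)]; exact hh_lip_aux b a h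

lemma hh_cont : Continuous hh := by
  have : LipschitzWith 1 hh := LipschitzWith.of_dist_le_mul (fun a b => by
    rw [Real.dist_eq, Real.dist_eq, NNReal.coe_one, one_mul]; exact hh_lip a b)
  exact this.continuous

noncomputable def gT (T u : ℝ) : ℝ := hh (T^2 / u^2)

lemma gT_nonneg (T u : ℝ) : 0 ≤ gT T u := hh_nonneg _
lemma gT_le_one (T u : ℝ) : gT T u ≤ 1 := hh_le_one _
lemma gT_le (T u : ℝ) : gT T u ≤ T^2 / u^2 := hh_le_self _ (by positivity)

lemma gT_meas (T : ℝ) : Measurable (gT T) := by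
  unfold gT; exact hh_cont.measurable.comp (by fun_prop)

lemma gT_int_Ioi (T c : ℝ) (hc : 0 < c) : IntegrableOn (gT T) (Set.Ioi c) := by
  have h1 : IntegrableOn (fun u : ℝ => T^2 * u^(-2:ℝ)) (Set.Ioi c) := (integrableOn_Ioi_rpow_of_lt (by norm_num) hc).const_mul _
  refine Integrable.mono' h1 (gT_meas T).aestronglyMeasurable ?_
  refine (ae_restrict_iff' measurableSet_Ioi).2 (Filter.Eventually.of_forall (fun u hu => ?_))
  rw [Real.norm_of_nonneg (gT_nonneg _ _)]
  refine (gT_le T u).trans (le_of_eq ?_)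
  have hu0 : 0 < u := hc.trans hu
  rw [Real.rpow_neg hu0.le, div_eq_mul_inv]; norm_num

lemma gT_tail (T c : ℝ) (hc : 0 < c) : ∫ u in Set.Ioi c, gT T u ≤ T^2 / c := by
  have h1 : IntegrableOn (fun u : ℝ => T^2 * u^(-2:ℝ)) (Set.Ioi c) := (integrableOn_Ioi_rpow_of_lt (by norm_num) hc).const_mul _
  calc ∫ u in Set.Ioi c, gT T u ≤ ∫ u in Set.Ioi c, T^2 * u^(-2:ℝ) := by
        apply setIntegral_mono_on (gT_int_Ioi T c hc) h1 measurableSet_Ioi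
        intro u hu
        refine (gT_le T u).trans (le_of_eq ?_)
        have hu0 : 0 < u := hc.trans hu
        rw [Real.rpow_neg hu0.le, div_eq_mul_inv]; norm_num
    _ = T^2 / c := by
        rw [integral_const_mul, integral_Ioi_rpow_of_lt (by norm_num) hc]
        norm_num
        rw [Real.rpow_neg hc.le, Real.rpow_one, div_eq_mul_inv]

lemma gT_intv (T a b : ℝ) : IntervalIntegrable (gT T) volume a b := by
  rw [intervalIntegrable_iff]
  refine Integrable.mono' (g := fun _ => (1:ℝ)) ?_ (gT_meas T).aestronglyMeasurable ?_
  · exact integrableOn_const (by simp) 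
  · exact Filter.Eventually.of_forall (fun u => by rw [Real.norm_of_nonneg (gT_nonneg _ _)]; exact gT_le_one _ _)

lemma gT_int_Ioi0 (T : ℝ) : IntegrableOn (gT T) (Set.Ioi 0) := by
  rw [← Set.Ioc_union_Ioi_eq_Ioi (zero_le_one (α := ℝ))]
  refine IntegrableOn.union ?_ (gT_int_Ioi T 1 one_pos)
  exact (intervalIntegrable_iff_integrableOn_Ioc_of_le zero_le_one).1 (gT_intv T 0 1)

noncomputable def II : ℝ := ∫ u in Set.Ioi (0:ℝ), gT 1 u

lemma II_nonneg : 0 ≤ II := integral_nonneg (fun u => gT_nonneg 1 u)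

lemma gT_scale (T : ℝ) (hT : 0 < T) : ∫ u in Set.Ioi (0:ℝ), gT T u = II * T := by
  have h := integral_comp_mul_left_Ioi (gT 1) 0 (inv_pos.2 hT)
  rw [mul_zero, inv_inv, smul_eq_mul] at h
  rw [II, mul_comm, ← h]
  congr 1; funext u
  unfold gT; congr 1
  rw [mul_pow, inv_pow, one_pow]
  rcases eq_or_ne u 0 with rfl | hu
  · simp
  · field_simp

lemma eps_bound (T : ℝ) (hT : 0 < T) (m : ℕ) (hm : 0 < m) :
    |gT T m - ∫ u in (m:ℝ)..((m+1:ℕ):ℝ), gT T u| ≤ 2 * T^(3/4:ℝ) * (1 / (m:ℝ)^(9/8:ℝ)) := by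
  have hm0 : (0:ℝ) < m := by exact_mod_cast hm
  have hm1 : (1:ℝ) ≤ m := by exact_mod_cast hm
  have e1 : gT T m = ∫ u in (m:ℝ)..((m+1:ℕ):ℝ), gT T m := by simp
  rw [e1, ← intervalIntegral.integral_sub (by simp) (gT_intv T _ _)]
  have key : ∀ u ∈ Set.uIoc (m:ℝ) ((m+1:ℕ):ℝ), ‖gT T m - gT T u‖ ≤ 2 * T^(3/4:ℝ) * (1 / (m:ℝ)^(9/8:ℝ)) := by
    intro u hu
    rw [Set.uIoc_of_le (by push_cast; linarith)] at hu
    push_cast at hu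
    obtain ⟨hu1, hu2⟩ := hu
    have hu0 : 0 < u := by linarith
    rw [Real.norm_eq_abs]
    have b1 : |gT T m - gT T u| ≤ 1 := by
      rw [abs_le]
      constructor <;> linarith [gT_nonneg T m, gT_nonneg T u, gT_le_one T m, gT_le_one T u]
    set x := 2 * T^2 / (m:ℝ)^3 with hx
    have hx0 : 0 < x := by positivity
    have b2 : |gT T m - gT T u| ≤ x := by
      refine (hh_lip _ _).trans ?_
      have : T^2 / (m:ℝ)^2 - T^2 / u^2 = T^2 * (1 / (m:ℝ)^2 - 1/u^2) := by ring
      rw [this, abs_mul, abs_of_pos (by positivity), hx, mul_comm 2, mul_div_assoc]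
      apply mul_le_mul_of_nonneg_left _ (by positivity)
      have l1 : 1 / u^2 ≤ 1 / (m:ℝ)^2 := by gcongr
      have l2 : 1 / ((m:ℝ)+1)^2 ≤ 1 / u^2 := by gcongr
      rw [abs_of_nonneg (by linarith)]
      have l3 : 1 / (m:ℝ)^2 - 1 / ((m:ℝ)+1)^2 ≤ 2 / (m:ℝ)^3 := by
        rw [div_sub_div _ _ (by positivity) (by positivity), div_le_div_iff₀ (by positivity) (by positivity)]
        have : 0 ≤ (m:ℝ)^2 * (3 * m + 2) := by positivity
        nlinarith [this]
      linarith
    have b3 : |gT T m - gT T u| ≤ x^(3/8:ℝ) := by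
      rcases le_total x 1 with h | h
      · refine b2.trans ?_
        calc x = x^(1:ℝ) := (Real.rpow_one x).symm
          _ ≤ x^(3/8:ℝ) := Real.rpow_le_rpow_of_exponent_ge hx0 h (by norm_num)
      · exact b1.trans (Real.one_le_rpow h (by norm_num))
    refine b3.trans ?_
    rw [hx, Real.div_rpow (by positivity) (by positivity), Real.mul_rpow (by norm_num) (by positivity),
      ← Real.rpow_natCast T 2, ← Real.rpow_natCast (m:ℝ) 3, ← Real.rpow_mul hT.le, ← Real.rpow_mul hm0.le]
    norm_num
    rw [div_eq_mul_inv]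
    have : (2:ℝ)^(3/8:ℝ) ≤ 2 := by
      calc (2:ℝ)^(3/8:ℝ) ≤ 2^(1:ℝ) := Real.rpow_le_rpow_of_exponent_le (by norm_num) (by norm_num)
        _ = 2 := Real.rpow_one 2
    gcongr
  have := intervalIntegral.norm_integral_le_of_norm_le_const key
  rw [Real.norm_eq_abs] at this
  simpa using this

lemma h_sum : ∃ C : ℝ, 0 < C ∧ ∀ T : ℝ, 0 < T → ∀ Z : ℕ,
    |∑ m ∈ Icc 1 Z, hh (T^2 / (m:ℝ)^2) - II * T| ≤ C * (T^(3/4:ℝ) + T^2 / (Z+1)) := by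
  have hsum : Summable (fun m : ℕ => 1 / (m:ℝ)^(9/8:ℝ)) := Real.summable_one_div_nat_rpow.2 (by norm_num)
  set S0 := ∑' m : ℕ, 1 / (m:ℝ)^(9/8:ℝ) with hS
  have hS0 : 0 ≤ S0 := tsum_nonneg (fun m => by positivity)
  refine ⟨2 * S0 + 1 + II + 1, by linarith [II_nonneg], ?_⟩
  intro T hT Z
  have hT34 : 0 < T^(3/4:ℝ) := by positivity
  have e1 : ∑ m ∈ Icc 1 Z, ∫ u in (m:ℝ)..((m+1:ℕ):ℝ), gT T u = ∫ u in (1:ℝ)..((Z+1:ℕ):ℝ), gT T u := by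
    have := intervalIntegral.sum_integral_adjacent_intervals_Ico (a := fun k : ℕ => (k:ℝ)) (m := 1) (n := Z+1) (f := gT T) (μ := volume)
      (by omega) (fun k _ => gT_intv T _ _)
    rw [Nat.cast_one] at this
    rw [← this]
    congr 1
  have e2 := intervalIntegral.integral_interval_add_Ioi (gT_int_Ioi T 1 one_pos) (gT_int_Ioi T ((Z+1:ℕ):ℝ) (by positivity))
  have e3 := intervalIntegral.integral_interval_add_Ioi (gT_int_Ioi0 T) (gT_int_Ioi T 1 one_pos)
  rw [gT_scale T hT] at e3
  have t1 := gT_tail T ((Z+1:ℕ):ℝ) (by positivity)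
  have t2 : 0 ≤ ∫ u in Set.Ioi ((Z+1:ℕ):ℝ), gT T u := integral_nonneg (fun u => gT_nonneg T u)
  have t3 : 0 ≤ ∫ u in Set.Ioi (1:ℝ), gT T u := integral_nonneg (fun u => gT_nonneg T u)
  have t4 : 0 ≤ ∫ u in (0:ℝ)..1, gT T u := intervalIntegral.integral_nonneg zero_le_one (fun u _ => gT_nonneg T u)
  have t5 : ∫ u in (0:ℝ)..1, gT T u ≤ (1 + II) * T^(3/4:ℝ) := by
    rcases le_total 1 T with h | h
    · have : ∫ u in (0:ℝ)..1, gT T u ≤ ∫ u in (0:ℝ)..1, (1:ℝ) :=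
        intervalIntegral.integral_mono_on zero_le_one (gT_intv T 0 1) (by simp) (fun u _ => gT_le_one T u)
      simp at this
      have h2 : 1 ≤ T^(3/4:ℝ) := Real.one_le_rpow h (by norm_num)
      nlinarith [II_nonneg]
    · have : T ≤ T^(3/4:ℝ) := by
        calc T = T^(1:ℝ) := (Real.rpow_one T).symm
          _ ≤ _ := Real.rpow_le_rpow_of_exponent_ge hT h (by norm_num)
      nlinarith [II_nonneg]
  have s1 : |∑ m ∈ Icc 1 Z, (gT T m - ∫ u in (m:ℝ)..((m+1:ℕ):ℝ), gT T u)| ≤ 2 * T^(3/4:ℝ) * S0 := by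
    calc _ ≤ ∑ m ∈ Icc 1 Z, |gT T m - ∫ u in (m:ℝ)..((m+1:ℕ):ℝ), gT T u| := Finset.abs_sum_le_sum_abs _ _
      _ ≤ ∑ m ∈ Icc 1 Z, 2 * T^(3/4:ℝ) * (1 / (m:ℝ)^(9/8:ℝ)) := by
          apply Finset.sum_le_sum; intro m hm; exact eps_bound T hT m (Finset.mem_Icc.1 hm).1
      _ = 2 * T^(3/4:ℝ) * ∑ m ∈ Icc 1 Z, (1 / (m:ℝ)^(9/8:ℝ)) := by rw [Finset.mul_sum]
      _ ≤ _ := by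
          gcongr
          exact hsum.sum_le_tsum _ (fun m _ => by positivity)
  rw [Finset.sum_sub_distrib, e1] at s1
  change |∑ m ∈ Icc 1 Z, gT T m - II * T| ≤ _
  push_cast at *
  have hz : 0 ≤ T^2 / ((Z:ℝ)+1) := by positivity
  rw [abs_le] at s1 ⊢
  have x1 := mul_nonneg II_nonneg hT34.le
  have x2 := mul_nonneg II_nonneg hz
  have x3 := mul_nonneg hS0 hz
  constructor <;> nlinarith [s1.1, s1.2]

end SqV

namespace SqV
open Finset MeasureTheory Filter Topology

noncomputable def Gz (z : ℝ) : ℝ :=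
  (1/(2*√2)) * (Real.arctan (√2*z+1) + Real.arctan (√2*z-1))
   + (1/(4*√2)) * (Real.log (z^2+√2*z+1) - Real.log (z^2-√2*z+1))

lemma Gz_pos1 (z : ℝ) : 0 < z^2+√2*z+1 := by
  nlinarith [sq_nonneg (z+√2/2), Real.sq_sqrt (show (0:ℝ) ≤ 2 by norm_num)]
lemma Gz_pos2 (z : ℝ) : 0 < z^2-√2*z+1 := by
  nlinarith [sq_nonneg (z-√2/2), Real.sq_sqrt (show (0:ℝ) ≤ 2 by norm_num)]

lemma Gz_deriv (z : ℝ) : HasDerivAt Gz (1/(1+z^4)) z := by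
  have p1 := Gz_pos1 z
  have p2 := Gz_pos2 z
  have hw : (√2)^2 = 2 := Real.sq_sqrt (by norm_num)
  have hw0 : 0 < √2 := by positivity
  have d1 : HasDerivAt (fun z : ℝ => √2*z+1) (√2) z := by
    simpa using ((hasDerivAt_id z).const_mul (√2)).add_const 1
  have d2 : HasDerivAt (fun z : ℝ => √2*z-1) (√2) z := by
    simpa using ((hasDerivAt_id z).const_mul (√2)).sub_const 1
  have d3 : HasDerivAt (fun z : ℝ => z^2+√2*z+1) (2*z+√2) z := by
    simpa using (((hasDerivAt_pow 2 z)).add ((hasDerivAt_id z).const_mul (√2))).add_const 1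
  have d4 : HasDerivAt (fun z : ℝ => z^2-√2*z+1) (2*z-√2) z := by
    simpa using (((hasDerivAt_pow 2 z)).sub ((hasDerivAt_id z).const_mul (√2))).add_const 1
  have := ((d1.arctan.add d2.arctan).const_mul (1/(2*√2))).add
    (((d3.log p1.ne').sub (d4.log p2.ne')).const_mul (1/(4*√2)))
  refine this.congr_deriv ?_
  have e1 : 1 + (√2*z+1)^2 = 2*(z^2+√2*z+1) := by ring_nf; rw [hw]; ring
  have e2 : 1 + (√2*z-1)^2 = 2*(z^2-√2*z+1) := by ring_nf; rw [hw]; ring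
  have e3 : 1+z^4 = (z^2+√2*z+1)*(z^2-√2*z+1) := by ring_nf; rw [hw]; ring
  rw [e1, e2, e3]
  generalize hA : z^2+√2*z+1 = A at *
  generalize hB : z^2-√2*z+1 = B at *
  field_simp
  subst hA hB
  ring_nf

lemma Gz_zero : Gz 0 = 0 := by
  unfold Gz; simp [Real.arctan_neg]

lemma Gz_lim : Tendsto Gz atTop (𝓝 (Real.pi/(2*√2))) := by
  have hw0 : 0 < √2 := by positivity
  have t0 : Tendsto (fun z : ℝ => √2*z) atTop atTop := tendsto_id.const_mul_atTop hw0
  have a1 : Tendsto (fun z : ℝ => Real.arctan (√2*z+1)) atTop (𝓝 (Real.pi/2)) :=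
    (Real.tendsto_arctan_atTop.mono_right nhdsWithin_le_nhds).comp (tendsto_atTop_add_const_right _ 1 t0)
  have a2 : Tendsto (fun z : ℝ => Real.arctan (√2*z-1)) atTop (𝓝 (Real.pi/2)) :=
    (Real.tendsto_arctan_atTop.mono_right nhdsWithin_le_nhds).comp (tendsto_atTop_add_const_right _ (-1) t0)
  have i1 : Tendsto (fun z : ℝ => z⁻¹) atTop (𝓝 0) := tendsto_inv_atTop_zero
  have l : Tendsto (fun z : ℝ => Real.log (z^2+√2*z+1) - Real.log (z^2-√2*z+1)) atTop (𝓝 0) := by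
    have l1 : Tendsto (fun z : ℝ => Real.log (1+√2*z⁻¹+(z⁻¹)^2) - Real.log (1-√2*z⁻¹+(z⁻¹)^2)) atTop (𝓝 0) := by
      have c1 : Tendsto (fun z : ℝ => 1+√2*z⁻¹+(z⁻¹)^2) atTop (𝓝 1) := by
        simpa using ((i1.const_mul (√2)).const_add 1).add (i1.pow 2)
      have c2 : Tendsto (fun z : ℝ => 1-√2*z⁻¹+(z⁻¹)^2) atTop (𝓝 1) := by
        simpa using ((i1.const_mul (√2)).const_sub 1).add (i1.pow 2)
      simpa using (c1.log one_ne_zero).sub (c2.log one_ne_zero)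
    refine l1.congr' ?_
    filter_upwards [eventually_gt_atTop 0] with z hz
    have e1 : z^2+√2*z+1 = z^2*(1+√2*z⁻¹+(z⁻¹)^2) := by field_simp
    have e2 : z^2-√2*z+1 = z^2*(1-√2*z⁻¹+(z⁻¹)^2) := by field_simp
    have q1 := Gz_pos1 z
    have q2 := Gz_pos2 z
    have h1 : 0 < 1+√2*z⁻¹+(z⁻¹)^2 := by rw [e1] at q1; exact pos_of_mul_pos_right q1 (by positivity)
    have h2 : 0 < 1-√2*z⁻¹+(z⁻¹)^2 := by rw [e2] at q2; exact pos_of_mul_pos_right q2 (by positivity)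
    rw [e1, e2, Real.log_mul (by positivity) h1.ne', Real.log_mul (by positivity) h2.ne']
    ring
  have := ((a1.add a2).const_mul (1/(2*√2))).add (l.const_mul (1/(4*√2)))
  refine (this.congr (fun z => rfl)).trans (le_of_eq ?_)
  congr 1; ring

lemma int_y : IntegrableOn (fun y : ℝ => y^(1/2:ℝ) * (1/(y*(1+y^2)))) (Set.Ioi 0) ∧
    ∫ y in Set.Ioi (0:ℝ), y^(1/2:ℝ) * (1/(y*(1+y^2))) = Real.pi/√2 := by
  have hc : ContinuousWithinAt (fun y : ℝ => 2 * Gz (√y)) (Set.Ici 0) 0 := by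
    apply Continuous.continuousWithinAt
    have : Continuous Gz := continuous_iff_continuousAt.2 (fun z => (Gz_deriv z).continuousAt)
    fun_prop
  have hd : ∀ y ∈ Set.Ioi (0:ℝ), HasDerivAt (fun y : ℝ => 2 * Gz (√y)) (y^(1/2:ℝ) * (1/(y*(1+y^2)))) y := by
    intro y hy
    have hy : 0 < y := hy
    have h1 : HasDerivAt (fun y : ℝ => Gz (√y)) ((1/(1+(√y)^4)) * (1/(2*√y))) y :=
      (Gz_deriv (√y)).comp y (Real.hasDerivAt_sqrt hy.ne')
    refine (h1.const_mul 2).congr_deriv ?_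
    rw [← Real.sqrt_eq_rpow]
    have e : (√y)^4 = y^2 := by rw [show 4 = 2*2 by norm_num, pow_mul, Real.sq_sqrt hy.le]
    have e2 : y = √y*√y := (Real.mul_self_sqrt hy.le).symm
    have hs : 0 < √y := Real.sqrt_pos.2 hy
    rw [e]
    have : y⁻¹ * √y = (√y)⁻¹ := by nth_rw 1 [e2]; field_simp
    calc 2 * (1 / (1 + y ^ 2) * (1 / (2 * √y))) = (√y)⁻¹ * (1/(1+y^2)) := by field_simp
      _ = _ := by rw [← this]; field_simp
  have hn : ∀ y ∈ Set.Ioi (0:ℝ), 0 ≤ y^(1/2:ℝ) * (1/(y*(1+y^2))) := by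
    intro y hy; have hy : 0 < y := hy; positivity
  have hl : Tendsto (fun y : ℝ => 2 * Gz (√y)) atTop (𝓝 (Real.pi/√2)) := by
    have := (Gz_lim.comp Real.tendsto_sqrt_atTop).const_mul 2
    refine this.trans (le_of_eq ?_)
    congr 1; field_simp
  refine ⟨integrableOn_Ioi_deriv_of_nonneg hc hd hn hl, ?_⟩
  rw [integral_Ioi_of_hasDerivAt_of_nonneg hc hd hn hl]
  simp [Gz_zero]

lemma int_s (y : ℝ) (hy : 0 < y) : IntegrableOn (fun s : ℝ => (1 - Real.cos s) * Real.exp (-(y*s))) (Set.Ioi 0) ∧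
    ∫ s in Set.Ioi (0:ℝ), (1 - Real.cos s) * Real.exp (-(y*s)) = 1/(y*(1+y^2)) := by
  set F : ℝ → ℝ := fun s => Real.exp (-(y*s)) * (-(1/y) - (Real.sin s - y*Real.cos s)/(1+y^2)) with hF
  have hd : ∀ s : ℝ, HasDerivAt F ((1 - Real.cos s) * Real.exp (-(y*s))) s := by
    intro s
    have d0 : HasDerivAt (fun s : ℝ => -(y*s)) (-y) s := by
      simpa using ((hasDerivAt_id s).const_mul y).fun_neg
    have d1 := d0.exp
    have d2 : HasDerivAt (fun s => -(1/y) - (Real.sin s - y*Real.cos s)/(1+y^2))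
      (-((Real.cos s + y*Real.sin s)/(1+y^2))) s := by
      have := (((Real.hasDerivAt_sin s).sub ((Real.hasDerivAt_cos s).const_mul y)).div_const (1+y^2)).const_sub (-(1/y))
      refine this.congr_deriv ?_
      ring
    refine (d1.mul d2).congr_deriv ?_
    have : (1+y^2) ≠ 0 := by positivity
    field_simp
    ring
  have hn : ∀ s ∈ Set.Ioi (0:ℝ), 0 ≤ (1 - Real.cos s) * Real.exp (-(y*s)) := by
    intro s _; have := Real.cos_le_one s; exact mul_nonneg (by linarith) (Real.exp_pos _).le
  have hl : Tendsto F atTop (𝓝 0) := by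
    have e0 : Tendsto (fun s : ℝ => Real.exp (-(y*s))) atTop (𝓝 0) :=
      Real.tendsto_exp_neg_atTop_nhds_zero.comp (tendsto_id.const_mul_atTop hy)
    have e1 := e0.mul_const (1/y + (1+y)/(1+y^2))
    rw [zero_mul] at e1
    refine squeeze_zero_norm (fun s => ?_) e1
    rw [hF, Real.norm_eq_abs, abs_mul, abs_of_pos (Real.exp_pos _)]
    refine mul_le_mul_of_nonneg_left ?_ (Real.exp_pos _).le
    refine (abs_sub _ _).trans ?_
    rw [abs_neg, abs_of_pos (by positivity : 0 < 1/y), abs_div, abs_of_pos (by positivity : 0 < 1+y^2)]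
    gcongr
    refine (abs_sub _ _).trans ?_
    rw [abs_mul, abs_of_pos hy]
    have := Real.abs_sin_le_one s
    have := Real.abs_cos_le_one s
    nlinarith
  refine ⟨integrableOn_Ioi_deriv_of_nonneg' (fun s _ => hd s) hn hl, ?_⟩
  rw [integral_Ioi_of_hasDerivAt_of_nonneg' (fun s _ => hd s) hn hl]
  simp [hF]
  field_simp
  ring

end SqV

namespace SqV
open Finset MeasureTheory Filter Topology

lemma int_x : ∫ s in Set.Ioi (0:ℝ), (1 - Real.cos s) * s^(-(3/2):ℝ) = √(2*Real.pi) := by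
  have hg : Real.Gamma (3/2) = √Real.pi/2 := by
    have := Real.Gamma_add_one (s := 1/2) (by norm_num)
    rw [Real.Gamma_one_half_eq] at this
    rw [show (3/2:ℝ) = 1/2+1 by norm_num, this]; ring
  have hint : Integrable (Function.uncurry (fun (s y : ℝ) => y^(1/2:ℝ) * ((1 - Real.cos s) * Real.exp (-(y*s)))))
      ((volume.restrict (Set.Ioi (0:ℝ))).prod (volume.restrict (Set.Ioi (0:ℝ)))) := by
    rw [integrable_prod_iff']
    · constructor
      · refine (ae_restrict_iff' measurableSet_Ioi).2 (Filter.Eventually.of_forall (fun y hy => ?_))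
        have h5 := Integrable.const_mul (int_s y hy).1 (y^(1/2:ℝ))
        exact h5
      · refine int_y.1.congr ?_
        refine (ae_restrict_iff' measurableSet_Ioi).2 (Filter.Eventually.of_forall (fun y hy => ?_))
        have hy' : 0 < y := hy
        show y^(1/2:ℝ) * (1/(y*(1+y^2))) = ∫ s in Set.Ioi (0:ℝ), ‖y^(1/2:ℝ) * ((1 - Real.cos s) * Real.exp (-(y*s)))‖
        rw [← (int_s y hy).2, ← integral_const_mul]
        refine setIntegral_congr_fun measurableSet_Ioi (fun s _ => ?_)
        have := Real.cos_le_one s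
        have h2 : 0 ≤ 1 - Real.cos s := by linarith
        exact (Real.norm_of_nonneg (by positivity)).symm
    · refine Measurable.aestronglyMeasurable ?_
      unfold Function.uncurry
      fun_prop
  have hsw := integral_integral_swap hint
  have r : ∫ y in Set.Ioi (0:ℝ), ∫ s in Set.Ioi (0:ℝ), y^(1/2:ℝ) * ((1 - Real.cos s) * Real.exp (-(y*s))) = Real.pi/√2 := by
    rw [← int_y.2]
    refine setIntegral_congr_fun measurableSet_Ioi (fun y hy => ?_)
    show ∫ s in Set.Ioi (0:ℝ), y^(1/2:ℝ) * ((1 - Real.cos s) * Real.exp (-(y*s))) = _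
    rw [integral_const_mul, (int_s y hy).2]
  have l : ∫ s in Set.Ioi (0:ℝ), ∫ y in Set.Ioi (0:ℝ), y^(1/2:ℝ) * ((1 - Real.cos s) * Real.exp (-(y*s))) =
      (√Real.pi/2) * ∫ s in Set.Ioi (0:ℝ), (1 - Real.cos s) * s^(-(3/2):ℝ) := by
    rw [← integral_const_mul]
    refine setIntegral_congr_fun measurableSet_Ioi (fun s hs => ?_)
    have hs : 0 < s := hs
    have := Real.integral_rpow_mul_exp_neg_mul_Ioi (a := 3/2) (r := s) (by norm_num) hs
    rw [hg] at this
    show ∫ y in Set.Ioi (0:ℝ), y^(1/2:ℝ) * ((1 - Real.cos s) * Real.exp (-(y*s))) = √Real.pi/2 * ((1 - Real.cos s) * s^(-(3/2):ℝ))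
    rw [Real.rpow_neg hs.le, ← Real.inv_rpow hs.le, ← one_div]
    rw [mul_left_comm, mul_comm (√Real.pi/2), ← this, ← integral_const_mul]
    refine setIntegral_congr_fun measurableSet_Ioi (fun y hy => ?_)
    show _ = (1 - Real.cos s) * (y ^ ((3:ℝ) / 2 - 1) * Real.exp (-(s * y)))
    rw [show (3:ℝ)/2-1 = 1/2 by norm_num, mul_comm s y]; ring
  rw [hsw, r] at l
  have hp : 0 < √Real.pi := Real.sqrt_pos.2 Real.pi_pos
  have h2 : 0 < √2 := by positivity
  have e : Real.pi = √Real.pi * √Real.pi := (Real.mul_self_sqrt Real.pi_pos.le).symm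
  have e2 : √2*√2 = 2 := Real.mul_self_sqrt (by norm_num)
  rw [Real.sqrt_mul (by norm_num)]
  have h3 : (√Real.pi/2) * (√2 * √Real.pi) = Real.pi / √2 := by
    rw [eq_div_iff h2.ne']
    calc √Real.pi/2 * (√2 * √Real.pi) * √2 = (√Real.pi*√Real.pi)*(√2*√2)/2 := by ring
      _ = _ := by rw [← e, e2]; ring
  rw [← h3] at l
  exact (mul_left_cancel₀ (by positivity) l).symm

lemma int_u (c : ℝ) (hc : 0 < c) :
    ∫ u in Set.Ioi (0:ℝ), (1 - Real.cos (c * (1/u^2))) = √c * √(2*Real.pi) / 2 := by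
  have h := integral_comp_rpow_Ioi (fun u : ℝ => 1 - Real.cos (c * (1/u^2))) (p := -(1/2)) (by norm_num)
  rw [← h]
  have h2 := integral_comp_mul_left_Ioi (fun s : ℝ => (1 - Real.cos s) * s^(-(3/2):ℝ)) 0 hc
  rw [mul_zero, int_x, smul_eq_mul] at h2
  have e : √c * √(2*Real.pi) / 2 = (1/2 * c^(3/2:ℝ)) * (c⁻¹ * √(2*Real.pi)) := by
    have : c^(3/2:ℝ) * c⁻¹ = √c := by
      rw [Real.sqrt_eq_rpow, ← Real.rpow_neg_one, ← Real.rpow_add hc]; norm_num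
    rw [← this]; ring
  rw [e, ← h2, ← integral_const_mul]
  refine setIntegral_congr_fun measurableSet_Ioi (fun x hx => ?_)
  have hx : 0 < x := hx
  show (|(-(1/2):ℝ)| * x^(-(1/2) - 1:ℝ)) • (1 - Real.cos (c * (1/(x^(-(1/2):ℝ))^2))) = _
  have e1 : (x^(-(1/2):ℝ))^2 = x⁻¹ := by
    rw [← Real.rpow_natCast, ← Real.rpow_mul hx.le]; norm_num [Real.rpow_neg_one]
  have e2 : |(-(1/2):ℝ)| = 1/2 := by norm_num [abs_of_pos]
  rw [e1, e2, smul_eq_mul, Real.mul_rpow hc.le hx.le, one_div x⁻¹, inv_inv]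
  have e3 : c^(3/2:ℝ) * c^(-(3/2):ℝ) = 1 := by rw [← Real.rpow_add hc]; norm_num
  rw [show (-(1/2) - 1:ℝ) = -(3/2) by norm_num]
  linear_combination (-(1/2)) * ((1 - Real.cos (c*x)) * x^(-(3/2):ℝ)) * e3

lemma hh_fourier (t : ℝ) :
    HasSum (fun n : ℕ => (1 - Real.cos (2*Real.pi*n*t)) / (Real.pi^2*(n:ℝ)^2)) (hh t) := by
  set x := Int.fract t with hx
  have hx0 : x ∈ Set.Icc (0:ℝ) 1 := ⟨Int.fract_nonneg t, (Int.fract_lt_one t).le⟩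
  have h1 := hasSum_one_div_nat_pow_mul_cos (k := 1) one_ne_zero hx0
  have h2 := hasSum_zeta_two
  have h3 := (h2.sub h1).mul_left (1/Real.pi^2)
  have hp : Real.pi ≠ 0 := Real.pi_ne_zero
  convert! h3 using 1
  · funext n
    have : Real.cos (2*Real.pi*n*t) = Real.cos (2*Real.pi*n*x) := by
      have ht : t = ⌊t⌋ + x := (Int.floor_add_fract t).symm
      rw [ht]
      have := Real.cos_add_int_mul_two_pi (2*Real.pi*n*x) (n*⌊t⌋)
      rw [← this]; congr 1; push_cast; ring
    rw [this]
    simp only [mul_one]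
    by_cases hn : (n:ℝ) = 0
    · simp [hn]
    · field_simp
  · have hb : Polynomial.eval x (Polynomial.map (algebraMap ℚ ℝ) (Polynomial.bernoulli (2*1))) = x^2 - x + 1/6 := by
      have := bernoulliFun_two x
      unfold bernoulliFun at this
      rw [mul_one, this]; ring
    rw [hb]
    unfold hh
    rw [← hx]
    norm_num [Nat.factorial]
    field_simp
    ring

lemma zeta_real : riemannZeta (3/2) = ((∑' n : ℕ, 1/(n:ℝ)^(3/2:ℝ) : ℝ) : ℂ) := by
  have h32 : (1:ℝ) < ((3/2:ℂ)).re := by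
    rw [show (3/2:ℂ) = ((3/2:ℝ):ℂ) by push_cast; rfl, Complex.ofReal_re]; norm_num
  rw [zeta_eq_tsum_one_div_nat_cpow h32, Complex.ofReal_tsum]
  refine tsum_congr (fun n => ?_)
  push_cast
  rw [Complex.ofReal_cpow (by positivity)]
  push_cast; rfl

lemma II_eq : II = (riemannZeta (3/2)).re / Real.pi := by
  have hp := Real.pi_pos
  set F : ℕ → ℝ → ℝ := fun n u => (1 - Real.cos (2*Real.pi*n*(1/u^2))) / (Real.pi^2*(n:ℝ)^2) with hF
  have hFn : ∀ n u, 0 ≤ F n u := fun n u => by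
    have := Real.cos_le_one (2*Real.pi*n*(1/u^2))
    exact div_nonneg (by linarith) (by positivity)
  have hg : ∀ u, HasSum (fun n => F n u) (gT 1 u) := fun u => by
    unfold gT; rw [one_pow]; exact hh_fourier _
  have hFi : ∀ n, IntegrableOn (F n) (Set.Ioi 0) := by
    intro n
    refine Integrable.mono' (gT_int_Ioi0 1) (Measurable.aestronglyMeasurable (by rw [hF]; fun_prop)) ?_
    refine Filter.Eventually.of_forall (fun u => ?_)
    rw [Real.norm_of_nonneg (hFn n u)]
    exact le_hasSum (hg u) n (fun m _ => hFn m u)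
  have hv : ∀ n : ℕ, ∫ u in Set.Ioi (0:ℝ), F n u = (1/Real.pi) * (1/(n:ℝ)^(3/2:ℝ)) := by
    intro n
    rw [hF]; simp only
    rw [integral_div]
    rcases Nat.eq_zero_or_pos n with h0 | h0
    · subst h0; simp
    · have hn : (0:ℝ) < n := by exact_mod_cast h0
      rw [int_u _ (by positivity)]
      have e1 : √(2*Real.pi*n) = √(2*Real.pi) * √n := Real.sqrt_mul (by positivity) _
      have e2 : √(2*Real.pi)*√(2*Real.pi) = 2*Real.pi := Real.mul_self_sqrt (by positivity)
      have e3 : (n:ℝ)^2 = √n * (n:ℝ)^(3/2:ℝ) := by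
        rw [Real.sqrt_eq_rpow, ← Real.rpow_add hn, ← Real.rpow_natCast]; norm_num
      have hs : 0 < √(n:ℝ) := Real.sqrt_pos.2 hn
      have hs2 : 0 < (n:ℝ)^(3/2:ℝ) := by positivity
      rw [e1, e3, show √(2*Real.pi) * √n * √(2*Real.pi) = (√(2*Real.pi)*√(2*Real.pi))*√n by ring, e2]
      field_simp
  have hs : Summable (fun n : ℕ => 1/(n:ℝ)^(3/2:ℝ)) := Real.summable_one_div_nat_rpow.2 (by norm_num)
  have key := hasSum_integral_of_summable_integral_norm (μ := volume.restrict (Set.Ioi (0:ℝ))) (F := F) hFi (by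
    refine (hs.mul_left (1/Real.pi)).congr (fun n => ?_)
    rw [← hv n]
    exact integral_congr_ae (Filter.Eventually.of_forall (fun u => (Real.norm_of_nonneg (hFn n u)).symm)))
  have e : ∫ u in Set.Ioi (0:ℝ), ∑' n, F n u = II := by
    unfold II
    exact integral_congr_ae (Filter.Eventually.of_forall (fun u => (hg u).tsum_eq))
  rw [e] at key
  have h1 : II = ∑' n : ℕ, (1/Real.pi) * (1/(n:ℝ)^(3/2:ℝ)) := by
    rw [← key.tsum_eq]; exact tsum_congr hv
  have hz := zeta_real
  rw [h1, hz, Complex.ofReal_re, tsum_mul_left]; ring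

lemma II_pos : 0 < II := by
  have hp := Real.pi_pos
  have hs : Summable (fun n : ℕ => 1/(n:ℝ)^(3/2:ℝ)) := Real.summable_one_div_nat_rpow.2 (by norm_num)
  have hz : riemannZeta (3/2) = ((∑' n : ℕ, 1/(n:ℝ)^(3/2:ℝ) : ℝ) : ℂ) := zeta_real
  rw [II_eq, hz, Complex.ofReal_re]
  refine div_pos (hs.tsum_pos (fun n => by positivity) 1 (by norm_num)) hp

end SqV

namespace SqV
open Finset

local notation "μ" => ArithmeticFunction.moebius

lemma sum_mult (Z f : ℕ) (hf : 0 < f) (g : ℕ → ℝ) :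
    ∑ n ∈ (Icc 1 Z).filter (fun n => f ∣ n), g n = ∑ m ∈ Icc 1 (Z/f), g (f*m) := by
  symm
  refine Finset.sum_bij (fun m _ => f*m) ?_ ?_ ?_ ?_
  · intro m hm
    rw [mem_Icc] at hm
    rw [mem_filter, mem_Icc]
    refine ⟨⟨Nat.mul_pos hf hm.1, ?_⟩, Dvd.intro _ rfl⟩
    rw [mul_comm]; exact (Nat.le_div_iff_mul_le hf).1 hm.2
  · intro a _ b _ h; exact Nat.eq_of_mul_eq_mul_left hf h
  · intro n hn
    rw [mem_filter, mem_Icc] at hn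
    obtain ⟨m, rfl⟩ := hn.2
    refine ⟨m, ?_, rfl⟩
    rw [mem_Icc]
    refine ⟨Nat.pos_of_mul_pos_left hn.1.1, ?_⟩
    rw [Nat.le_div_iff_mul_le hf, mul_comm]; exact hn.1.2
  · intro m _; rfl

lemma cop_ind (n r : ℕ) (hr : 0 < r) :
    (if Nat.Coprime n r then (1:ℝ) else 0) = ∑ f ∈ r.divisors, if f ∣ n then (μ f : ℝ) else 0 := by
  have := coprime_ind (n:ℤ) r hr
  simp only [Int.gcd_natCast_natCast, Int.natCast_dvd_natCast] at this
  exact this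

lemma sum_DD_eq (r Z : ℕ) (hr : 0 < r) (g : ℕ → ℝ) :
    ∑ n ∈ DD r Z, g n = ∑ f ∈ r.divisors, (μ f : ℝ) * ∑ m ∈ Icc 1 (Z/f), g (f*m) := by
  unfold DD
  rw [sum_filter]
  have : ∀ n ∈ Icc 1 Z, (if Nat.Coprime n r then g n else 0) = ∑ f ∈ r.divisors, (μ f:ℝ) * (if f ∣ n then g n else 0) := by
    intro n _
    have h := cop_ind n r hr
    have h2 : (if Nat.Coprime n r then g n else 0) = (if Nat.Coprime n r then (1:ℝ) else 0) * g n := by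
      split_ifs <;> simp
    rw [h2, h, sum_mul]
    refine sum_congr rfl (fun f _ => ?_)
    split_ifs <;> simp
  rw [sum_congr rfl this, sum_comm]
  refine sum_congr rfl (fun f hf => ?_)
  rw [← mul_sum, ← sum_filter, sum_mult _ _ (Nat.pos_of_mem_divisors hf)]

lemma div_succ_ge (Z f : ℕ) (hf : 0 < f) : ((Z:ℝ)+1)/f ≤ ((Z/f:ℕ):ℝ) + 1 := by
  have hf' : (0:ℝ) < f := by exact_mod_cast hf
  rw [div_le_iff₀ hf']
  have := Nat.lt_div_mul_add (a := Z) hf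
  have h2 : Z + 1 ≤ (Z/f + 1) * f := by rw [add_mul, one_mul]; exact this
  exact_mod_cast h2

lemma h_sum_cop : ∃ C > 0, ∀ r : ℕ, 0 < r → ∀ T : ℝ, 0 < T → ∀ Z : ℕ,
    |∑ m ∈ DD r Z, hh (T^2/(m:ℝ)^2) - II*T*((r.totient:ℝ)/r)| ≤
      C * (r.divisors.card:ℝ) * (T^(3/4:ℝ) + T^2/(Z+1)) := by
  obtain ⟨C, hC, hs⟩ := h_sum
  refine ⟨C, hC, fun r hr T hT Z => ?_⟩
  rw [sum_DD_eq r Z hr, ← sum_moebius_div r hr, mul_sum, ← sum_sub_distrib]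
  refine (abs_sum_le_sum_abs _ _).trans ?_
  have : ∀ f ∈ r.divisors, |(μ f:ℝ) * ∑ m ∈ Icc 1 (Z/f), hh (T^2/((f*m:ℕ):ℝ)^2) - II*T*((μ f:ℝ)/f)| ≤
      C * (T^(3/4:ℝ) + T^2/(Z+1)) := by
    intro f hf
    have hf0 : 0 < f := Nat.pos_of_mem_divisors hf
    have hf' : (0:ℝ) < f := by exact_mod_cast hf0
    have hf1 : (1:ℝ) ≤ f := by exact_mod_cast hf0
    have h := hs (T/f) (by positivity) (Z/f)
    have e1 : ∀ m : ℕ, (T/f)^2/(m:ℝ)^2 = T^2/((f*m:ℕ):ℝ)^2 := by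
      intro m; push_cast; rw [div_pow, div_div, mul_pow]
    simp only [e1] at h
    have e2 : (μ f:ℝ) * ∑ m ∈ Icc 1 (Z/f), hh (T^2/((f*m:ℕ):ℝ)^2) - II*T*((μ f:ℝ)/f) =
      (μ f:ℝ) * (∑ m ∈ Icc 1 (Z/f), hh (T^2/((f*m:ℕ):ℝ)^2) - II*(T/f)) := by ring
    rw [e2, abs_mul]
    refine (mul_le_of_le_one_left (abs_nonneg _) (moebius_abs_le f)).trans (h.trans ?_)
    refine mul_le_mul_of_nonneg_left (add_le_add ?_ ?_) hC.le
    · exact Real.rpow_le_rpow (by positivity) (div_le_self hT.le hf1) (by norm_num)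
    · have h1 := div_succ_ge Z f hf0
      calc (T/f)^2/(((Z/f:ℕ):ℝ)+1) ≤ (T/f)^2/(((Z:ℝ)+1)/f) := by gcongr
        _ = T^2/(Z+1) * (1/f) := by field_simp
        _ ≤ T^2/(Z+1) * 1 := by gcongr; rw [div_le_one hf']; exact hf1
        _ = _ := mul_one _
  refine (sum_le_sum this).trans (le_of_eq ?_)
  rw [sum_const, nsmul_eq_mul]; ring

noncomputable def SSm (K : ℝ) (r Z : ℕ) : ℝ := ∑ δ ∈ DD r Z, (μ δ : ℝ)^2 * hh (K/(δ:ℝ)^2)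

lemma SSm_eq (K : ℝ) (r Z : ℕ) :
    SSm K r Z = ∑ b ∈ DD r Z, (μ b : ℝ) * ∑ m ∈ DD r (Z/b^2), hh (K/((b^2*m:ℕ):ℝ)^2) := by
  unfold SSm
  have h1 : ∀ δ ∈ DD r Z, (μ δ : ℝ)^2 * hh (K/(δ:ℝ)^2) = ∑ b ∈ DD r Z, (μ b:ℝ) * (if b^2 ∣ δ then hh (K/(δ:ℝ)^2) else 0) := by
    intro δ hδ
    unfold DD at hδ
    rw [mem_filter, mem_Icc] at hδ
    rw [moebius_sq_sum δ Z hδ.1.1 hδ.1.2, sum_mul, sum_filter]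
    unfold DD
    rw [sum_filter]
    refine sum_congr rfl (fun b _ => ?_)
    by_cases hb : b^2 ∣ δ
    · have : Nat.Coprime b r := Nat.Coprime.coprime_dvd_left ((dvd_pow_self b two_ne_zero).trans hb) hδ.2
      simp [hb, this]
    · simp [hb]
  rw [sum_congr rfl h1, sum_comm]
  refine sum_congr rfl (fun b hb => ?_)
  unfold DD at hb
  rw [mem_filter, mem_Icc] at hb
  rw [← mul_sum]
  congr 1
  unfold DD
  have hb2 : 0 < b^2 := by have := hb.1.1; positivity
  have e1 : ∑ n ∈ (Icc 1 Z).filter (fun d => Nat.Coprime d r), (if b^2 ∣ n then hh (K/(n:ℝ)^2) else 0) =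
      ∑ n ∈ (Icc 1 Z).filter (fun n => b^2 ∣ n), (if Nat.Coprime n r then hh (K/(n:ℝ)^2) else 0) := by
    rw [sum_filter, sum_filter]
    refine sum_congr rfl (fun n _ => ?_)
    split_ifs <;> rfl
  rw [e1, sum_mult _ _ hb2, sum_filter]
  refine sum_congr rfl (fun m _ => ?_)
  have : Nat.Coprime (b^2*m) r ↔ Nat.Coprime m r := by
    rw [Nat.coprime_mul_iff_left]
    exact ⟨fun h => h.2, fun h => ⟨Nat.Coprime.pow_left 2 hb.2, h⟩⟩
  simp only [this]

lemma S_lemma : ∃ C > 0, ∀ r : ℕ, 0 < r → ∀ T : ℝ, 1 ≤ T → ∀ Z : ℕ, 1 ≤ Z →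
    |SSm (T^2) r Z - II*T*((r.totient:ℝ)/r)*Cq r| ≤
      C * (r.divisors.card:ℝ) * (T^(3/4:ℝ) + T^2/(Z+1)) := by
  obtain ⟨C, hC, hs⟩ := h_sum_cop
  have hsum : Summable (fun n : ℕ => 1/(n:ℝ)^(3/2:ℝ)) := Real.summable_one_div_nat_rpow.2 (by norm_num)
  set W := ∑' n : ℕ, 1/(n:ℝ)^(3/2:ℝ) with hW
  have hW0 : 0 ≤ W := tsum_nonneg (fun n => by positivity)
  have hII := II_pos
  refine ⟨C*W + 2*II, by positivity, fun r hr T hT Z hZ => ?_⟩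
  have hT0 : 0 < T := by linarith
  have hZ0 : (0:ℝ) < Z := by exact_mod_cast hZ
  have hZ1 : (1:ℝ) ≤ Z := by exact_mod_cast hZ
  set A := T^(3/4:ℝ) + T^2/((Z:ℝ)+1) with hA
  have hA0 : 0 ≤ A := by positivity
  have hτ : (1:ℝ) ≤ (r.divisors.card:ℝ) := by
    exact_mod_cast Finset.card_pos.2 ⟨1, Nat.one_mem_divisors.2 hr.ne'⟩
  have hφ : (r.totient:ℝ)/r ≤ 1 := by
    rw [div_le_one (by exact_mod_cast hr)]; exact_mod_cast Nat.totient_le r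
  have hφ0 : 0 ≤ (r.totient:ℝ)/r := by positivity
  have part1 : |SSm (T^2) r Z - II*T*((r.totient:ℝ)/r)*∑ b ∈ DD r Z, (μ b:ℝ)*(1/(b:ℝ)^2)| ≤
      C * (r.divisors.card:ℝ) * A * W := by
    rw [SSm_eq, mul_sum, ← sum_sub_distrib]
    refine (abs_sum_le_sum_abs _ _).trans ?_
    have : ∀ b ∈ DD r Z, |(μ b:ℝ) * ∑ m ∈ DD r (Z/b^2), hh (T^2/((b^2*m:ℕ):ℝ)^2) -
        II*T*((r.totient:ℝ)/r)*((μ b:ℝ)*(1/(b:ℝ)^2))| ≤ C * (r.divisors.card:ℝ) * A * (1/(b:ℝ)^(3/2:ℝ)) := by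
      intro b hb
      unfold DD at hb
      rw [mem_filter, mem_Icc] at hb
      have hb1 : (1:ℝ) ≤ b := by exact_mod_cast hb.1.1
      have hb0 : (0:ℝ) < b := by linarith
      have hb2 : 0 < b^2 := by have := hb.1.1; positivity
      have h := hs r hr (T/(b:ℝ)^2) (by positivity) (Z/b^2)
      have e1 : ∀ m : ℕ, (T/(b:ℝ)^2)^2/(m:ℝ)^2 = T^2/((b^2*m:ℕ):ℝ)^2 := by
        intro m; push_cast; rw [div_pow, div_div, mul_pow]
      simp only [e1] at h
      have e2 : (μ b:ℝ) * ∑ m ∈ DD r (Z/b^2), hh (T^2/((b^2*m:ℕ):ℝ)^2) -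
        II*T*((r.totient:ℝ)/r)*((μ b:ℝ)*(1/(b:ℝ)^2)) =
        (μ b:ℝ) * (∑ m ∈ DD r (Z/b^2), hh (T^2/((b^2*m:ℕ):ℝ)^2) - II*(T/(b:ℝ)^2)*((r.totient:ℝ)/r)) := by ring
      rw [e2, abs_mul]
      refine (mul_le_of_le_one_left (abs_nonneg _) (moebius_abs_le b)).trans (h.trans ?_)
      rw [mul_assoc (C*(r.divisors.card:ℝ))]
      refine mul_le_mul_of_nonneg_left ?_ (by positivity)
      rw [hA, add_mul]
      have hp : (0:ℝ) < (b:ℝ)^(3/2:ℝ) := by positivity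
      refine add_le_add (le_of_eq ?_) ?_
      · rw [Real.div_rpow hT0.le (by positivity), ← Real.rpow_natCast, ← Real.rpow_mul hb0.le]
        norm_num; rfl
      · have h1 := div_succ_ge Z (b^2) hb2
        push_cast at h1
        have h3 : (b:ℝ)^(3/2:ℝ) ≤ (b:ℝ)^2 := by
          rw [← Real.rpow_natCast]; exact Real.rpow_le_rpow_of_exponent_le hb1 (by norm_num)
        calc (T/(b:ℝ)^2)^2/(((Z/b^2:ℕ):ℝ)+1) ≤ (T/(b:ℝ)^2)^2/(((Z:ℝ)+1)/(b:ℝ)^2) := by gcongr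
          _ = T^2/(Z+1) * (1/(b:ℝ)^2) := by field_simp
          _ ≤ _ := by gcongr
    refine (sum_le_sum this).trans ?_
    rw [← mul_sum]
    refine mul_le_mul_of_nonneg_left ?_ (by positivity)
    exact hsum.sum_le_tsum _ (fun n _ => by positivity)
  have part2 : |∑ b ∈ DD r Z, (μ b:ℝ)*(1/(b:ℝ)^2) - Cq r| ≤ 1/Z := by
    have h := ff_tail h1 HB_h1 r Z hr.ne' (by omega)
    rw [ff_sum_DD, ← Cq_eq] at h
    refine le_of_eq_of_le ?_ h
    congr 2
    refine sum_congr rfl (fun b hb => ?_)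
    unfold DD at hb
    rw [mem_filter, mem_Icc] at hb
    have := ff_h1 r b hb.2
    rw [← this]; unfold ff; rw [if_pos hb.2]
  have e : SSm (T^2) r Z - II*T*((r.totient:ℝ)/r)*Cq r =
    (SSm (T^2) r Z - II*T*((r.totient:ℝ)/r)*∑ b ∈ DD r Z, (μ b:ℝ)*(1/(b:ℝ)^2)) +
     II*T*((r.totient:ℝ)/r)*(∑ b ∈ DD r Z, (μ b:ℝ)*(1/(b:ℝ)^2) - Cq r) := by ring
  rw [e]
  refine (abs_add_le _ _).trans ?_
  have p3 : |II*T*((r.totient:ℝ)/r)*(∑ b ∈ DD r Z, (μ b:ℝ)*(1/(b:ℝ)^2) - Cq r)| ≤ 2*II*A := by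
    rw [abs_mul, abs_of_nonneg (by positivity)]
    calc _ ≤ II*T*1*(1/Z) := by gcongr
      _ = II*(T/Z) := by ring
      _ ≤ II*(2*(T^2/(Z+1))) := by
        refine mul_le_mul_of_nonneg_left ?_ hII.le
        rw [← mul_div_assoc, div_le_div_iff₀ hZ0 (by positivity)]
        nlinarith [mul_le_mul hT hZ1 zero_le_one hT0.le, mul_nonneg (mul_nonneg hT0.le (sub_nonneg.2 hT)) hZ0.le, mul_nonneg hT0.le (sub_nonneg.2 hZ1)]
      _ ≤ II*(2*A) := by
        have : 0 ≤ T^(3/4:ℝ) := by positivity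
        refine mul_le_mul_of_nonneg_left ?_ hII.le
        rw [hA]; linarith
      _ = _ := by ring
  have p4 : 2*II*A ≤ 2*II*A*(r.divisors.card:ℝ) := le_mul_of_one_le_right (by positivity) hτ
  calc _ ≤ C * (r.divisors.card:ℝ) * A * W + 2*II*A*(r.divisors.card:ℝ) := add_le_add part1 (p3.trans p4)
    _ = _ := by ring

end SqV

namespace SqV
open Finset

local notation "μ" => ArithmeticFunction.moebius

def EE (q D : ℕ) : Finset (ℕ × ℕ) := ((DD q D) ×ˢ (DD q D)).filter (fun e => Nat.Coprime e.1 e.2)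

lemma mem_DD (q D d : ℕ) : d ∈ DD q D ↔ (1 ≤ d ∧ d ≤ D) ∧ Nat.Coprime d q := by
  unfold DD; rw [mem_filter, mem_Icc]

lemma mem_EE (q D : ℕ) (e : ℕ × ℕ) : e ∈ EE q D ↔ (e.1 ∈ DD q D ∧ e.2 ∈ DD q D) ∧ Nat.Coprime e.1 e.2 := by
  unfold EE; rw [mem_filter, mem_product]

lemma TD_eq (K : ℝ) (q D : ℕ) :
    TD K q D = ∑ e ∈ EE q D, (μ e.1 : ℝ) * (μ e.2 : ℝ) / ((e.1:ℝ)*e.2)^2 *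
      SSm K (q*e.1*e.2) (D / max e.1 e.2) := by
  unfold TD SSm
  simp only [mul_sum]
  rw [← sum_product', sum_sigma']
  symm
  have hval : ∀ x ∈ (EE q D).sigma (fun e => DD (q*e.1*e.2) (D / max e.1 e.2)),
      (μ x.1.1 : ℝ) * (μ x.1.2 : ℝ) / ((x.1.1:ℝ)*x.1.2)^2 * ((μ x.2 : ℝ)^2 * hh (K/(x.2:ℝ)^2)) =
      (μ (x.2*x.1.1) : ℝ) * (μ (x.2*x.1.2) : ℝ) * ((Nat.gcd (x.2*x.1.1) (x.2*x.1.2) : ℝ)^4 *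
        hh (K / (Nat.gcd (x.2*x.1.1) (x.2*x.1.2) : ℝ)^2) / (((x.2*x.1.1:ℕ):ℝ) * ((x.2*x.1.2:ℕ):ℝ))^2) := by
    rintro ⟨⟨e1, e2⟩, d⟩ hx
    simp only [mem_sigma, mem_EE, mem_DD] at hx
    obtain ⟨⟨⟨⟨⟨a1, a2⟩, a3⟩, ⟨⟨b1, b2⟩, b3⟩⟩, hc⟩, ⟨c1, c2⟩, c3⟩ := hx
    have c4 : Nat.Coprime d e1 := c3.coprime_dvd_right ((Dvd.intro_left _ rfl : e1 ∣ q*e1).mul_right e2)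
    have c5 : Nat.Coprime d e2 := c3.coprime_dvd_right (Dvd.intro_left _ rfl)
    simp only
    rw [ArithmeticFunction.isMultiplicative_moebius.map_mul_of_coprime c4,
      ArithmeticFunction.isMultiplicative_moebius.map_mul_of_coprime c5, Nat.gcd_mul_left, hc, mul_one]
    have : (d:ℝ) ≠ 0 := by exact_mod_cast (show d ≠ 0 by omega)
    have : (e1:ℝ) ≠ 0 := by exact_mod_cast (show e1 ≠ 0 by omega)
    have : (e2:ℝ) ≠ 0 := by exact_mod_cast (show e2 ≠ 0 by omega)
    push_cast
    field_simp
  refine Finset.sum_bij_ne_zero (fun x _ _ => (x.2*x.1.1, x.2*x.1.2)) ?_ ?_ ?_ ?_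
  · rintro ⟨⟨e1, e2⟩, d⟩ hx _
    simp only [mem_sigma, mem_EE, mem_DD, mem_product] at hx ⊢
    obtain ⟨⟨⟨⟨⟨a1, a2⟩, a3⟩, ⟨⟨b1, b2⟩, b3⟩⟩, hc⟩, ⟨c1, c2⟩, c3⟩ := hx
    have hm : 0 < max e1 e2 := lt_of_lt_of_le a1 (le_max_left _ _)
    rw [Nat.le_div_iff_mul_le hm] at c2
    have cq : Nat.Coprime d q := c3.coprime_dvd_right ((Dvd.intro _ rfl : q ∣ q*e1).mul_right e2)
    refine ⟨⟨⟨Nat.mul_pos c1 a1, ?_⟩, Nat.Coprime.mul_left cq a3⟩, ⟨Nat.mul_pos c1 b1, ?_⟩, Nat.Coprime.mul_left cq b3⟩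
    · exact (Nat.mul_le_mul_left _ (le_max_left _ _)).trans c2
    · exact (Nat.mul_le_mul_left _ (le_max_right _ _)).trans c2
  · rintro ⟨⟨e1, e2⟩, d⟩ hx _ ⟨⟨e1', e2'⟩, d'⟩ hx' _ h
    simp only [mem_sigma, mem_EE, mem_DD] at hx hx'
    simp only [Prod.mk.injEq] at h
    have g1 : Nat.gcd (d*e1) (d*e2) = d := by rw [Nat.gcd_mul_left, hx.1.2, mul_one]
    have g2 : Nat.gcd (d'*e1') (d'*e2') = d' := by rw [Nat.gcd_mul_left, hx'.1.2, mul_one]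
    have hd : d = d' := by rw [← g1, ← g2, h.1, h.2]
    subst hd
    have h1 := Nat.eq_of_mul_eq_mul_left hx.2.1.1 h.1
    have h2 := Nat.eq_of_mul_eq_mul_left hx.2.1.1 h.2
    subst h1 h2; rfl
  · rintro ⟨d1, d2⟩ hx hne
    simp only [mem_product, mem_DD] at hx
    have m1 : μ d1 ≠ 0 := by
      intro h; apply hne; simp [h]
    have m2 : μ d2 ≠ 0 := by
      intro h; apply hne; simp [h]
    have s1 := ArithmeticFunction.moebius_ne_zero_iff_squarefree.1 m1
    have s2 := ArithmeticFunction.moebius_ne_zero_iff_squarefree.1 m2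
    obtain ⟨⟨⟨a1, a2⟩, a3⟩, ⟨⟨b1, b2⟩, b3⟩⟩ := hx
    obtain ⟨g, e1, e2, hg, hc, rfl, rfl⟩ := Nat.exists_coprime' (m := d1) (n := d2) (Nat.gcd_pos_of_pos_left _ a1)
    have t1 := Nat.squarefree_mul_iff.1 s1
    have t2 := Nat.squarefree_mul_iff.1 s2
    have he1 : 0 < e1 := Nat.pos_of_mul_pos_right a1
    have he2 : 0 < e2 := Nat.pos_of_mul_pos_right b1
    have ca : Nat.Coprime e1 q := a3.coprime_dvd_left (Dvd.intro _ rfl)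
    have cb : Nat.Coprime e2 q := b3.coprime_dvd_left (Dvd.intro _ rfl)
    have cg : Nat.Coprime g q := a3.coprime_dvd_left (Dvd.intro_left _ rfl)
    have hmem : (⟨(e1, e2), g⟩ : (_ : ℕ × ℕ) × ℕ) ∈ (EE q D).sigma (fun e => DD (q*e.1*e.2) (D / max e.1 e.2)) := by
      simp only [mem_sigma, mem_EE, mem_DD]
      refine ⟨⟨⟨⟨⟨he1, ?_⟩, ca⟩, ⟨he2, ?_⟩, cb⟩, hc⟩, ⟨hg, ?_⟩, ?_⟩
      · exact (Nat.le_mul_of_pos_right _ hg).trans a2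
      · exact (Nat.le_mul_of_pos_right _ hg).trans b2
      · rw [Nat.le_div_iff_mul_le (lt_of_lt_of_le he1 (le_max_left _ _))]
        rcases max_cases e1 e2 with h | h
        · rw [h.1, mul_comm]; exact a2
        · rw [h.1, mul_comm]; exact b2
      · exact Nat.Coprime.mul_right (Nat.Coprime.mul_right cg t1.1.symm) t2.1.symm
    refine ⟨⟨(e1, e2), g⟩, hmem, ?_, ?_⟩
    · intro h0; apply hne
      rw [hval _ hmem] at h0
      simpa only [mul_comm] using h0
    · simp only [mul_comm]
  · intro x hx _
    exact hval x hx

end SqV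

namespace SqV
open Finset

local notation "μ" => ArithmeticFunction.moebius

noncomputable def PQ (h : ℕ → ℝ) (q : ℕ) : ℝ := PPr h * ∏ p ∈ q.primeFactors, (1 - h p)⁻¹

lemma PQ_mul (h : ℕ → ℝ) (q e : ℕ) (hc : Nat.Coprime q e) :
    PQ h (q*e) = PQ h q * ∏ p ∈ e.primeFactors, (1 - h p)⁻¹ := by
  unfold PQ
  rw [hc.primeFactors_mul, prod_union hc.disjoint_primeFactors, mul_assoc]

lemma PQ_tail (h : ℕ → ℝ) (hh : HB h) (q D : ℕ) (hq : q ≠ 0) (hD : 0 < D) :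
    |∑ e ∈ DD q D, (μ e : ℝ) * ∏ p ∈ e.primeFactors, h p - PQ h q| ≤ 1 / (D:ℝ) := by
  rw [← ff_sum_DD]; exact ff_tail h hh q D hq hD

lemma PQ_abs (h : ℕ → ℝ) (hh : HB h) (q : ℕ) (hq : q ≠ 0) : |PQ h q| ≤ 2 := by
  have h1 := PQ_tail h hh q 1 hq one_pos
  have : DD q 1 = {1} := by
    ext d; rw [mem_DD, mem_singleton]
    constructor
    · intro h; omega
    · rintro rfl; simp
  rw [this] at h1
  simp at h1
  rw [abs_le] at h1 ⊢
  constructor <;> linarith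

lemma tot_prod (e : ℕ) (he : 0 < e) : (e.totient:ℝ)/e = ∏ p ∈ e.primeFactors, (1 - (p:ℝ)⁻¹) := by
  have h := Nat.totient_eq_mul_prod_factors e
  have h2 : (e.totient:ℝ) = e * ∏ p ∈ e.primeFactors, (1 - (p:ℝ)⁻¹) := by
    have h5 := congrArg (Rat.cast : ℚ → ℝ) h
    push_cast at h5
    exact h5
  rw [h2]; field_simp

lemma tot_mul (q e : ℕ) (he : 0 < e) (hc : Nat.Coprime q e) :
    ((q*e).totient:ℝ)/((q*e:ℕ):ℝ) = (q.totient:ℝ)/q * ∏ p ∈ e.primeFactors, (1 - (p:ℝ)⁻¹) := by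
  rw [← tot_prod e he, Nat.totient_mul hc]; push_cast; rw [mul_div_mul_comm]

noncomputable def h2 (p : ℕ) : ℝ := 1/((p:ℝ)*(p+1))
noncomputable def h3 (p : ℕ) : ℝ := 1/((p:ℝ)^2+p-1)

lemma HB_h2 : HB h2 := fun p hp => by
  have : (2:ℝ) ≤ p := by exact_mod_cast hp.two_le
  unfold h2
  exact ⟨by positivity, by apply one_div_le_one_div_of_le (by positivity); nlinarith⟩
lemma HB_h3 : HB h3 := fun p hp => by
  have : (2:ℝ) ≤ p := by exact_mod_cast hp.two_le
  unfold h3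
  exact ⟨one_div_nonneg.2 (by nlinarith), by apply one_div_le_one_div_of_le (by positivity); nlinarith⟩

lemma prod_h2 (e : ℕ) : (μ e : ℝ) / (e:ℝ)^2 * ((∏ p ∈ e.primeFactors, (1 - (p:ℝ)⁻¹)) * ∏ p ∈ e.primeFactors, (1 - h1 p)⁻¹)
    = (μ e : ℝ) * ∏ p ∈ e.primeFactors, h2 p := by
  by_cases hs : Squarefree e
  · have he : (e:ℝ) = ∏ p ∈ e.primeFactors, (p:ℝ) := by
      have := Nat.prod_primeFactors_of_squarefree hs
      rw [← Nat.cast_prod, this]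
    rw [div_mul_eq_mul_div, mul_div_assoc]
    congr 1
    rw [he]
    rw [← prod_pow, ← prod_mul_distrib, ← prod_div_distrib]
    refine prod_congr rfl (fun p hp => ?_)
    have hp := Nat.prime_of_mem_primeFactors hp
    have : (2:ℝ) ≤ p := by exact_mod_cast hp.two_le
    unfold h1 h2
    have h3 : (p:ℝ)^2 - 1 = (p-1)*(p+1) := by ring
    have h4 : (p:ℝ) - 1 ≠ 0 := by intro h; linarith
    have h6 : (p:ℝ) + 1 ≠ 0 := by intro h; linarith
    have h7 : (p:ℝ) ≠ 0 := by intro h; linarith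
    have h5 : 1 - 1/(p:ℝ)^2 = (p-1)*(p+1)/(p:ℝ)^2 := by field_simp; ring
    rw [h5]
    field_simp
  · have : μ e = 0 := ArithmeticFunction.moebius_eq_zero_of_not_squarefree hs
    simp [this]

lemma prod_h3 (e : ℕ) : (∏ p ∈ e.primeFactors, h2 p) * ∏ p ∈ e.primeFactors, (1 - h2 p)⁻¹ = ∏ p ∈ e.primeFactors, h3 p := by
  rw [← prod_mul_distrib]
  refine prod_congr rfl (fun p hp => ?_)
  have hp := Nat.prime_of_mem_primeFactors hp
  have : (2:ℝ) ≤ p := by exact_mod_cast hp.two_le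
  unfold h2 h3
  have h7 : (p:ℝ) ≠ 0 := by intro h; linarith
  have h6 : (p:ℝ) + 1 ≠ 0 := by intro h; linarith
  have h8 : (p:ℝ)^2+p-1 ≠ 0 := by intro h; nlinarith
  have h5 : 1 - 1/((p:ℝ)*(p+1)) = ((p:ℝ)^2+p-1)/(p*(p+1)) := by field_simp
  rw [h5]; field_simp

lemma inv_sq_sum (q D : ℕ) : ∑ e ∈ DD q D, 1/(e:ℝ)^2 ≤ 2 := by
  calc ∑ e ∈ DD q D, 1/(e:ℝ)^2 ≤ ∑ e ∈ Icc 1 D, 1/(e:ℝ)^2 :=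
        sum_le_sum_of_subset_of_nonneg (by unfold DD; exact filter_subset _ _) (fun _ _ _ => by positivity)
    _ ≤ ∑ e ∈ insert 1 (Ioc 1 D), 1/(e:ℝ)^2 := by
        refine sum_le_sum_of_subset_of_nonneg ?_ (fun _ _ _ => by positivity)
        intro e he; rw [mem_Icc] at he; rw [mem_insert, mem_Ioc]; omega
    _ ≤ 2 := by
        rw [sum_insert (by simp)]
        have := inv_sq_tail 1 D one_pos
        norm_num at this ⊢; linarith

lemma mu_prod_abs (h : ℕ → ℝ) (hh : HB h) (e : ℕ) : |(μ e:ℝ) * ∏ p ∈ e.primeFactors, h p| ≤ 1/(e:ℝ)^2 := by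
  have := ff_abs_le h hh 1 e
  unfold ff at this
  rwa [if_pos (Nat.coprime_one_right e)] at this

lemma const_sum (q D : ℕ) (hq : 0 < q) (hD : 0 < D) :
    |∑ e ∈ EE q D, ((μ e.1 : ℝ) * ∏ p ∈ e.1.primeFactors, h2 p) * ((μ e.2 : ℝ) * ∏ p ∈ e.2.primeFactors, h2 p)
      - PQ h2 q * PQ h3 q| ≤ 4/(D:ℝ) := by
  set w : ℕ → ℝ := fun e => (μ e : ℝ) * ∏ p ∈ e.primeFactors, h2 p with hw
  have e1 : ∑ e ∈ EE q D, w e.1 * w e.2 = ∑ a ∈ DD q D, w a * ∑ b ∈ DD (q*a) D, w b := by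
    unfold EE
    rw [sum_filter, sum_product]
    refine sum_congr rfl (fun a _ => ?_)
    rw [mul_sum, ← sum_filter]
    refine sum_congr ?_ (fun _ _ => rfl)
    ext b
    simp only [mem_filter, mem_DD]
    rw [Nat.coprime_mul_iff_right, Nat.coprime_comm (m := a)]
    tauto
  have e2 : ∑ a ∈ DD q D, w a * PQ h2 (q*a) = PQ h2 q * ∑ a ∈ DD q D, (μ a:ℝ) * ∏ p ∈ a.primeFactors, h3 p := by
    rw [mul_sum]
    refine sum_congr rfl (fun a ha => ?_)
    rw [mem_DD] at ha
    rw [PQ_mul h2 q a ha.2.symm, ← prod_h3, hw]; ring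
  have p1 : |∑ e ∈ EE q D, w e.1 * w e.2 - ∑ a ∈ DD q D, w a * PQ h2 (q*a)| ≤ 2*(1/D) := by
    rw [e1, ← sum_sub_distrib]
    refine (abs_sum_le_sum_abs _ _).trans ?_
    calc _ ≤ ∑ a ∈ DD q D, 1/(a:ℝ)^2 * (1/D) := by
          refine sum_le_sum (fun a ha => ?_)
          rw [mem_DD] at ha
          rw [← mul_sub, abs_mul]
          exact mul_le_mul (mu_prod_abs h2 HB_h2 a) (PQ_tail h2 HB_h2 (q*a) D (Nat.mul_pos hq ha.1.1).ne' hD) (abs_nonneg _) (by positivity)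
      _ ≤ _ := by rw [← sum_mul]; exact mul_le_mul_of_nonneg_right (inv_sq_sum q D) (by positivity)
  have p2 : |∑ a ∈ DD q D, w a * PQ h2 (q*a) - PQ h2 q * PQ h3 q| ≤ 2*(1/D) := by
    rw [e2, ← mul_sub, abs_mul]
    exact mul_le_mul (PQ_abs h2 HB_h2 q hq.ne') (PQ_tail h3 HB_h3 q D hq.ne' hD) (abs_nonneg _) (by norm_num)
  calc _ ≤ 2*(1/(D:ℝ)) + 2*(1/D) := (abs_sub_le _ _ _).trans (add_le_add p1 p2)
    _ = _ := by ring

lemma tau3 (q D : ℕ) (e : ℕ × ℕ) (he : e ∈ EE q D) :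
    (q*e.1*e.2).divisors.card = q.divisors.card * e.1.divisors.card * e.2.divisors.card := by
  rw [mem_EE, mem_DD, mem_DD] at he
  rw [Nat.Coprime.card_divisors_mul, Nat.Coprime.card_divisors_mul]
  · exact he.1.1.2.symm
  · exact Nat.Coprime.mul_left he.1.2.2.symm he.2

lemma main_term (q D : ℕ) (hq : 0 < q) (e : ℕ × ℕ) (he : e ∈ EE q D) :
    (μ e.1 : ℝ) * (μ e.2 : ℝ) / ((e.1:ℝ)*e.2)^2 * ((((q*e.1*e.2).totient:ℝ)/((q*e.1*e.2:ℕ):ℝ)) * Cq (q*e.1*e.2)) =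
    ((q.totient:ℝ)/q * Cq q) *
      (((μ e.1 : ℝ) * ∏ p ∈ e.1.primeFactors, h2 p) * ((μ e.2 : ℝ) * ∏ p ∈ e.2.primeFactors, h2 p)) := by
  rw [mem_EE, mem_DD, mem_DD] at he
  have c1 : Nat.Coprime q e.1 := he.1.1.2.symm
  have c2 : Nat.Coprime (q*e.1) e.2 := Nat.Coprime.mul_left he.1.2.2.symm he.2
  have hC : ∀ q, Cq q = PQ h1 q := Cq_eq
  rw [tot_mul _ _ he.1.2.1.1 c2, tot_mul _ _ he.1.1.1.1 c1, hC, hC, PQ_mul _ _ _ c2, PQ_mul _ _ _ c1,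
    ← prod_h2, ← prod_h2, mul_pow]
  rw [mul_div_mul_comm]
  ring

end SqV

namespace SqV
open Finset

local notation "μ" => ArithmeticFunction.moebius

set_option maxHeartbeats 2000000 in
lemma TD_eval : ∃ C > 0, ∀ q : ℕ, 0 < q → ∀ T : ℝ, 1 ≤ T → ∀ D : ℕ, 0 < D →
    |TD (T^2) q D - II*T*((q.totient:ℝ)/q*Cq q*(PQ h2 q * PQ h3 q))| ≤
      C * (q.divisors.card:ℝ) * (T^(3/4:ℝ) + T^2/√D) := by
  obtain ⟨C, hC, hS⟩ := S_lemma
  obtain ⟨Ct, hCt, hτ⟩ := divisor_bound (1/4) (by norm_num)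
  have hsum : Summable (fun n : ℕ => 1/(n:ℝ)^(5/4:ℝ)) := Real.summable_one_div_nat_rpow.2 (by norm_num)
  set W := ∑' n : ℕ, 1/(n:ℝ)^(5/4:ℝ) with hW
  have hW0 : 0 ≤ W := tsum_nonneg (fun n => by positivity)
  have hII := II_pos
  refine ⟨C*Ct^2*W^2 + 8*II, by positivity, fun q hq T hT D hD => ?_⟩
  have hT0 : 0 < T := by linarith
  have hD0 : (0:ℝ) < D := by exact_mod_cast hD
  have hD1 : (1:ℝ) ≤ D := by exact_mod_cast hD
  have hsD : 0 < √(D:ℝ) := Real.sqrt_pos.2 hD0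
  set A := T^(3/4:ℝ) + T^2/√D with hA
  have hA0 : 0 ≤ A := by positivity
  have hτ1 : (1:ℝ) ≤ (q.divisors.card:ℝ) := by
    exact_mod_cast Finset.card_pos.2 ⟨1, Nat.one_mem_divisors.2 hq.ne'⟩
  have hφ : (q.totient:ℝ)/q ≤ 1 := by
    rw [div_le_one (by exact_mod_cast hq)]; exact_mod_cast Nat.totient_le q
  have hφ0 : 0 ≤ (q.totient:ℝ)/q := by positivity
  set wS := ∑ e ∈ EE q D, ((μ e.1 : ℝ) * ∏ p ∈ e.1.primeFactors, h2 p) * ((μ e.2 : ℝ) * ∏ p ∈ e.2.primeFactors, h2 p) with hwS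
  have part1 : |TD (T^2) q D - II*T*((q.totient:ℝ)/q*Cq q*wS)| ≤ C*Ct^2*(q.divisors.card:ℝ)*A*W^2 := by
    have e0 : II*T*((q.totient:ℝ)/q*Cq q*wS) = ∑ e ∈ EE q D, (μ e.1 : ℝ) * (μ e.2 : ℝ) / ((e.1:ℝ)*e.2)^2 *
        (II*T*(((q*e.1*e.2).totient:ℝ)/((q*e.1*e.2:ℕ):ℝ)) * Cq (q*e.1*e.2)) := by
      rw [hwS, mul_sum, mul_sum]
      refine sum_congr rfl (fun e he => ?_)
      rw [← main_term q D hq e he]; ring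
    rw [e0, TD_eq, ← sum_sub_distrib]
    refine (abs_sum_le_sum_abs _ _).trans ?_
    have : ∀ e ∈ EE q D, |(μ e.1 : ℝ) * (μ e.2 : ℝ) / ((e.1:ℝ)*e.2)^2 * SSm (T^2) (q*e.1*e.2) (D / max e.1 e.2) -
        (μ e.1 : ℝ) * (μ e.2 : ℝ) / ((e.1:ℝ)*e.2)^2 *
        (II*T*(((q*e.1*e.2).totient:ℝ)/((q*e.1*e.2:ℕ):ℝ)) * Cq (q*e.1*e.2))| ≤
        C*Ct^2*(q.divisors.card:ℝ)*A*((1/(e.1:ℝ)^(5/4:ℝ))*(1/(e.2:ℝ)^(5/4:ℝ))) := by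
      intro e he
      have ht := tau3 q D e he
      rw [mem_EE, mem_DD, mem_DD] at he
      obtain ⟨⟨⟨⟨a1, a2⟩, a3⟩, ⟨⟨b1, b2⟩, b3⟩⟩, hc⟩ := he
      generalize e.1 = a at *
      generalize e.2 = b at *
      have ha : (1:ℝ) ≤ a := by exact_mod_cast a1
      have hb : (1:ℝ) ≤ b := by exact_mod_cast b1
      have ha0 : (0:ℝ) < a := by linarith
      have hb0 : (0:ℝ) < b := by linarith
      have hm : 0 < max a b := lt_of_lt_of_le a1 (le_max_left _ _)
      have hmD : max a b ≤ D := max_le a2 b2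
      have hmab : max a b ≤ a*b := max_le (Nat.le_mul_of_pos_right _ b1) (Nat.le_mul_of_pos_left _ a1)
      have hZ : 1 ≤ D / max a b := (Nat.one_le_div_iff hm).2 hmD
      have h := hS (q*a*b) (by positivity) T hT (D / max a b) hZ
      rw [← mul_sub, abs_mul]
      have m1 : |(μ a:ℝ)*(μ b:ℝ)/((a:ℝ)*b)^2| ≤ 1/((a:ℝ)*b)^2 := by
        rw [abs_div, abs_of_pos (by positivity : 0 < ((a:ℝ)*b)^2), abs_mul]
        gcongr
        exact mul_le_one₀ (moebius_abs_le a) (abs_nonneg _) (moebius_abs_le b)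
      have m2 : T^(3/4:ℝ) + T^2/(((D / max a b : ℕ):ℝ)+1) ≤ √((a:ℝ)*b) * A := by
        have hab1 : 1 ≤ √((a:ℝ)*b) := Real.one_le_sqrt.2 (by nlinarith)
        rw [hA, mul_add]
        refine add_le_add (le_mul_of_one_le_left (by positivity) hab1) ?_
        have h1 := div_succ_ge D (max a b) hm
        have hm0 : (0:ℝ) < ((max a b : ℕ):ℝ) := by exact_mod_cast hm
        have hmD' : ((max a b : ℕ):ℝ) ≤ D := by exact_mod_cast hmD
        have hmab' : ((max a b : ℕ):ℝ) ≤ (a:ℝ)*b := by exact_mod_cast hmab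
        set M := ((max a b : ℕ):ℝ) with hM
        have hsM : 0 < √M := Real.sqrt_pos.2 hm0
        have h2 : √(D:ℝ)/√((a:ℝ)*b) ≤ ((D / max a b : ℕ):ℝ)+1 := by
          refine le_trans ?_ h1
          calc √(D:ℝ)/√((a:ℝ)*b) ≤ √(D:ℝ)/√M := by gcongr
            _ = √(D/M) := (Real.sqrt_div hD0.le _).symm
            _ ≤ D/M := by
              rw [Real.sqrt_le_left (by positivity)]
              have : 1 ≤ D/M := (one_le_div hm0).2 hmD'
              nlinarith
            _ ≤ _ := by gcongr; linarith
        calc T^2/(((D / max a b : ℕ):ℝ)+1) ≤ T^2/(√(D:ℝ)/√((a:ℝ)*b)) := by gcongr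
          _ = _ := by field_simp
      rw [ht] at h
      push_cast at h
      have t1 := hτ a a1
      have t2 := hτ b b1
      have hpow : ∀ x : ℝ, 0 < x → 1/x^2 * x^(1/4:ℝ) * √x = 1/x^(5/4:ℝ) := by
        intro x hx
        rw [Real.sqrt_eq_rpow, ← Real.rpow_natCast, one_div (x^((2:ℕ):ℝ)), one_div (x^(5/4:ℝ)), ← Real.rpow_neg hx.le, ← Real.rpow_neg hx.le,
          ← Real.rpow_add hx, ← Real.rpow_add hx]; norm_num
      have hpa := hpow a ha0
      have hpb := hpow b hb0
      have hsq : √((a:ℝ)*b) = √(a:ℝ)*√(b:ℝ) := Real.sqrt_mul ha0.le _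
      push_cast
      calc _ ≤ 1/((a:ℝ)*b)^2 * (C*((q.divisors.card:ℝ)*(a.divisors.card:ℝ)*(b.divisors.card:ℝ))*
              (T^(3/4:ℝ) + T^2/(((D / max a b : ℕ):ℝ)+1))) :=
            mul_le_mul m1 h (abs_nonneg _) (by positivity)
        _ ≤ 1/((a:ℝ)*b)^2 * (C*((q.divisors.card:ℝ)*(Ct*(a:ℝ)^(1/4:ℝ))*(Ct*(b:ℝ)^(1/4:ℝ)))*
              (√((a:ℝ)*b) * A)) := by gcongr
        _ = C*Ct^2*(q.divisors.card:ℝ)*A*((1/(a:ℝ)^2 * (a:ℝ)^(1/4:ℝ) * √(a:ℝ))*(1/(b:ℝ)^2 * (b:ℝ)^(1/4:ℝ) * √(b:ℝ))) := by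
            rw [hsq]; ring
        _ = _ := by rw [hpa, hpb]
    refine (sum_le_sum this).trans ?_
    rw [← mul_sum]
    refine mul_le_mul_of_nonneg_left ?_ (by positivity)
    calc ∑ e ∈ EE q D, (1/(e.1:ℝ)^(5/4:ℝ))*(1/(e.2:ℝ)^(5/4:ℝ)) ≤
          ∑ e ∈ (DD q D) ×ˢ (DD q D), (1/(e.1:ℝ)^(5/4:ℝ))*(1/(e.2:ℝ)^(5/4:ℝ)) :=
          sum_le_sum_of_subset_of_nonneg (by unfold EE; exact filter_subset _ _) (fun _ _ _ => by positivity)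
      _ = (∑ a ∈ DD q D, 1/(a:ℝ)^(5/4:ℝ)) * ∑ b ∈ DD q D, 1/(b:ℝ)^(5/4:ℝ) := by
          rw [sum_product, sum_mul_sum]
      _ ≤ W * W := by
          have := hsum.sum_le_tsum (DD q D) (fun n _ => by positivity)
          exact mul_le_mul this this (sum_nonneg (fun _ _ => by positivity)) hW0
      _ = W^2 := by ring
  have part2 : |II*T*((q.totient:ℝ)/q*Cq q*wS) - II*T*((q.totient:ℝ)/q*Cq q*(PQ h2 q * PQ h3 q))| ≤ 8*II*A := by
    have hc := const_sum q D hq hD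
    rw [← hwS] at hc
    have hCq : |Cq q| ≤ 2 := by
      have := PQ_abs h1 HB_h1 q hq.ne'
      unfold PQ at this; rwa [← Cq_eq] at this
    rw [← mul_sub, ← mul_sub, abs_mul, abs_of_pos (by positivity : 0 < II*T), abs_mul, abs_mul, abs_of_nonneg hφ0]
    calc _ ≤ II*T*(1*2*(4/D)) := by gcongr
      _ = 8*II*(T/D) := by ring
      _ ≤ 8*II*(T^2/√D) := by
          have : √(D:ℝ) ≤ D := by
            rw [Real.sqrt_le_left hD0.le]; nlinarith
          gcongr
          nlinarith
      _ ≤ 8*II*A := by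
          have : 0 ≤ T^(3/4:ℝ) := by positivity
          rw [hA]; gcongr; linarith
  have p4 : 8*II*A ≤ 8*II*A*(q.divisors.card:ℝ) := le_mul_of_one_le_right (by positivity) hτ1
  calc _ ≤ C*Ct^2*(q.divisors.card:ℝ)*A*W^2 + 8*II*A*(q.divisors.card:ℝ) :=
        (abs_sub_le _ _ _).trans (add_le_add part1 (part2.trans p4))
    _ = _ := by ring

end SqV

namespace SqV
open Finset

lemma PPr_pos (h : ℕ → ℝ) (hh : HB h) : 0 < PPr h := by
  have h6 : PPr h1 ≤ PPr h := by
    refine le_of_tendsto_of_tendsto' (PPr_hasProd h1 HB_h1) (PPr_hasProd h hh) (fun s => ?_)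
    refine prod_le_prod (fun p _ => ?_) (fun p _ => ?_)
    · have := HB_lt h1 HB_h1 p p.2; linarith
    · have := (hh p p.2).2
      unfold h1; linarith
  refine lt_of_lt_of_le ?_ h6
  rw [PPr_h1]; positivity

lemma fac_eq (p : ℕ) (hp : p.Prime) :
    (1 - h1 p)*(1 - h2 p)*(1 - h3 p) = ((p:ℝ)^3 - 3*p + 2)/(p:ℝ)^3 := by
  have h2' : (2:ℝ) ≤ p := by exact_mod_cast hp.two_le
  have : (p:ℝ)^2 + p - 1 ≠ 0 := by nlinarith
  have : (p:ℝ) + 1 ≠ 0 := by linarith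
  have : (p:ℝ) ≠ 0 := by linarith
  unfold h1 h2 h3
  have e2 : 1 - 1/((p:ℝ)*(p+1)) = ((p:ℝ)^2 + p - 1)/(p*(p+1)) := by
    field_simp
  have e3 : 1 - 1/((p:ℝ)^2+p-1) = ((p:ℝ)^2 + p - 2)/((p:ℝ)^2 + p - 1) := by
    rw [eq_div_iff (by assumption), sub_mul, div_mul_cancel₀ _ (by assumption)]; ring
  rw [e2, e3]
  generalize (p:ℝ)^2 + p - 1 = w at *
  field_simp
  ring

lemma fac_eq2 (p : ℕ) (hp : p.Prime) :
    (1-(p:ℝ)⁻¹)^2 * ((1 - h1 p)⁻¹*(1 - h2 p)⁻¹*(1 - h3 p)⁻¹) = (1 + 2*(p:ℝ)⁻¹)⁻¹ := by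
  have h2' : (2:ℝ) ≤ p := by exact_mod_cast hp.two_le
  have : (p:ℝ) ≠ 0 := by linarith
  have : (p:ℝ) - 1 ≠ 0 := by linarith
  have : (p:ℝ) + 2 ≠ 0 := by linarith
  rw [← mul_inv, ← mul_inv, fac_eq p hp,
    show (p:ℝ)^3 - 3*p + 2 = (p-1)^2*(p+2) by ring]
  field_simp

lemma Cmain_eq : Cmain = II * (PPr h1 * PPr h2 * PPr h3) := by
  have h := ((PPr_hasProd h1 HB_h1).mul (PPr_hasProd h2 HB_h2)).mul (PPr_hasProd h3 HB_h3)
  unfold Cmain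
  rw [II_eq, ← h.tprod_eq]
  congr 1
  exact tprod_congr (fun p => (fac_eq p p.2).symm)

lemma Cmain_pos : 0 < Cmain := by
  rw [Cmain_eq]
  have := PPr_pos h1 HB_h1
  have := PPr_pos h2 HB_h2
  have := PPr_pos h3 HB_h3
  have := II_pos
  positivity

lemma const_eq (q : ℕ) (hq : 0 < q) (T : ℝ) :
    (q.totient:ℝ)*(II*T*((q.totient:ℝ)/q*Cq q*(PQ h2 q * PQ h3 q))) =
      Cmain * (∏ p ∈ q.primeFactors, (1 + 2 * ((p : ℝ))⁻¹)⁻¹) * (q*T) := by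
  have hq0 : (q:ℝ) ≠ 0 := by positivity
  have e1 : (q.totient:ℝ) = q * ∏ p∈q.primeFactors,(1-(p:ℝ)⁻¹) := by
    rw [← tot_prod q hq]; field_simp
  have e2 : ∏ p ∈ q.primeFactors, (1 + 2 * ((p : ℝ))⁻¹)⁻¹ =
      (∏ p∈q.primeFactors,(1-(p:ℝ)⁻¹))^2 * ((∏ p ∈ q.primeFactors, (1 - h1 p)⁻¹) *
       (∏ p ∈ q.primeFactors, (1 - h2 p)⁻¹) * (∏ p ∈ q.primeFactors, (1 - h3 p)⁻¹)) := by
    rw [← prod_pow, ← prod_mul_distrib, ← prod_mul_distrib, ← prod_mul_distrib]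
    exact prod_congr rfl (fun p hp => (fac_eq2 p (Nat.prime_of_mem_primeFactors hp)).symm)
  rw [e2, Cmain_eq, Cq_eq, e1]
  unfold PQ
  field_simp

lemma prod_lower (q : ℕ) (hq : 0 < q) :
    1/(q.divisors.card:ℝ) ≤ ∏ p ∈ q.primeFactors, (1 + 2 * ((p : ℝ))⁻¹)⁻¹ := by
  have h1 : (2:ℝ)^(q.primeFactors.card) ≤ q.divisors.card := by
    have : 2^(q.primeFactors.card) ≤ q.divisors.card := by
      rw [Nat.card_divisors hq.ne', ← prod_const]
      refine prod_le_prod (fun _ _ => by norm_num) (fun p hp => ?_)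
      have := (Nat.mem_primeFactors.1 hp)
      have := this.1.factorization_pos_of_dvd this.2.2 this.2.1
      omega
    exact_mod_cast this
  calc 1/(q.divisors.card:ℝ) ≤ 1/(2:ℝ)^(q.primeFactors.card) := by gcongr
    _ = ∏ p ∈ q.primeFactors, (2:ℝ)⁻¹ := by rw [prod_const]; simp
    _ ≤ _ := by
      refine prod_le_prod (fun _ _ => by norm_num) (fun p hp => ?_)
      have h2 : (2:ℝ) ≤ p := by exact_mod_cast (Nat.prime_of_mem_primeFactors hp).two_le
      have : (p:ℝ)⁻¹ ≤ 2⁻¹ := inv_anti₀ (by norm_num) h2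
      refine inv_anti₀ (by positivity) ?_
      linarith

end SqV

namespace SqV
open Finset

lemma split_bound (s : Finset ℕ) (E F : ℕ → ℝ) (y : ℝ) (hy : 0 < y) :
    |∑ a ∈ s, (E a)^2 - ∑ a ∈ s, (F a)^2| ≤
      (∑ a ∈ s, (F a)^2)/y^3 + (y^3+1) * ∑ a ∈ s, (E a - F a)^2 := by
  rw [← sum_sub_distrib, mul_sum, sum_div, ← sum_add_distrib]
  refine (abs_sum_le_sum_abs _ _).trans (sum_le_sum (fun a _ => ?_))
  have h3 : 0 < y^3 := by positivity
  generalize y^3 = w at *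
  have e : (E a)^2 - (F a)^2 = 2*F a*(E a - F a) + (E a - F a)^2 := by ring
  rw [e]
  generalize E a - F a = g
  generalize F a = f
  have k1 : f^2/w + w*g^2 - 2*f*g = (f - w*g)^2/w := by field_simp; ring
  have k2 : f^2/w + w*g^2 + 2*f*g = (f + w*g)^2/w := by field_simp; ring
  have k3 : 0 ≤ (f - w*g)^2/w := by positivity
  have k4 : 0 ≤ (f + w*g)^2/w := by positivity
  rw [abs_le]; constructor <;> nlinarith [sq_nonneg g]

lemma G_size (y j r d s t : ℝ) (hy : 2 ≤ y) (hj : y^5 ≤ j) (hr : j^12*y^20 ≤ r)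
    (hd : r/(2*(j^2*y^2)) ≤ d) (hs : r/2 ≤ s) (ht : t ≤ y) (ht0 : 0 ≤ t) :
    3*(r^2*(j^8/d)^2 + (y*(r^2*j^8/d) + 2*j^4*(r^2*j^8/d^2)^2*t) + (j^8+1)*y*(r^2*j^8/s)) ≤
      126*(r^2*j^4)/y^6 := by
  have hy0 : 0 < y := by linarith
  have hy1 : 1 ≤ y := by linarith
  have hj1 : 1 ≤ j := (one_le_pow₀ hy1).trans hj
  have hj0 : 0 < j := by linarith
  have hr0 : 0 < r := lt_of_lt_of_le (by positivity) hr
  have hd0 : 0 < d := lt_of_lt_of_le (by positivity) hd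
  have hs0 : 0 < s := lt_of_lt_of_le (by positivity) hs
  have id : 1/d ≤ 2*(j^2*y^2)/r := by
    rw [div_le_div_iff₀ hd0 hr0, one_mul]
    rw [div_le_iff₀ (by positivity)] at hd; linarith
  have is : 1/s ≤ 2/r := by
    rw [div_le_div_iff₀ hs0 hr0]; linarith
  have yp : ∀ {a b : ℕ}, a ≤ b → y^a ≤ y^b := fun h => pow_le_pow_right₀ hy1 h
  have jp : ∀ {a b : ℕ}, a ≤ b → j^a ≤ j^b := fun h => pow_le_pow_right₀ hj1 h
  have hr2 : j^24*y^40 ≤ r^2 := by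
    calc j^24*y^40 = (j^12*y^20)^2 := by ring
      _ ≤ r^2 := by gcongr
  have b1 : r^2*(j^8/d)^2 ≤ 4*(r^2*j^4)/y^6 := by
    calc r^2*(j^8/d)^2 = r^2*(j^8*(1/d))^2 := by ring
      _ ≤ r^2*(j^8*(2*(j^2*y^2)/r))^2 := by gcongr
      _ = 4*(j^16*y^10*j^4)/y^6 := by field_simp; norm_num
      _ ≤ 4*(j^24*y^40*j^4)/y^6 := by gcongr <;> first | exact hj1 | exact hy1 | norm_num
      _ ≤ _ := by gcongr
  have b2 : y*(r^2*j^8/d) ≤ 2*(r^2*j^4)/y^6 := by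
    calc y*(r^2*j^8/d) = y*(r^2*j^8*(1/d)) := by ring
      _ ≤ y*(r^2*j^8*(2*(j^2*y^2)/r)) := by gcongr
      _ = 2*(r*(j^6*y^9)*j^4)/y^6 := by field_simp
      _ ≤ 2*(r*(j^12*y^20)*j^4)/y^6 := by gcongr <;> first | exact hj1 | exact hy1 | norm_num
      _ ≤ 2*(r*r*j^4)/y^6 := by gcongr
      _ = _ := by ring
  have b3 : 2*j^4*(r^2*j^8/d^2)^2*t ≤ 32*(r^2*j^4)/y^6 := by
    calc 2*j^4*(r^2*j^8/d^2)^2*t = 2*j^4*(r^2*j^8*(1/d)^2)^2*t := by ring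
      _ ≤ 2*j^4*(r^2*j^8*(2*(j^2*y^2)/r)^2)^2*y := by gcongr
      _ = 32*(j^24*y^15*j^4)/y^6 := by field_simp; norm_num
      _ ≤ 32*(j^24*y^40*j^4)/y^6 := by gcongr <;> first | exact hj1 | exact hy1 | norm_num
      _ ≤ _ := by gcongr
  have b4 : (j^8+1)*y*(r^2*j^8/s) ≤ 4*(r^2*j^4)/y^6 := by
    have : 1 ≤ j^8 := one_le_pow₀ hj1
    calc (j^8+1)*y*(r^2*j^8/s) = (j^8+1)*y*(r^2*j^8*(1/s)) := by ring
      _ ≤ (j^8+j^8)*y*(r^2*j^8*(2/r)) := by gcongr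
      _ = 4*(r*(j^12*y^7)*j^4)/y^6 := by field_simp; norm_num
      _ ≤ 4*(r*(j^12*y^20)*j^4)/y^6 := by gcongr <;> first | exact hj1 | exact hy1 | norm_num
      _ ≤ 4*(r*r*j^4)/y^6 := by gcongr
      _ = _ := by ring
  calc _ ≤ 3*(4*(r^2*j^4)/y^6 + (2*(r^2*j^4)/y^6 + 32*(r^2*j^4)/y^6) + 4*(r^2*j^4)/y^6) := by gcongr
    _ = _ := by ring

lemma TD_size (y j r d : ℝ) (hy : 2 ≤ y) (hj : y^5 ≤ j) (hr : j^12*y^20 ≤ r)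
    (hd : r/(2*(j^2*y^2)) ≤ d) :
    (j^4)^(3/4:ℝ) + (j^4)^2/√d ≤ 2*j^4/y^3 := by
  have hy0 : 0 < y := by linarith
  have hy1 : 1 ≤ y := by linarith
  have hj1 : 1 ≤ j := (one_le_pow₀ hy1).trans hj
  have hj0 : 0 < j := by linarith
  have hr0 : 0 < r := lt_of_lt_of_le (by positivity) hr
  have hd0 : 0 < d := lt_of_lt_of_le (by positivity) hd
  have e : (j^4)^(3/4:ℝ) = j^3 := by
    rw [← Real.rpow_natCast j 4, ← Real.rpow_mul hj0.le, ← Real.rpow_natCast]; norm_num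
  rw [e]
  have a1 : j^3 ≤ j^4/y^3 := by
    rw [le_div_iff₀ (by positivity)]
    calc j^3*y^3 ≤ j^3*y^5 := by gcongr <;> first | exact hy1 | norm_num
      _ ≤ j^3*j := by gcongr
      _ = j^4 := by ring
  have a2 : j^4*y^3 ≤ √d := by
    refine Real.le_sqrt_of_sq_le (le_trans ?_ hd)
    rw [le_div_iff₀ (by positivity)]
    refine le_trans ?_ hr
    calc (j^4*y^3)^2*(2*(j^2*y^2)) = j^10*y^8*2 := by ring
      _ ≤ j^10*y^8*y := by gcongr
      _ = j^10*y^9 := by ring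
      _ ≤ _ := by gcongr <;> first | exact hj1 | exact hy1 | norm_num
  calc _ ≤ j^4/y^3 + (j^4)^2/(j^4*y^3) := by gcongr
    _ = _ := by field_simp; norm_num

lemma core : ∃ C0 > 0, ∀ (X : ℝ) (q : ℕ) (y j : ℝ), 0 < q → 2 ≤ y → y^5 ≤ j → j^12*y^20 ≤ √(q:ℝ) →
    X = q*j^8 → (∀ n : ℕ, 0 < n → n ≤ ⌊X⌋₊ → (n.divisors.card:ℝ) ≤ y) →
    |M2 X q - Cmain * (∏ p ∈ q.primeFactors, (1 + 2 * ((p : ℝ))⁻¹)⁻¹) * (q*j^4)| ≤ C0*(q*j^4)/y^2 := by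
  obtain ⟨C, hC, hTD⟩ := TD_eval
  have hCm := Cmain_pos
  refine ⟨(5+2*C) + (Cmain + (5+2*C)) + 252, by positivity, ?_⟩
  intro X q y j hq hy hj hr hX hτ
  have hq0 : (0:ℝ) < q := by exact_mod_cast hq
  have hy0 : 0 < y := by linarith
  have hy1 : 1 ≤ y := by linarith
  have hj1 : 1 ≤ j := (one_le_pow₀ hy1).trans hj
  have hj0 : 0 < j := by linarith
  have hqr : √(q:ℝ)^2 = (q:ℝ) := Real.sq_sqrt hq0.le
  set r := √(q:ℝ) with hrdef
  have hr0 : 0 < r := lt_of_lt_of_le (by positivity) hr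
  have hj8 : 1 ≤ j^8 := one_le_pow₀ hj1
  have hqX : (q:ℝ) ≤ X := by rw [hX]; exact le_mul_of_one_le_right hq0.le hj8
  have hX0 : 0 ≤ X := hq0.le.trans hqX
  have hK : X/q = j^8 := by rw [hX]; field_simp
  have hqF : q ≤ ⌊X⌋₊ := Nat.le_floor hqX
  have hτq := hτ q hq hqF
  set x := r/(j^2*y^2) with hx
  have hx2 : 2 ≤ x := by
    rw [hx, le_div_iff₀ (by positivity)]
    refine le_trans ?_ hr
    calc 2*(j^2*y^2) ≤ y*(j^2*y^2) := by gcongr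
      _ = j^2*y^3 := by ring
      _ ≤ _ := by gcongr <;> first | exact hj1 | exact hy1 | norm_num
  set D := ⌊x⌋₊ with hD
  have hDx : (D:ℝ) ≤ x := Nat.floor_le (by linarith)
  have hDl : r/(2*(j^2*y^2)) ≤ D := by
    have := Nat.lt_floor_add_one x
    have e : r/(2*(j^2*y^2)) = x/2 := by rw [hx]; field_simp
    rw [e]; linarith
  have hDpos : 0 < D := Nat.floor_pos.2 (by linarith)
  have hxr : x ≤ r := by
    rw [hx]; refine div_le_self hr0.le ?_
    exact one_le_mul_of_one_le_of_one_le (one_le_pow₀ hj1) (one_le_pow₀ hy1)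
  set s := Nat.sqrt q with hs
  have hDs : D ≤ s := by
    rw [hs, Nat.le_sqrt]
    have h : (D:ℝ) ≤ r := hDx.trans hxr
    have : (D:ℝ)*D ≤ q := by rw [← hqr, sq]; gcongr
    exact_mod_cast this
  have hsq : s*s ≤ q := Nat.sqrt_le q
  have hsX : s ≤ ⌊X⌋₊ := (Nat.sqrt_le_self q).trans hqF
  have hsr : r/2 ≤ s := by
    have h1 : q < (s+1)*(s+1) := Nat.lt_succ_sqrt q
    have h2 : (q:ℝ) < ((s:ℝ)+1)*((s:ℝ)+1) := by exact_mod_cast h1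
    have h3 : r ≤ (s:ℝ)+1 := by
      rw [hrdef]; exact Real.sqrt_le_iff.2 ⟨by positivity, by nlinarith⟩
    have h4 : (1:ℝ) ≤ s := by exact_mod_cast lt_of_lt_of_le hDpos hDs
    linarith
  have hsqrtK : √(j^8) = j^4 := by
    rw [show j^8 = (j^4)^2 by ring]; exact Real.sqrt_sq (by positivity)
  have hG := G_norm X y q D s hX0 hy1 hq hDpos hDs hsX hsq hτ
  rw [hK, hsqrtK] at hG
  have hG2 := G_size y j r D s (q.divisors.card:ℝ) hy hj hr hDl hsr hτq (Nat.cast_nonneg _)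
  rw [hqr, ← hX] at hG2
  have hG3 := hG.trans hG2
  clear hG hG2
  have hF := FF_norm X q D hq hqX
  rw [hK] at hF
  have hT := hTD q hq (j^4) (one_le_pow₀ hj1) D hDpos
  have hTs := TD_size y j r D hy hj hr hDl
  rw [show (j^4)^2 = j^8 by ring] at hT hTs
  have hce := const_eq q hq (j^4)
  set Pr := ∏ p ∈ q.primeFactors, (1 + 2 * ((p : ℝ))⁻¹)⁻¹ with hPr
  have hPr1 : Pr ≤ 1 := by
    refine prod_le_one (fun p _ => by positivity) (fun p _ => ?_)
    refine inv_le_one_of_one_le₀ ?_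
    have : 0 ≤ (p:ℝ)⁻¹ := by positivity
    linarith
  have hM : M2 X q = ∑ a ∈ CA q, (Eterm X q a)^2 := rfl
  have hsp := split_bound (CA q) (fun a => Eterm X q a) (fun a => FF X q D a) y hy0
  rw [← hM] at hsp
  set S := ∑ a ∈ CA q, (FF X q D a)^2 with hS
  set G := ∑ a ∈ CA q, (Eterm X q a - FF X q D a)^2 with hGd
  set R := (q:ℝ)*j^4 with hR
  have hR0 : 0 < R := by positivity
  have hφ : (q.totient:ℝ) ≤ q := by exact_mod_cast Nat.totient_le q
  have c1 : |S - (q.totient:ℝ)*TD (j^8) q D| ≤ 5*R/y^2 := by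
    refine hF.trans ?_
    calc (D:ℝ)^2*(5*j^8*(q.divisors.card:ℝ)) ≤ x^2*(5*j^8*y) := by gcongr
      _ = 5*R/y^3 := by rw [hR, hx, ← hqr]; field_simp
      _ ≤ 5*R/y^2 := by gcongr <;> first | exact hy1 | norm_num
  have c2 : |(q.totient:ℝ)*TD (j^8) q D - Cmain*Pr*R| ≤ 2*C*R/y^2 := by
    rw [← hce, ← mul_sub, abs_mul, abs_of_nonneg (Nat.cast_nonneg _)]
    calc _ ≤ (q:ℝ)*(C*(q.divisors.card:ℝ)*(2*j^4/y^3)) := by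
          refine mul_le_mul hφ (hT.trans ?_) (abs_nonneg _) hq0.le
          gcongr
      _ ≤ (q:ℝ)*(C*y*(2*j^4/y^3)) := by gcongr
      _ = _ := by rw [hR]; field_simp
  have c3 : |S - Cmain*Pr*R| ≤ (5+2*C)*R/y^2 := by
    refine (abs_sub_le _ _ _).trans ((add_le_add c1 c2).trans (le_of_eq ?_)); ring
  have y2 : 1 ≤ y^2 := one_le_pow₀ hy1
  have c4 : S ≤ (Cmain + (5+2*C))*R := by
    have h1 := (abs_le.1 c3).2
    have h2 : (5+2*C)*R/y^2 ≤ (5+2*C)*R := div_le_self (by positivity) y2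
    have h3 : Cmain*Pr*R ≤ Cmain*1*R := by gcongr
    linarith
  have c5 : S/y^3 ≤ (Cmain + (5+2*C))*R/y^2 := by
    calc S/y^3 ≤ (Cmain + (5+2*C))*R/y^3 := by gcongr
      _ ≤ _ := by gcongr <;> first | exact hy1 | norm_num
  have c6 : (y^3+1)*G ≤ 252*R/y^2 := by
    have : 1 ≤ y^3 := one_le_pow₀ hy1
    calc (y^3+1)*G ≤ (y^3+y^3)*(126*R/y^6) := by gcongr
      _ = 252*R/y^3 := by field_simp; norm_num
      _ ≤ _ := by gcongr <;> first | exact hy1 | norm_num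
  calc _ ≤ |M2 X q - S| + |S - Cmain*Pr*R| := abs_sub_le _ _ _
    _ ≤ ((Cmain + (5+2*C))*R/y^2 + 252*R/y^2) + (5+2*C)*R/y^2 :=
        add_le_add (hsp.trans (add_le_add c5 c6)) c3
    _ = _ := by ring

end SqV

open SqV in
/-- `M₂(X,q) ∼ C·∏_{p∣q}(1+2/p)^{-1}·X^{1/2}q^{1/2}` as `X → ∞`, uniformly for
`X^{31/41+ε} ≤ q ≤ X^{1−ε}`. -/
theorem statement2 (ε : ℝ) (hε : 0 < ε) :
    ∀ δ : ℝ, 0 < δ → ∃ X₀ : ℝ, ∀ X : ℝ, X₀ ≤ X → ∀ q : ℕ, 1 ≤ q →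
      X ^ ((31 : ℝ)/41 + ε) ≤ (q : ℝ) → (q : ℝ) ≤ X ^ (1 - ε) →
      |M2 X q - Cmain * (∏ p ∈ q.primeFactors, (1 + 2 * ((p : ℝ))⁻¹)⁻¹) *
          X ^ ((1 : ℝ)/2) * (q : ℝ) ^ ((1 : ℝ)/2)|
        ≤ δ * (Cmain * (∏ p ∈ q.primeFactors, (1 + 2 * ((p : ℝ))⁻¹)⁻¹) *
          X ^ ((1 : ℝ)/2) * (q : ℝ) ^ ((1 : ℝ)/2)) := by
  intro δ hδ
  obtain ⟨C0, hC0, hcore⟩ := core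
  set η := ε/40 with hη
  have hη0 : 0 < η := by positivity
  obtain ⟨Cd, hCd, hdiv⟩ := divisor_bound (η/2) (by positivity)
  have hCm := Cmain_pos
  have t1 := tendsto_rpow_atTop hη0
  have t2 := tendsto_rpow_atTop (half_pos hη0)
  have ev := ((Filter.eventually_ge_atTop (1:ℝ)).and (t1.eventually_ge_atTop 2)).and
    ((t2.eventually_ge_atTop Cd).and (t1.eventually_ge_atTop (C0/(δ*Cmain))))
  obtain ⟨X₀, hX₀⟩ := Filter.eventually_atTop.1 ev
  refine ⟨X₀, fun X hX q hq hq1 hq2 => ?_⟩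
  obtain ⟨⟨hX1, hy⟩, hyC, hyδ⟩ := hX₀ X hX
  have hX0 : 0 < X := by linarith
  have hq0 : (0:ℝ) < q := by exact_mod_cast hq
  set y := X^η with hyd
  have hy0 : 0 < y := by linarith
  set j := (X/q)^(1/8:ℝ) with hj
  have hK0 : 0 < X/q := by positivity
  have hj0 : 0 < j := by positivity
  have hj8 : j^8 = X/q := by
    rw [hj, ← Real.rpow_natCast, ← Real.rpow_mul hK0.le]; norm_num
  have hj4 : j^4 = (X/q)^(1/2:ℝ) := by
    rw [hj, ← Real.rpow_natCast, ← Real.rpow_mul hK0.le]; norm_num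
  have hXe : X = q*j^8 := by rw [hj8]; field_simp
  have hKe : X^ε ≤ X/q := by
    rw [le_div_iff₀ hq0]
    calc X^ε*q ≤ X^ε*X^(1-ε) := by gcongr
      _ = X := by rw [← Real.rpow_add hX0]; norm_num
  have hyj : y^5 ≤ j := by
    calc y^5 = (X^ε)^(1/8:ℝ) := by
          rw [hyd, hη, ← Real.rpow_natCast, ← Real.rpow_mul hX0.le, ← Real.rpow_mul hX0.le]
          congr 1; push_cast; ring
      _ ≤ j := by rw [hj]; gcongr
  have hr : j^12*y^20 ≤ √(q:ℝ) := by
    refine Real.le_sqrt_of_sq_le ?_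
    have e1 : (j^12*y^20)^2 = (X/q)^3*X^ε := by
      have : (j^12*y^20)^2 = (j^8)^3*y^40 := by ring
      rw [this, hj8]
      congr 1
      rw [hyd, hη, ← Real.rpow_natCast, ← Real.rpow_mul hX0.le]
      congr 1; push_cast; ring
    rw [e1, div_pow, div_mul_eq_mul_div, div_le_iff₀ (by positivity)]
    calc X^3*X^ε = X^(3+ε) := by rw [Real.rpow_add hX0]; norm_cast
      _ ≤ X^(((31:ℝ)/41+ε)*4) := Real.rpow_le_rpow_of_exponent_le hX1 (by linarith)
      _ = (X^((31:ℝ)/41+ε))^4 := by rw [Real.rpow_mul hX0.le]; norm_cast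
      _ ≤ (q:ℝ)^4 := by gcongr
      _ = _ := by ring
  have hτ : ∀ n : ℕ, 0 < n → n ≤ ⌊X⌋₊ → (n.divisors.card:ℝ) ≤ y := by
    intro n hn hnX
    have hnX' : (n:ℝ) ≤ X := (Nat.le_floor_iff hX0.le).1 hnX
    calc (n.divisors.card:ℝ) ≤ Cd*(n:ℝ)^(η/2) := hdiv n hn
      _ ≤ X^(η/2)*X^(η/2) := by gcongr
      _ = y := by rw [← Real.rpow_add hX0]; congr 1; ring
  have hc := hcore X q y j hq hy hyj hr hXe hτ
  have hqF : q ≤ ⌊X⌋₊ := by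
    refine Nat.le_floor (hq2.trans ?_)
    calc X^(1-ε) ≤ X^(1:ℝ) := Real.rpow_le_rpow_of_exponent_le hX1 (by linarith)
      _ = X := Real.rpow_one X
  have hτq := hτ q hq hqF
  have hpl := prod_lower q hq
  set Pr := ∏ p ∈ q.primeFactors, (1 + 2 * ((p : ℝ))⁻¹)⁻¹ with hPr
  have hPrl : 1/y ≤ Pr := by
    refine le_trans ?_ hpl
    have : (0:ℝ) < q.divisors.card := by
      exact_mod_cast Finset.card_pos.2 ⟨1, Nat.one_mem_divisors.2 (by omega)⟩
    exact one_div_le_one_div_of_le this hτq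
  have hR : X^((1:ℝ)/2)*(q:ℝ)^((1:ℝ)/2) = q*j^4 := by
    rw [hj4, Real.div_rpow hX0.le hq0.le]
    have : (q:ℝ) = (q:ℝ)^((1:ℝ)/2)*(q:ℝ)^((1:ℝ)/2) := by
      rw [← Real.rpow_add hq0]; norm_num
    have h0 : 0 < (q:ℝ)^((1:ℝ)/2) := by positivity
    rw [mul_div_assoc', eq_div_iff h0.ne', mul_assoc, ← this]; ring
  rw [mul_assoc (Cmain*Pr), hR]
  refine hc.trans ?_
  set R := (q:ℝ)*j^4 with hRd
  have hR0 : 0 < R := by positivity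
  have h1 : C0 ≤ δ*Cmain*y := by
    rw [div_le_iff₀ (by positivity)] at hyδ; linarith
  calc C0*R/y^2 ≤ (δ*Cmain*y)*R/y^2 := by gcongr
    _ = δ*(Cmain*(1/y)*R) := by field_simp
    _ ≤ _ := by gcongr
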